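/- Assume Hypothesis 3.1. Let λ > 0, s ∈ [0,T], ν ∈ K^λ, and let F₀ : [0,T] × H → H satisfy Hypothesis 3.3 (with F₀ in place of F). Let f ∈ C¹_u(H) and let u₀ ∈ D(V) satisfy ‖u₀‖_∞ ≤ (1/λ)‖f‖_∞, D_x u₀ ∈ C([0,T]; C_u(H,H)), and λu₀ − Vu₀ − ⟨F₀, D_x u₀⟩ = f. Then u₀ ∈ D(L^ν) and λu₀ − L^ν u₀ = f + ⟨F₀ − F, D_x u₀⟩ as elements of L²([s,T]×H; ν). -/

import Mathlib

open MeasureTheory Set Filter Topology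
open scoped InnerProductSpace ENNReal NNReal

attribute [local instance] Classical.propDecidable

noncomputable section

variable (H : Type) [NormedAddCommGroup H] [InnerProductSpace ℝ H] [CompleteSpace H]
  [SecondCountableTopology H] [MeasurableSpace H] [BorelSpace H]

/-- All data of the framework: the `C₀`-semigroup `e^{tA}` with its generator `A`
(a densely defined unbounded operator), the diffusion operator `C` (symmetric, nonnegative)
with a square root `C^{1/2}`, a Hilbert basis of `H`, the time horizon `T > 0`, and the
Borel measurable drift `F` defined on a Borel set `DF ⊆ [0,T] × H`. -/
structure FPData where
  T : ℝ
  hT : 0 < T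
  S : ℝ → H →L[ℝ] H
  S_zero : S 0 = 1
  S_add : ∀ s t : ℝ, 0 ≤ s → 0 ≤ t → S (s + t) = (S s).comp (S t)
  S_cont : ∀ x : H, ContinuousOn (fun t => S t x) (Ici (0 : ℝ))
  A : H →ₗ.[ℝ] H
  A_dense : Dense (A.domain : Set H)
  A_mem_iff : ∀ x : H, x ∈ A.domain ↔
    ∃ y : H, Tendsto (fun t : ℝ => t⁻¹ • (S t x - x)) (𝓝[>] 0) (𝓝 y)
  A_gen : ∀ x : A.domain,
    Tendsto (fun t : ℝ => t⁻¹ • (S t (x : H) - (x : H))) (𝓝[>] 0) (𝓝 (A x))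
  C : H →L[ℝ] H
  C_pos : C.IsPositive
  sqrtC : H →L[ℝ] H
  sqrtC_pos : sqrtC.IsPositive
  sqrtC_sq : sqrtC.comp sqrtC = C
  ι : Type
  basis : HilbertBasis ι ℝ H
  F : ℝ × H → H
  DF : Set (ℝ × H)
  DF_meas : MeasurableSet DF
  F_meas : Measurable F

variable {H}

/-- The spatial gradient `D_x u(t,x)` of a function `u : ℝ × H → ℝ`. -/
def xGrad (u : ℝ × H → ℝ) (p : ℝ × H) : H :=
  gradient (fun z => u (p.1, z)) p.2

/-- The set `Sf` of functions is dense in `L¹([s,T] × H, μ)`. -/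
def DenseRangeL1 (μ : Measure (ℝ × H)) (Sf : Set (ℝ × H → ℝ)) : Prop :=
  ∀ f : ℝ × H → ℝ, Integrable f μ → ∀ ε > 0,
    ∃ g ∈ Sf, Integrable g μ ∧ ∫ p, |f p - g p| ∂μ < ε

namespace FPData

variable (D : FPData H)

/-- `h ∈ C¹([0,T]; D(A*))`, represented by the pair `(h, g)` with `g t = A* (h t)`. -/
def CinDAstar (h g : ℝ → H) : Prop :=
  ContDiffOn ℝ 1 h (Icc 0 D.T) ∧ ContDiffOn ℝ 1 g (Icc 0 D.T) ∧
    ∀ t ∈ Icc 0 D.T, (h t, g t) ∈ D.A.adjoint.graph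

/-- Generators of `E_A([0,T] × H)`: real parts of `φ(t) e^{i⟨x, h(t)⟩}`. -/
def EAgen : Set (ℝ × H → ℝ) :=
  {u | ∃ (φ : ℝ → ℝ) (h g : ℝ → H), ContDiffOn ℝ 1 φ (Icc 0 D.T) ∧ φ D.T = 0 ∧
    D.CinDAstar h g ∧
    (u = (fun p => φ p.1 * Real.cos ⟪p.2, h p.1⟫_ℝ) ∨
     u = (fun p => φ p.1 * Real.sin ⟪p.2, h p.1⟫_ℝ))}

/-- The space of test functions `E_A([0,T] × H) = D(L₀)`: the linear span of the generators. -/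
def EA : Set (ℝ × H → ℝ) := ↑(Submodule.span ℝ D.EAgen)

/-- The trace term `Tr[C D²_x u(t,x)] = Σ_i ⟨D²_x u(t,x)(C^{1/2} e_i), C^{1/2} e_i⟩`. -/
def traceCD2 (u : ℝ × H → ℝ) (p : ℝ × H) : ℝ :=
  ∑' i : D.ι,
    ⟪(fderiv ℝ (gradient fun z => u (p.1, z)) p.2) (D.sqrtC (D.basis i)),
      D.sqrtC (D.basis i)⟫_ℝ

/-- The Ornstein–Uhlenbeck part `V₀u = D_t u + (1/2)Tr[C D²_x u] + ⟨x, A* D_x u⟩`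
of the Kolmogorov operator. -/
def Vzero (u : ℝ × H → ℝ) (p : ℝ × H) : ℝ :=
  deriv (fun r => u (r, p.2)) p.1 + (1 / 2) * D.traceCD2 u p +
    (if hk : xGrad u p ∈ D.A.adjoint.domain then ⟪p.2, D.A.adjoint ⟨xGrad u p, hk⟩⟫_ℝ
     else 0)

/-- The Kolmogorov operator `L₀u = V₀u + ⟨F(t,x), D_x u⟩`. -/
def Lzero (u : ℝ × H → ℝ) (p : ℝ × H) : ℝ :=
  D.Vzero u p + ⟪D.F p, xGrad u p⟫_ℝ

/-- `|F(t,x)|`, with the convention `|F(t,x)| = +∞` outside `D(F)`. -/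
def FnormE (p : ℝ × H) : ℝ≥0∞ := if p ∈ D.DF then (‖D.F p‖₊ : ℝ≥0∞) else ⊤

/-- Condition (1.6): `∫ (|⟨y, A*h(t)⟩| + |F(t,y)|) dμ < ∞` for all `h ∈ C¹([0,T]; D(A*))`. -/
def DriftIntegrable (μ : Measure (ℝ × H)) : Prop :=
  ∀ h g : ℝ → H, D.CinDAstar h g →
    ∫⁻ p, ((‖⟪p.2, g p.1⟫_ℝ‖₊ : ℝ≥0∞) + D.FnormE p) ∂μ < ⊤

/-- `μ(dt,dx) = μ_t(dx) dt` on `[s,T] × H` for a measurable kernel `(μ_t)`. -/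
def IsKernel (s : ℝ) (μ : Measure (ℝ × H)) (μt : ℝ → Measure H) : Prop :=
  (∀ B : Set H, MeasurableSet B → Measurable fun t => μt t B) ∧
  ∀ E : Set (ℝ × H), MeasurableSet E → μ E = ∫⁻ t in Icc s D.T, μt t {x | (t, x) ∈ E}

/-- `μ = μ_t dt` is a solution of the Fokker–Planck equation (1.5) with initial condition
`ζ` at time `s` (membership in `M_{s,ζ}`). -/
def IsFPSol (s : ℝ) (ζ : Measure H) (μ : Measure (ℝ × H)) (μt : ℝ → Measure H) : Prop :=
  (∀ t ∈ Icc s D.T, IsProbabilityMeasure (μt t)) ∧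
  D.IsKernel s μ μt ∧ D.DriftIntegrable μ ∧
  ∀ u ∈ D.EA, ∀ᵐ t ∂(volume.restrict (Icc s D.T)),
    ∫ y, u (t, y) ∂(μt t) =
      ∫ y, u (s, y) ∂ζ + ∫ r in Icc s t, (∫ y, D.Lzero u (r, y) ∂(μt r))

/-- The set `M_{s,ζ}` of solutions of the Fokker–Planck equation. -/
def Mset (s : ℝ) (ζ : Measure H) : Set (Measure (ℝ × H)) :=
  {μ | ∃ μt : ℝ → Measure H, D.IsFPSol s ζ μ μt}

/-- Membership in `M_s^λ` (formula (4.2)): `ν = ν_t dt` is a finite nonnegative measure with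
`∫ L₀ u dν ≤ 2λ ∫ u dν` for all nonnegative `u ∈ E_A`. -/
def IsSubInv (lam s : ℝ) (ν : Measure (ℝ × H)) (νt : ℝ → Measure H) : Prop :=
  (∀ t ∈ Icc s D.T, IsFiniteMeasure (νt t)) ∧
  D.IsKernel s ν νt ∧ D.DriftIntegrable ν ∧
  ∀ u ∈ D.EA, (∀ p : ℝ × H, p.1 ∈ Icc 0 D.T → 0 ≤ u p) →
    ∫ t in Icc s D.T, (∫ y, D.Lzero u (t, y) ∂(νt t)) ≤
      2 * lam * ∫ t in Icc s D.T, (∫ y, u (t, y) ∂(νt t))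

/-- The moment condition `∫_s^T ∫_H (|x|⁴ + |F(t,x)|² + |x|⁴|F(t,x)|²) ν_t(dx) dt < ∞`. -/
def moment2 (s : ℝ) (νt : ℝ → Measure H) : Prop :=
  ∫⁻ t in Icc s D.T, (∫⁻ y, (ENNReal.ofReal (‖y‖ ^ 4) + (D.FnormE (t, y)) ^ 2 +
    ENNReal.ofReal (‖y‖ ^ 4) * (D.FnormE (t, y)) ^ 2) ∂(νt t)) < ⊤

/-- The moment condition `∫_s^T ∫_H (|x|² + |F(t,x)| + |x|²|F(t,x)|) ν_t(dx) dt < ∞`. -/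
def moment1 (s : ℝ) (νt : ℝ → Measure H) : Prop :=
  ∫⁻ t in Icc s D.T, (∫⁻ y, (ENNReal.ofReal (‖y‖ ^ 2) + D.FnormE (t, y) +
    ENNReal.ofReal (‖y‖ ^ 2) * D.FnormE (t, y)) ∂(νt t)) < ⊤

/-- Hypothesis 3.1: dissipativity of `A`, trace class `Q_t = ∫_0^t e^{sA} C e^{sA*} ds`,
and the smoothing condition `e^{tA}(H) ⊆ Q_t^{1/2}(H)` with `Λ_t := (Q_t^{1/2})^{-1} e^{tA}`
satisfying `∫_0^∞ e^{-λt} ‖Λ_t‖ dt < ∞` for `λ` large enough. -/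
structure Hyp31 where
  ω : ℝ
  A_diss : ∀ x : D.A.domain, ⟪D.A x, (x : H)⟫_ℝ ≤ ω * ‖(x : H)‖ ^ 2
  Q : ℝ → H →L[ℝ] H
  Q_def : ∀ t : ℝ, 0 < t → ∀ x : H,
    Q t x = ∫ r in (0 : ℝ)..t, D.S r (D.C ((ContinuousLinearMap.adjoint (D.S r)) x))
  Q_pos : ∀ t : ℝ, 0 < t → (Q t).IsPositive
  Q_traceClass : ∀ t : ℝ, 0 < t → Summable fun i : D.ι => ⟪Q t (D.basis i), D.basis i⟫_ℝ
  sqrtQ : ℝ → H →L[ℝ] H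
  sqrtQ_pos : ∀ t : ℝ, 0 < t → (sqrtQ t).IsPositive
  sqrtQ_sq : ∀ t : ℝ, 0 < t → (sqrtQ t).comp (sqrtQ t) = Q t
  range_incl : ∀ t : ℝ, 0 < t → Set.range (D.S t) ⊆ Set.range (sqrtQ t)
  Λ : ℝ → H →L[ℝ] H
  Λ_spec : ∀ t : ℝ, 0 < t → (sqrtQ t).comp (Λ t) = D.S t
  lam₀ : ℝ
  Λ_int : ∀ lam : ℝ, lam₀ ≤ lam →
    IntegrableOn (fun t => Real.exp (-lam * t) * ‖Λ t‖) (Ioi 0)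

/-- Hypothesis 5.1: `F(t,·)` is the minimal section of an `m`-dissipative graph
`F̄(t,·)`, with `F(t,0) = 0`. -/
structure Hyp51 where
  Fbar : ℝ → H → Set H
  dom_meas : ∀ t ∈ Icc 0 D.T, MeasurableSet {x : H | (Fbar t x).Nonempty}
  K : ℝ
  K_pos : 0 < K
  diss : ∀ t ∈ Icc 0 D.T, ∀ x y u v : H, u ∈ Fbar t x → v ∈ Fbar t y →
    ⟪u - v, x - y⟫_ℝ ≤ K * ‖x - y‖ ^ 2
  mrange : ∀ t ∈ Icc 0 D.T, ∀ lam : ℝ, K < lam → ∀ z : H,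
    ∃ x : H, ∃ w ∈ Fbar t x, lam • x - w = z
  dom_eq : ∀ t ∈ Icc 0 D.T, ∀ x : H, (t, x) ∈ D.DF ↔ (Fbar t x).Nonempty
  minimal : ∀ t ∈ Icc 0 D.T, ∀ x : H, (t, x) ∈ D.DF →
    D.F (t, x) ∈ Fbar t x ∧ ∀ w ∈ Fbar t x, ‖D.F (t, x)‖ ≤ ‖w‖
  zero_mem : ∀ t ∈ Icc 0 D.T, (t, (0 : H)) ∈ D.DF ∧ D.F (t, 0) = 0

/-- Hypothesis 3.3 for a drift `F₀ : [0,T] × H → H`: continuity, continuous space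
derivative, and uniform Lipschitz continuity in the space variable. -/
def Hyp33 (F0 : ℝ × H → H) : Prop :=
  ContinuousOn F0 (Icc 0 D.T ×ˢ (univ : Set H)) ∧
  (∀ t ∈ Icc 0 D.T, ∀ x : H, DifferentiableAt ℝ (fun y => F0 (t, y)) x) ∧
  (∀ t ∈ Icc 0 D.T, Continuous fun x : H => fderiv ℝ (fun y => F0 (t, y)) x) ∧
  ∃ K > 0, ∀ t ∈ Icc 0 D.T, ∀ x y : H, ‖F0 (t, x) - F0 (t, y)‖ ≤ K * ‖x - y‖

/-- The data of the Ornstein–Uhlenbeck semigroup: the Gaussian measures `N_{Q_t}`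
(specified through their characteristic functionals). -/
structure OUData (hyp : D.Hyp31) where
  N : ℝ → Measure H
  N_prob : ∀ t : ℝ, 0 ≤ t → IsProbabilityMeasure (N t)
  N_zero : N 0 = Measure.dirac 0
  N_char : ∀ t : ℝ, 0 < t → ∀ h : H,
    ∫ x, Complex.exp ((⟪x, h⟫_ℝ : ℂ) * Complex.I) ∂(N t) =
      Complex.exp (-((⟪hyp.Q t h, h⟫_ℝ : ℂ)) / 2)

end FPData

namespace FPData.OUData

variable {H : Type} [NormedAddCommGroup H] [InnerProductSpace ℝ H] [CompleteSpace H]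
  [SecondCountableTopology H] [MeasurableSpace H] [BorelSpace H]
  {D : FPData H} {hyp : D.Hyp31}

/-- The Ornstein–Uhlenbeck semigroup `R_t φ(x) = ∫_H φ(e^{tA} x + y) N_{Q_t}(dy)`. -/
def Rop (O : D.OUData hyp) (t : ℝ) (φ : H → ℝ) (x : H) : ℝ :=
  ∫ y, φ (D.S t x + y) ∂(O.N t)

/-- The resolvent `G̃_λ f(x) = ∫_0^∞ e^{-λt} R_t f(x) dt` of the OU semigroup. -/
def Gtilde (O : D.OUData hyp) (lam : ℝ) (f : H → ℝ) (x : H) : ℝ :=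
  ∫ t in Ioi (0 : ℝ), Real.exp (-lam * t) * O.Rop t f x

/-- The resolvent `G_λ f(t,x) = ∫_t^T e^{-λ(r-t)} R_{r-t} f(r,·)(x) dr` of the
time-dependent OU operator `V`; by definition `u ∈ D(V)` iff `u = G_λ f` for some `λ` and
some `f ∈ C([0,T]; C_{u,2}(H))`, and then `Vu = λu - f`. -/
def Gop (O : D.OUData hyp) (lam : ℝ) (f : ℝ → H → ℝ) (p : ℝ × H) : ℝ :=
  ∫ r in p.1..D.T, Real.exp (-lam * (r - p.1)) * O.Rop (r - p.1) (f r) p.2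

end FPData.OUData

section Spaces

variable {H : Type} [NormedAddCommGroup H] [InnerProductSpace ℝ H] [CompleteSpace H]

/-- Membership in `C_{u,2}(H)`: `x ↦ φ(x)/(1+|x|²)` is uniformly continuous and bounded. -/
def MemCu2 (φ : H → ℝ) : Prop :=
  UniformContinuous (fun x : H => φ x / (1 + ‖x‖ ^ 2)) ∧
    ∃ M : ℝ, ∀ x : H, |φ x| ≤ M * (1 + ‖x‖ ^ 2)

/-- The norm of `C_{u,2}(H)`: `‖φ‖ = sup_x |φ(x)|/(1+|x|²)`. -/
def cu2Norm (φ : H → ℝ) : ℝ := ⨆ x : H, |φ x| / (1 + ‖x‖ ^ 2)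

/-- The sup norm `‖f‖_∞ = sup_x |f(x)|`. -/
def supNorm (f : H → ℝ) : ℝ := ⨆ x : H, |f x|

/-- Membership in `C¹_u(H)`: bounded and uniformly continuous together with the
(Fréchet) derivative. -/
def MemC1u (φ : H → ℝ) : Prop :=
  UniformContinuous φ ∧ (∃ M : ℝ, ∀ x : H, |φ x| ≤ M) ∧ Differentiable ℝ φ ∧
    UniformContinuous (gradient φ) ∧ ∃ M : ℝ, ∀ x : H, ‖gradient φ x‖ ≤ M

/-- Membership in `C_u(H,H)`: bounded and uniformly continuous `H → H`. -/
def MemCuHH (Φ : H → H) : Prop := UniformContinuous Φ ∧ ∃ M : ℝ, ∀ x : H, ‖Φ x‖ ≤ M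

end Spaces

namespace FPData

variable {H : Type} [NormedAddCommGroup H] [InnerProductSpace ℝ H] [CompleteSpace H]
  [SecondCountableTopology H] [MeasurableSpace H] [BorelSpace H] (D : FPData H)

/-- Membership in `C([0,T]; C_{u,2}(H))`. -/
def MemCT (f : ℝ → H → ℝ) : Prop :=
  (∀ t ∈ Icc 0 D.T, MemCu2 (f t)) ∧
  ∀ t₀ ∈ Icc 0 D.T, ∀ ε > 0, ∃ δ > 0, ∀ t ∈ Icc 0 D.T, |t - t₀| < δ →
    ∀ x : H, |f t x - f t₀ x| ≤ ε * (1 + ‖x‖ ^ 2)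

/-- Membership in `C([0,T]; C¹_u(H))`. -/
def MemCTC1u (f : ℝ → H → ℝ) : Prop :=
  (∀ t ∈ Icc 0 D.T, MemC1u (f t)) ∧
  ∀ t₀ ∈ Icc 0 D.T, ∀ ε > 0, ∃ δ > 0, ∀ t ∈ Icc 0 D.T, |t - t₀| < δ →
    ∀ x : H, |f t x - f t₀ x| + ‖gradient (f t) x - gradient (f t₀) x‖ ≤ ε

/-- `D_x u ∈ C([0,T]; C_u(H,H))`. -/
def GradInCTCuHH (u : ℝ × H → ℝ) : Prop :=
  (∀ t ∈ Icc 0 D.T, MemCuHH fun x : H => xGrad u (t, x)) ∧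
  ∀ t₀ ∈ Icc 0 D.T, ∀ ε > 0, ∃ δ > 0, ∀ t ∈ Icc 0 D.T, |t - t₀| < δ →
    ∀ x : H, ‖xGrad u (t, x) - xGrad u (t₀, x)‖ ≤ ε

end FPData

end

set_option linter.unusedSectionVars false

/-- The smallest class of functions that contains `cos (ℓ + c)` for `ℓ ∈ L` and is closed under
linear combinations and bounded pointwise limits. -/
inductive TrigClosure {E : Type*} (L : Submodule ℝ (E → ℝ)) : (E → ℝ) → Prop
  | cos (ℓ : E → ℝ) (hℓ : ℓ ∈ L) (c : ℝ) : TrigClosure L fun x => Real.cos (ℓ x + c)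
  | add (f g : E → ℝ) (hf : TrigClosure L f) (hg : TrigClosure L g) :
      TrigClosure L fun x => f x + g x
  | smul (a : ℝ) (f : E → ℝ) (hf : TrigClosure L f) : TrigClosure L fun x => a * f x
  | lim (f : ℕ → E → ℝ) (g : E → ℝ) (M : ℝ) (hf : ∀ n, TrigClosure L (f n))
      (hM : ∀ n x, |f n x| ≤ M) (hlim : ∀ x, Tendsto (fun n => f n x) atTop (𝓝 (g x))) :
      TrigClosure L g

namespace TrigClosure

variable {E : Type*} {L : Submodule ℝ (E → ℝ)}

theorem bounded {f : E → ℝ} (hf : TrigClosure L f) : ∃ M, ∀ x, |f x| ≤ M := by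
  induction hf with
  | cos ℓ hℓ c => exact ⟨1, fun x => Real.abs_cos_le_one _⟩
  | add f g _ _ h1 h2 =>
    obtain ⟨M, hM⟩ := h1
    obtain ⟨N, hN⟩ := h2
    exact ⟨M + N, fun x => (abs_add_le _ _).trans (add_le_add (hM x) (hN x))⟩
  | smul a f _ h =>
    obtain ⟨M, hM⟩ := h
    exact ⟨|a| * M, fun x => by
      rw [abs_mul]; exact mul_le_mul_of_nonneg_left (hM x) (abs_nonneg a)⟩
  | lim f g M _ hM hlim _ =>
    exact ⟨M, fun x => le_of_tendsto (hlim x).abs (Eventually.of_forall fun n => hM n x)⟩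

theorem cos_mul {ℓ : E → ℝ} (hℓ : ℓ ∈ L) (c : ℝ) {g : E → ℝ} (hg : TrigClosure L g) :
    TrigClosure L fun x => Real.cos (ℓ x + c) * g x := by
  induction hg with
  | cos m hm d =>
    have h := smul (1 / 2) _ (add _ _ (cos (ℓ + m) (L.add_mem hℓ hm) (c + d))
      (cos (ℓ - m) (L.sub_mem hℓ hm) (c - d)))
    convert h using 2 with x
    have h1 : (ℓ + m) x + (c + d) = (ℓ x + c) + (m x + d) := by simp; ring
    have h2 : (ℓ - m) x + (c - d) = (ℓ x + c) - (m x + d) := by simp; ring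
    rw [h1, h2, Real.cos_add (ℓ x + c), Real.cos_sub (ℓ x + c)]
    ring
  | add f g _ _ h1 h2 => simpa only [mul_add] using add _ _ h1 h2
  | smul a f _ h => simpa only [mul_left_comm] using smul a _ h
  | lim f g M _ hM hlim h =>
    refine lim _ _ M h (fun n x => ?_) fun x => (hlim x).const_mul _
    rw [abs_mul]
    exact (mul_le_of_le_one_left (abs_nonneg _) (Real.abs_cos_le_one _)).trans (hM n x)

theorem mul {f g : E → ℝ} (hf : TrigClosure L f) (hg : TrigClosure L g) :
    TrigClosure L fun x => f x * g x := by
  induction hf with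
  | cos ℓ hℓ c => exact cos_mul hℓ c hg
  | add f₁ f₂ _ _ h1 h2 => simpa only [add_mul] using add _ _ h1 h2
  | smul a f _ h => simpa only [mul_assoc] using smul a _ h
  | lim f f' M _ hM hlim h =>
    obtain ⟨N, hN⟩ := hg.bounded
    refine lim _ _ (M * N) h (fun n x => ?_) fun x => (hlim x).mul_const _
    rw [abs_mul]
    exact mul_le_mul (hM n x) (hN x) (abs_nonneg _) ((abs_nonneg _).trans (hM n x))

theorem const (a : ℝ) : TrigClosure L fun _ : E => a := by
  simpa using smul a _ (cos 0 L.zero_mem 0)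

theorem polynomial_comp {f : E → ℝ} (hf : TrigClosure L f) (p : Polynomial ℝ) :
    TrigClosure L fun x => p.eval (f x) := by
  induction p using Polynomial.induction_on with
  | C a => simpa using const a
  | add p q hp hq => simpa using add _ _ hp hq
  | monomial n a h =>
    have h2 := mul h hf
    convert h2 using 2 with x
    simp [pow_succ, mul_assoc]

theorem continuous_comp {f : E → ℝ} (hf : TrigClosure L f) {ψ : ℝ → ℝ} (hψ : Continuous ψ) :
    TrigClosure L fun x => ψ (f x) := by
  obtain ⟨M, hM⟩ := hf.bounded
  have hex : ∀ n : ℕ, ∃ p : Polynomial ℝ, ∀ x ∈ Icc (-M) M,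
      |p.eval x - ψ x| < 1 / ((n : ℝ) + 1) := fun n =>
    exists_polynomial_near_of_continuousOn _ _ ψ hψ.continuousOn _ Nat.one_div_pos_of_nat
  choose p hp using hex
  obtain ⟨B, hB⟩ := (isCompact_Icc (a := -M) (b := M)).exists_bound_of_continuousOn
    hψ.continuousOn
  have hmem : ∀ x, f x ∈ Icc (-M) M := fun x => abs_le.mp (hM x)
  refine lim (fun n x => (p n).eval (f x)) _ (1 + B) (fun n => hf.polynomial_comp _)
    (fun n x => ?_) fun x => ?_
  · have h1 := hp n _ (hmem x)
    have h2 := hB _ (hmem x)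
    have h3 : 1 / ((n : ℝ) + 1) ≤ 1 := by
      rw [div_le_one (by positivity)]; linarith [Nat.cast_nonneg (α := ℝ) n]
    calc |(p n).eval (f x)| = |((p n).eval (f x) - ψ (f x)) + ψ (f x)| := by rw [sub_add_cancel]
      _ ≤ _ := abs_add_le _ _
      _ ≤ 1 + B := add_le_add (h1.le.trans h3) h2
  · rw [tendsto_iff_dist_tendsto_zero]
    exact squeeze_zero (fun _ => dist_nonneg) (fun n => (hp n _ (hmem x)).le)
      tendsto_one_div_add_atTop_nhds_zero_nat

theorem bounded_continuous_comp {ℓ : E → ℝ} (hℓ : ℓ ∈ L) {ψ : ℝ → ℝ} (hψ : Continuous ψ)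
    {M : ℝ} (hM : ∀ s, |ψ s| ≤ M) : TrigClosure L fun x => ψ (ℓ x) := by
  refine lim (fun n x => ψ ((n + 1) * Real.arcsin (Real.sin (ℓ x / (n + 1))))) _ M
    (fun n => ?_) (fun n x => hM _) fun x => ?_
  · have h1 : TrigClosure L fun x => Real.sin (ℓ x / (n + 1)) := by
      have := cos (((n : ℝ) + 1)⁻¹ • ℓ) (L.smul_mem _ hℓ) (-(Real.pi / 2))
      convert this using 2 with x
      rw [← sub_eq_add_neg, Real.cos_sub_pi_div_two]
      congr 1
      simp [div_eq_inv_mul]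
    exact h1.continuous_comp (ψ := fun s => ψ ((n + 1) * Real.arcsin s)) (by fun_prop)
  · refine tendsto_const_nhds.congr' ?_
    have h1 : Tendsto (fun n : ℕ => ℓ x / ((n : ℝ) + 1)) atTop (𝓝 0) := by
      have := tendsto_one_div_add_atTop_nhds_zero_nat (𝕜 := ℝ) |>.const_mul (ℓ x)
      simpa [div_eq_mul_inv] using this
    have hpi : (0 : ℝ) < Real.pi / 2 := by positivity
    filter_upwards [h1.eventually (Icc_mem_nhds (neg_lt_zero.mpr hpi) hpi)] with n hn
    rw [Real.arcsin_sin hn.1 hn.2]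
    congr 1
    field_simp

theorem indicator_lt {ℓ : E → ℝ} (hℓ : ℓ ∈ L) (c : ℝ) :
    TrigClosure L (indicator {x | ℓ x < c} 1) := by
  refine lim (fun (n : ℕ) x => min 1 (max 0 (n * (c - ℓ x)))) _ 1 (fun n => ?_) (fun n x => ?_)
    fun x => ?_
  · have habs : ∀ s, |min 1 (max 0 ((n : ℝ) * (c - s)))| ≤ 1 := fun s => by
      rw [abs_of_nonneg (le_min zero_le_one (le_max_left _ _))]
      exact min_le_left _ _
    exact bounded_continuous_comp hℓ (ψ := fun s => min 1 (max 0 ((n : ℝ) * (c - s))))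
      (by fun_prop) habs
  · rw [abs_of_nonneg (le_min zero_le_one (le_max_left _ _))]
    exact min_le_left _ _
  · refine tendsto_const_nhds.congr' ?_
    by_cases h : ℓ x < c
    · obtain ⟨N, hN⟩ := exists_nat_gt (1 / (c - ℓ x))
      filter_upwards [eventually_ge_atTop N] with n hn
      have hpos : 0 < c - ℓ x := sub_pos.mpr h
      have h1 : 1 ≤ (n : ℝ) * (c - ℓ x) := by
        rw [div_lt_iff₀ hpos] at hN
        exact hN.le.trans (mul_le_mul_of_nonneg_right (by exact_mod_cast hn) hpos.le)
      rw [max_eq_right (zero_le_one.trans h1), min_eq_left h1]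
      simp [h]
    · filter_upwards with n
      have h1 : (n : ℝ) * (c - ℓ x) ≤ 0 :=
        mul_nonpos_of_nonneg_of_nonpos (Nat.cast_nonneg n) (by linarith)
      simp [h, max_eq_left h1]

/-- The `σ`-algebra of sets whose indicator lies in the closure. -/
@[reducible]
def measurableSpace (L : Submodule ℝ (E → ℝ)) : MeasurableSpace E where
  MeasurableSet' s := TrigClosure L (indicator s 1)
  measurableSet_empty := by
    have h := const (L := L) 0
    convert h using 1
    ext x
    simp
  measurableSet_compl s hs := by
    have h := add _ _ (const 1) (smul (-1) _ hs)
    convert h using 1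
    ext x
    by_cases hx : x ∈ s <;> simp [hx]
  measurableSet_iUnion s hs := by
    have hU : ∀ n : ℕ, TrigClosure L (indicator (⋃ i < n, s i) 1) := by
      intro n
      induction n with
      | zero =>
        have h := const (L := L) 0
        convert h using 1
        ext x
        simp
      | succ n ih =>
        have h := add _ _ (add _ _ ih (hs n)) (smul (-1) _ (mul ih (hs n)))
        convert h using 1
        ext x
        rw [biUnion_lt_succ]
        by_cases h1 : x ∈ ⋃ i < n, s i
        · by_cases h2 : x ∈ s n <;> simp [indicator, h1, h2]
        · by_cases h2 : x ∈ s n <;> simp only [indicator, mem_union, h1, h2] <;> simp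
    refine lim _ _ 1 hU (fun n x => ?_) fun x => ?_
    · by_cases h1 : x ∈ ⋃ i < n, s i <;> simp only [indicator, h1] <;> simp
    · refine tendsto_const_nhds.congr' ?_
      by_cases hx : x ∈ ⋃ i, s i
      · obtain ⟨i, hi⟩ := mem_iUnion.mp hx
        filter_upwards [eventually_gt_atTop i] with n hn
        rw [indicator_of_mem hx, indicator_of_mem (mem_iUnion₂.mpr ⟨i, hn, hi⟩)]
      · filter_upwards with n
        rw [indicator_of_notMem hx, indicator_of_notMem]
        exact fun h => hx (iUnion₂_subset_iUnion _ _ h)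

theorem of_measurable [m : MeasurableSpace E]
    (hL : ∀ m' : MeasurableSpace E, (∀ ℓ ∈ L, Measurable[m'] ℓ) → m ≤ m')
    {g : E → ℝ} (hg : Measurable g) {M : ℝ} (hM : ∀ x, |g x| ≤ M) : TrigClosure L g := by
  have hle : m ≤ measurableSpace L := by
    refine hL _ fun ℓ hℓ => ?_
    refine @measurable_of_Iio ℝ E _ _ _ (measurableSpace L) _ _ _ _ fun c => ?_
    exact indicator_lt hℓ c
  have hs : StronglyMeasurable g := hg.stronglyMeasurable
  have hsimple : ∀ φ : SimpleFunc E ℝ, TrigClosure L φ := by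
    intro φ
    induction φ using SimpleFunc.induction with
    | const c hs =>
      have h := smul c _ (hle _ hs)
      convert h using 1
      ext x
      simp [SimpleFunc.coe_piecewise, indicator, piecewise]
    | add _ h1 h2 => exact add _ _ h1 h2
  refine lim (fun n => hs.approxBounded M n) g (max M 0) (fun n => hsimple _) (fun n x => ?_)
    fun x => hs.tendsto_approxBounded_of_norm_le (hM x)
  rcases isEmpty_or_nonempty E with h | ⟨⟨x₀⟩⟩
  · exact h.elim x
  · exact (hs.norm_approxBounded_le ((abs_nonneg _).trans (hM x₀)) n x).trans (le_max_left _ _)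

/-- A functional monotone class theorem for characters: a property of functions that holds for
all `cos (ℓ + c)`, `ℓ ∈ L`, and is stable under linear combinations and bounded pointwise limits
holds for all bounded measurable functions. -/
theorem measurable_induction [m : MeasurableSpace E]
    (hL : ∀ m' : MeasurableSpace E, (∀ ℓ ∈ L, Measurable[m'] ℓ) → m ≤ m')
    (hLm : ∀ ℓ ∈ L, Measurable ℓ) (P : (E → ℝ) → Prop)
    (hcos : ∀ ℓ ∈ L, ∀ c : ℝ, P fun x => Real.cos (ℓ x + c))
    (hadd : ∀ f g : E → ℝ, Measurable f → Measurable g → (∃ M, ∀ x, |f x| ≤ M) →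
      (∃ M, ∀ x, |g x| ≤ M) → P f → P g → P fun x => f x + g x)
    (hsmul : ∀ (a : ℝ) (f : E → ℝ), Measurable f → (∃ M, ∀ x, |f x| ≤ M) → P f →
      P fun x => a * f x)
    (hlim : ∀ (f : ℕ → E → ℝ) (g : E → ℝ) (M : ℝ), (∀ n, Measurable (f n)) → Measurable g →
      (∀ n, P (f n)) → (∀ n x, |f n x| ≤ M) →
      (∀ x, Tendsto (fun n => f n x) atTop (𝓝 (g x))) → P g)
    {g : E → ℝ} (hg : Measurable g) {M : ℝ} (hM : ∀ x, |g x| ≤ M) : P g := by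
  suffices h : Measurable g ∧ P g from h.2
  have hT := of_measurable hL hg hM
  clear hg hM
  induction hT with
  | cos ℓ hℓ c => exact ⟨Real.measurable_cos.comp ((hLm ℓ hℓ).add_const c), hcos ℓ hℓ c⟩
  | add f g hf hg h1 h2 =>
    exact ⟨h1.1.add h2.1, hadd f g h1.1 h2.1 hf.bounded hg.bounded h1.2 h2.2⟩
  | smul a f hf h => exact ⟨h.1.const_mul a, hsmul a f h.1 hf.bounded h.2⟩
  | lim f g M hf hM' hl h =>
    have hm : Measurable g :=
      measurable_of_tendsto_metrizable (fun n => (h n).1) (tendsto_pi_nhds.mpr hl)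
    exact ⟨hm, hlim f g M (fun n => (h n).1) hm (fun n => (h n).2) hM' hl⟩

end TrigClosure

namespace FPData

section Semigroup

variable {H : Type} [NormedAddCommGroup H] [InnerProductSpace ℝ H] [CompleteSpace H]
  [SecondCountableTopology H] [MeasurableSpace H] [BorelSpace H] (D : FPData H)

/-- The semigroup with time clamped to `[0,T]`. -/
def clampS (r : ℝ) : H →L[ℝ] H := D.S (max 0 (min r D.T))

theorem clampS_of_mem {t : ℝ} (ht : t ∈ Icc 0 D.T) : D.clampS t = D.S t := by
  rw [clampS, min_eq_left ht.2, max_eq_right ht.1]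

theorem clamp_mem (r : ℝ) : max 0 (min r D.T) ∈ Icc 0 D.T :=
  ⟨le_max_left _ _, max_le D.hT.le (min_le_right _ _)⟩

theorem continuous_clampS_apply (x : H) : Continuous fun r => D.clampS r x :=
  (D.S_cont x).comp_continuous (f := fun r => max 0 (min r D.T)) (by fun_prop)
    fun r => (D.clamp_mem r).1

theorem exists_clampS_bound : ∃ M, 1 ≤ M ∧ ∀ r, ‖D.clampS r‖ ≤ M := by
  obtain ⟨M, hM⟩ := banach_steinhaus (g := D.clampS) fun x => by
    obtain ⟨C, hC⟩ := (isCompact_Icc (a := 0) (b := D.T)).exists_bound_of_continuousOn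
      ((D.S_cont x).mono fun t ht => ht.1)
    exact ⟨C, fun r => hC _ (D.clamp_mem r)⟩
  exact ⟨max 1 M, le_max_left _ _, fun r => (hM r).trans (le_max_right _ _)⟩

/-- A bound for `‖e^{tA}‖` on `[0,T]`. -/
noncomputable def bdS : ℝ := D.exists_clampS_bound.choose

theorem one_le_bdS : 1 ≤ D.bdS := D.exists_clampS_bound.choose_spec.1

theorem bdS_pos : 0 < D.bdS := zero_lt_one.trans_le D.one_le_bdS

theorem norm_clampS_le (r : ℝ) : ‖D.clampS r‖ ≤ D.bdS := D.exists_clampS_bound.choose_spec.2 r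

theorem norm_clampS_apply_le (r : ℝ) (x : H) : ‖D.clampS r x‖ ≤ D.bdS * ‖x‖ :=
  (D.clampS r).le_of_opNorm_le (D.norm_clampS_le r) x

theorem continuous_clampS : Continuous fun p : ℝ × H => D.clampS p.1 p.2 := by
  refine continuous_iff_continuousAt.mpr fun p => ?_
  rw [ContinuousAt, tendsto_iff_norm_sub_tendsto_zero]
  have h1 : Tendsto (fun q : ℝ × H => D.bdS * ‖q.2 - p.2‖ + ‖D.clampS q.1 p.2 - D.clampS p.1 p.2‖)
      (𝓝 p) (𝓝 (D.bdS * ‖p.2 - p.2‖ + ‖D.clampS p.1 p.2 - D.clampS p.1 p.2‖)) := by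
    have h : Continuous fun q : ℝ × H => D.clampS q.1 p.2 :=
      (D.continuous_clampS_apply p.2).comp continuous_fst
    exact Continuous.tendsto (((continuous_snd.sub continuous_const).norm.const_mul _ : Continuous
      fun q : ℝ × H => D.bdS * ‖q.2 - p.2‖).add (h.sub continuous_const).norm) p
  simp only [sub_self, norm_zero, mul_zero, add_zero] at h1
  refine squeeze_zero (fun _ => norm_nonneg _) (fun q => ?_) h1
  calc ‖D.clampS q.1 q.2 - D.clampS p.1 p.2‖
      = ‖D.clampS q.1 (q.2 - p.2) + (D.clampS q.1 p.2 - D.clampS p.1 p.2)‖ := by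
        rw [map_sub]; congr 1; abel
    _ ≤ _ := (norm_add_le _ _).trans (add_le_add_left (D.norm_clampS_apply_le _ _) _)

theorem S_comm {s t : ℝ} (hs : 0 ≤ s) (ht : 0 ≤ t) (x : H) : D.S s (D.S t x) = D.S t (D.S s x) := by
  have h1 := congrArg (fun L => L x) (D.S_add s t hs ht)
  have h2 := congrArg (fun L => L x) (D.S_add t s ht hs)
  simp only [ContinuousLinearMap.comp_apply] at h1 h2
  rw [← h1, ← h2, add_comm]

theorem tendsto_S_generator {t : ℝ} (ht : 0 ≤ t) (x : D.A.domain) :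
    Tendsto (fun r : ℝ => r⁻¹ • (D.S r (D.S t x) - D.S t x)) (𝓝[>] 0) (𝓝 (D.S t (D.A x))) := by
  refine (((D.S t).continuous.tendsto _).comp (D.A_gen x)).congr' ?_
  filter_upwards [self_mem_nhdsWithin] with r hr
  simp only [Function.comp_apply, map_smul, map_sub]
  rw [D.S_comm ht (le_of_lt hr)]

theorem S_mem_domain {t : ℝ} (ht : 0 ≤ t) (x : D.A.domain) : D.S t x ∈ D.A.domain :=
  (D.A_mem_iff _).mpr ⟨_, D.tendsto_S_generator ht x⟩

theorem A_S_apply {t : ℝ} (ht : 0 ≤ t) (x : D.A.domain) :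
    D.A ⟨D.S t x, D.S_mem_domain ht x⟩ = D.S t (D.A x) :=
  tendsto_nhds_unique (D.A_gen ⟨D.S t x, D.S_mem_domain ht x⟩) (D.tendsto_S_generator ht x)

theorem S_sub_eq_integral {t : ℝ} (ht : 0 ≤ t) (x : D.A.domain) :
    ∫ r in (0 : ℝ)..t, D.S r (D.A x) = D.S t x - x := by
  have hsub : uIcc 0 t ⊆ Ici 0 := by rw [uIcc_of_le ht]; exact fun r hr => hr.1
  rw [intervalIntegral.integral_eq_sub_of_hasDeriv_right (f := fun r => D.S r (x : H))
    ((D.S_cont x).mono hsub) ?_ ((D.S_cont _).mono hsub).intervalIntegrable]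
  · simp [D.S_zero]
  · intro r hr
    have hr0 : 0 ≤ r := by rw [min_eq_left ht] at hr; exact hr.1.le
    rw [hasDerivWithinAt_iff_tendsto_slope' (by simp)]
    have hmap : Tendsto (fun q : ℝ => q - r) (𝓝[>] r) (𝓝[>] 0) := by
      refine tendsto_nhdsWithin_iff.mpr ⟨?_, ?_⟩
      · have h : Tendsto (fun q : ℝ => q - r) (𝓝 r) (𝓝 (r - r)) :=
          (continuous_id.sub continuous_const).tendsto r
        rw [sub_self] at h
        exact h.mono_left nhdsWithin_le_nhds
      · filter_upwards [self_mem_nhdsWithin] with q hq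
        exact sub_pos.mpr (mem_Ioi.mp hq)
    refine ((D.tendsto_S_generator hr0 x).comp hmap).congr' ?_
    filter_upwards [self_mem_nhdsWithin] with q hq
    have hq' : 0 ≤ q - r := (sub_pos.mpr (mem_Ioi.mp hq)).le
    have h1 := congrArg (fun L => L (x : H)) (D.S_add (q - r) r hq' hr0)
    simp only [ContinuousLinearMap.comp_apply, sub_add_cancel] at h1
    simp only [Function.comp_apply, slope, vsub_eq_sub]
    rw [h1]

theorem mem_adjoint_graph_iff {k a : H} :
    (k, a) ∈ D.A.adjoint.graph ↔ ∀ x : D.A.domain, ⟪a, (x : H)⟫_ℝ = ⟪k, D.A x⟫_ℝ := by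
  constructor
  · intro h x
    obtain ⟨y, hy, hy'⟩ := (LinearPMap.mem_graph_iff _).mp h
    simp only at hy hy'
    rw [← hy, ← hy']
    exact LinearPMap.adjoint_isFormalAdjoint D.A_dense y x
  · intro h
    have hmem : k ∈ D.A.adjoint.domain := LinearPMap.mem_adjoint_domain_of_exists _ ⟨a, h⟩
    exact (LinearPMap.mem_graph_iff _).mpr
      ⟨⟨k, hmem⟩, rfl, LinearPMap.adjoint_apply_eq D.A_dense ⟨k, hmem⟩ h⟩

theorem inner_clampS_eq {k a : H} (hk : (k, a) ∈ D.A.adjoint.graph) (x : H) {t : ℝ}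
    (ht : t ∈ Icc 0 D.T) :
    ⟪D.clampS t x, k⟫_ℝ = ⟪x, k⟫_ℝ + ∫ r in (0 : ℝ)..t, ⟪D.clampS r x, a⟫_ℝ := by
  have hc1 : Continuous fun x : H => ⟪D.clampS t x, k⟫_ℝ :=
    (D.clampS t).continuous.inner continuous_const
  have hc2 : Continuous fun x : H => ⟪x, k⟫_ℝ + ∫ r in (0 : ℝ)..t, ⟪D.clampS r x, a⟫_ℝ := by
    refine (continuous_id.inner continuous_const).add ?_
    refine intervalIntegral.continuous_parametric_intervalIntegral_of_continuous' ?_ _ _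
    exact (D.continuous_clampS.comp continuous_swap).inner continuous_const
  refine congrFun (Continuous.ext_on D.A_dense hc1 hc2 fun x hx => ?_) x
  have h1 := D.S_sub_eq_integral ht.1 ⟨x, hx⟩
  have h2 : ∀ r ∈ uIcc 0 t, ⟪D.clampS r x, a⟫_ℝ = ⟪k, D.S r (D.A ⟨x, hx⟩)⟫_ℝ := by
    intro r hr
    rw [uIcc_of_le ht.1] at hr
    rw [D.clampS_of_mem ⟨hr.1, hr.2.trans ht.2⟩, ← D.A_S_apply hr.1, real_inner_comm]
    exact D.mem_adjoint_graph_iff.mp hk ⟨_, D.S_mem_domain hr.1 ⟨x, hx⟩⟩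
  have hint : IntervalIntegrable (fun r => D.S r (D.A ⟨x, hx⟩)) volume 0 t := by
    refine ContinuousOn.intervalIntegrable ((D.S_cont _).mono ?_)
    rw [uIcc_of_le ht.1]
    exact fun r hr => hr.1
  have h3 := (innerSL ℝ k).intervalIntegral_comp_comm hint
  simp only [innerSL_apply_apply] at h3
  rw [intervalIntegral.integral_congr h2, h3, h1, D.clampS_of_mem ht, inner_sub_right,
    real_inner_comm k, real_inner_comm k]
  ring

theorem adjoint_clampS_mem {k a : H} (hk : (k, a) ∈ D.A.adjoint.graph) (t : ℝ) :
    (ContinuousLinearMap.adjoint (D.clampS t) k, ContinuousLinearMap.adjoint (D.clampS t) a) ∈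
      D.A.adjoint.graph := by
  refine D.mem_adjoint_graph_iff.mpr fun x => ?_
  rw [ContinuousLinearMap.adjoint_inner_left, ContinuousLinearMap.adjoint_inner_left]
  have h := D.mem_adjoint_graph_iff.mp hk ⟨_, D.S_mem_domain (D.clamp_mem t).1 x⟩
  rw [D.A_S_apply (D.clamp_mem t).1] at h
  exact h

theorem continuous_adjoint_clampS {k a : H} (hk : (k, a) ∈ D.A.adjoint.graph) :
    Continuous fun t => ContinuousLinearMap.adjoint (D.clampS t) k := by
  have key : ∀ s ∈ Icc 0 D.T, ∀ t ∈ Icc 0 D.T,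
      ‖ContinuousLinearMap.adjoint (D.clampS s) k - ContinuousLinearMap.adjoint (D.clampS t) k‖ ≤
        D.bdS * ‖a‖ * |s - t| := by
    intro s hs t ht
    set v := ContinuousLinearMap.adjoint (D.clampS s) k -
      ContinuousLinearMap.adjoint (D.clampS t) k with hv
    have hcont : Continuous fun r => ⟪D.clampS r v, a⟫_ℝ :=
      (D.continuous_clampS_apply v).inner continuous_const
    have h1 : ‖v‖ ^ 2 = ∫ r in t..s, ⟪D.clampS r v, a⟫_ℝ := by
      rw [← real_inner_self_eq_norm_sq]
      nth_rewrite 2 [hv]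
      rw [inner_sub_right, ContinuousLinearMap.adjoint_inner_right,
        ContinuousLinearMap.adjoint_inner_right, D.inner_clampS_eq hk v hs,
        D.inner_clampS_eq hk v ht, ← intervalIntegral.integral_interval_sub_left
          (hcont.intervalIntegrable 0 s) (hcont.intervalIntegrable 0 t)]
      ring
    have h2 : ‖∫ r in t..s, ⟪D.clampS r v, a⟫_ℝ‖ ≤ D.bdS * ‖v‖ * ‖a‖ * |s - t| :=
      intervalIntegral.norm_integral_le_of_norm_le_const fun r _ =>
        (norm_inner_le_norm _ _).trans
          (mul_le_mul_of_nonneg_right (D.norm_clampS_apply_le r v) (norm_nonneg a))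
    rw [← h1, Real.norm_of_nonneg (sq_nonneg _)] at h2
    rcases (norm_nonneg v).eq_or_lt with h0 | h0
    · rw [← h0]
      have := D.bdS_pos
      positivity
    · refine le_of_mul_le_mul_left ?_ h0
      calc ‖v‖ * ‖v‖ = ‖v‖ ^ 2 := (sq _).symm
        _ ≤ _ := h2
        _ = _ := by ring
  have hlip : ∀ t, D.clampS t = D.clampS (max 0 (min t D.T)) := fun t => by
    rw [D.clampS_of_mem (D.clamp_mem t)]; rfl
  have hon : ContinuousOn (fun t => ContinuousLinearMap.adjoint (D.clampS t) k) (Icc 0 D.T) := by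
    refine LipschitzOnWith.continuousOn (K := (D.bdS * ‖a‖).toNNReal) ?_
    refine LipschitzOnWith.of_dist_le_mul fun s hs t ht => ?_
    rw [dist_eq_norm, Real.dist_eq, Real.coe_toNNReal _
      (mul_nonneg D.bdS_pos.le (norm_nonneg a))]
    exact key s hs t ht
  have := hon.comp_continuous (f := fun t => max 0 (min t D.T)) (by fun_prop) D.clamp_mem
  refine this.congr fun t => ?_
  simp only [Function.comp_apply]
  rw [← hlip]

theorem dense_adjoint_domain : Dense (D.A.adjoint.domain : Set H) := by
  rw [Submodule.dense_iff_topologicalClosure_eq_top, Submodule.topologicalClosure_eq_top_iff,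
    Submodule.eq_bot_iff]
  intro z hz
  have hcont : ∀ x, Continuous fun r => ⟪D.clampS r x, z⟫_ℝ := fun x =>
    (D.continuous_clampS_apply x).inner continuous_const
  have hzero : ∀ t ∈ Icc 0 D.T, ∫ r in (0 : ℝ)..t, ⟪D.clampS r z, z⟫_ℝ = 0 := by
    intro t ht
    let ℓ : H →L[ℝ] ℝ := LinearMap.mkContinuous
      { toFun := fun x => ∫ r in (0 : ℝ)..t, ⟪D.clampS r x, z⟫_ℝ
        map_add' := fun x y => by
          simp only [map_add, inner_add_left]
          exact intervalIntegral.integral_add ((hcont x).intervalIntegrable _ _)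
            ((hcont y).intervalIntegrable _ _)
        map_smul' := fun c x => by
          simp only [map_smul, real_inner_smul_left, intervalIntegral.integral_const_mul]
          rfl } (D.bdS * ‖z‖ * |t - 0|) fun x => by
        refine (intervalIntegral.norm_integral_le_of_norm_le_const
          (C := D.bdS * ‖x‖ * ‖z‖) fun r _ => ?_).trans (le_of_eq (by ring))
        exact (norm_inner_le_norm _ _).trans
          (mul_le_mul_of_nonneg_right (D.norm_clampS_apply_le r x) (norm_nonneg z))
    let k : H := (InnerProductSpace.toDual ℝ H).symm ℓ
    have hk : ∀ x, ⟪k, x⟫_ℝ = ∫ r in (0 : ℝ)..t, ⟪D.clampS r x, z⟫_ℝ := fun x =>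
      InnerProductSpace.toDual_symm_apply
    have hmem : (k, ContinuousLinearMap.adjoint (D.clampS t) z - z) ∈ D.A.adjoint.graph := by
      refine D.mem_adjoint_graph_iff.mpr fun x => ?_
      rw [hk, inner_sub_left, ContinuousLinearMap.adjoint_inner_left]
      have h1 : ∀ r ∈ uIcc 0 t, ⟪D.clampS r (D.A x), z⟫_ℝ = ⟪z, D.S r (D.A x)⟫_ℝ := by
        intro r hr
        rw [uIcc_of_le ht.1] at hr
        rw [D.clampS_of_mem ⟨hr.1, hr.2.trans ht.2⟩, real_inner_comm]
      have hint : IntervalIntegrable (fun r => D.S r (D.A x)) volume 0 t := by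
        refine ContinuousOn.intervalIntegrable ((D.S_cont _).mono ?_)
        rw [uIcc_of_le ht.1]
        exact fun r hr => hr.1
      have h3 := (innerSL ℝ z).intervalIntegral_comp_comm hint
      simp only [innerSL_apply_apply] at h3
      rw [intervalIntegral.integral_congr h1, h3, D.S_sub_eq_integral ht.1, D.clampS_of_mem ht,
        inner_sub_right]
    have hkd : k ∈ D.A.adjoint.domain := LinearPMap.mem_domain_of_mem_graph hmem
    rw [← hk]
    exact (Submodule.mem_orthogonal _ _).mp hz k hkd
  have hinner : ∀ t ∈ Ioo 0 D.T, ⟪D.clampS t z, z⟫_ℝ = 0 := by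
    intro t ht
    have h1 : HasDerivAt (fun u => ∫ r in (0 : ℝ)..u, ⟪D.clampS r z, z⟫_ℝ) ⟪D.clampS t z, z⟫_ℝ t :=
      intervalIntegral.integral_hasDerivAt_right ((hcont z).intervalIntegrable _ _)
        ((hcont z).stronglyMeasurableAtFilter _ _) (hcont z).continuousAt
    have h2 : HasDerivAt (fun u => ∫ r in (0 : ℝ)..u, ⟪D.clampS r z, z⟫_ℝ) 0 t := by
      refine (hasDerivAt_const t (0 : ℝ)).congr_of_eventuallyEq ?_
      filter_upwards [Ioo_mem_nhds ht.1 ht.2] with u hu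
      exact hzero u ⟨hu.1.le, hu.2.le⟩
    exact h1.unique h2
  have h0 : ⟪D.clampS 0 z, z⟫_ℝ = 0 := by
    have hlim : Tendsto (fun r => ⟪D.clampS r z, z⟫_ℝ) (𝓝[>] 0) (𝓝 ⟪D.clampS 0 z, z⟫_ℝ) :=
      ((hcont z).tendsto 0).mono_left nhdsWithin_le_nhds
    refine tendsto_nhds_unique hlim (tendsto_const_nhds.congr' ?_)
    filter_upwards [Ioo_mem_nhdsGT D.hT] with r hr
    exact (hinner r hr).symm
  rw [D.clampS_of_mem ⟨le_rfl, D.hT.le⟩, D.S_zero] at h0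
  exact inner_self_eq_zero.mp h0

/-- The integrand `⟨C e^{rA*} k, e^{rA*} k⟩` of the covariance quadratic form. -/
noncomputable def covRate (k : H) (r : ℝ) : ℝ :=
  ⟪D.C (ContinuousLinearMap.adjoint (D.clampS r) k), ContinuousLinearMap.adjoint (D.clampS r) k⟫_ℝ

theorem covRate_nonneg (k : H) (r : ℝ) : 0 ≤ D.covRate k r :=
  D.C_pos.re_inner_nonneg_left _

theorem continuous_covRate {k a : H} (hk : (k, a) ∈ D.A.adjoint.graph) :
    Continuous (D.covRate k) :=
  (D.C.continuous.comp (D.continuous_adjoint_clampS hk)).inner (D.continuous_adjoint_clampS hk)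

theorem inner_Q_eq (hyp : D.Hyp31) {k a : H} (hk : (k, a) ∈ D.A.adjoint.graph) {t : ℝ}
    (ht : t ∈ Ioc 0 D.T) : ⟪hyp.Q t k, k⟫_ℝ = ∫ r in (0 : ℝ)..t, D.covRate k r := by
  have hcont : Continuous fun r =>
      D.clampS r (D.C (ContinuousLinearMap.adjoint (D.clampS r) k)) :=
    D.continuous_clampS.comp (continuous_id.prodMk
      (D.C.continuous.comp (D.continuous_adjoint_clampS hk)))
  have h1 : hyp.Q t k = ∫ r in (0 : ℝ)..t,
      D.clampS r (D.C (ContinuousLinearMap.adjoint (D.clampS r) k)) := by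
    rw [hyp.Q_def t ht.1]
    refine intervalIntegral.integral_congr fun r hr => ?_
    rw [uIcc_of_le ht.1.le] at hr
    simp only [D.clampS_of_mem ⟨hr.1, hr.2.trans ht.2⟩]
  have h3 := (innerSL ℝ k).intervalIntegral_comp_comm (hcont.intervalIntegrable 0 t)
    (μ := volume)
  simp only [innerSL_apply_apply] at h3
  rw [real_inner_comm, h1, ← h3]
  refine intervalIntegral.integral_congr fun r _ => ?_
  simp only [covRate]
  rw [← ContinuousLinearMap.adjoint_inner_left, real_inner_comm]

theorem inner_Q_le (hyp : D.Hyp31) (k : H) {t : ℝ} (ht : t ∈ Ioc 0 D.T) :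
    ⟪hyp.Q t k, k⟫_ℝ ≤ ⟪hyp.Q D.T k, k⟫_ℝ := by
  refine D.dense_adjoint_domain.induction (P := fun k => ⟪hyp.Q t k, k⟫_ℝ ≤ ⟪hyp.Q D.T k, k⟫_ℝ)
    (fun k hk => ?_) (isClosed_le (by fun_prop) (by fun_prop)) k
  have hk' : (k, D.A.adjoint ⟨k, hk⟩) ∈ D.A.adjoint.graph :=
    LinearPMap.mem_graph D.A.adjoint ⟨k, hk⟩
  rw [D.inner_Q_eq hyp hk' ht, D.inner_Q_eq hyp hk' ⟨D.hT, le_rfl⟩]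
  refine intervalIntegral.integral_mono_interval le_rfl ht.1.le ht.2
    (Eventually.of_forall fun r => D.covRate_nonneg k r)
    ((D.continuous_covRate hk').intervalIntegrable _ _)

end Semigroup

end FPData

section Gaussian

open ProbabilityTheory

variable {H : Type*} [NormedAddCommGroup H] [InnerProductSpace ℝ H] [CompleteSpace H]
  [SecondCountableTopology H] [MeasurableSpace H] [BorelSpace H]

theorem HilbertBasis.countable_index {ι : Type*} (b : HilbertBasis ι ℝ H) : Countable ι := by
  refine Pairwise.countable_of_isOpen_disjoint (s := fun i => Metric.ball (b i) (1 / 2)) ?_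
    (fun _ => Metric.isOpen_ball) fun i => ⟨b i, Metric.mem_ball_self (by norm_num)⟩
  intro i j hij
  refine Metric.ball_disjoint_ball ?_
  have h1 : ‖b i - b j‖ ^ 2 = 2 := by
    rw [norm_sub_sq_real, b.orthonormal.1 i, b.orthonormal.1 j, b.orthonormal.2 hij]
    norm_num
  rw [dist_eq_norm]
  nlinarith [norm_nonneg (b i - b j)]

theorem HilbertBasis.hasSum_sq_inner {ι : Type*} (b : HilbertBasis ι ℝ H) (x : H) :
    HasSum (fun i => ⟪x, b i⟫_ℝ ^ 2) (‖x‖ ^ 2) := by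
  have h := b.hasSum_inner_mul_inner x x
  rw [real_inner_self_eq_norm_sq] at h
  refine h.congr_fun fun i => ?_
  rw [sq, real_inner_comm x]

/-- `μ` is the centered Gaussian measure with covariance `Q`. -/
structure IsCenteredGaussian (μ : Measure H) (Q : H →L[ℝ] H) : Prop where
  prob : IsProbabilityMeasure μ
  pos : Q.IsPositive
  char : ∀ h : H, ∫ x, Complex.exp ((⟪x, h⟫_ℝ : ℂ) * Complex.I) ∂μ =
      Complex.exp (-((⟪Q h, h⟫_ℝ : ℂ)) / 2)

namespace IsCenteredGaussian

variable {μ : Measure H} {Q : H →L[ℝ] H}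

theorem inner_nonneg (hμ : IsCenteredGaussian μ Q) (h : H) : 0 ≤ ⟪Q h, h⟫_ℝ := hμ.pos.re_inner_nonneg_left h

theorem integrable_exp (hμ : IsCenteredGaussian μ Q) (h : H) :
    Integrable (fun x => Complex.exp ((⟪x, h⟫_ℝ : ℂ) * Complex.I)) μ := by
  have := hμ.prob
  refine Integrable.of_bound (C := 1) (by fun_prop) (Eventually.of_forall fun x => ?_)
  rw [Complex.norm_exp_ofReal_mul_I]

theorem integral_cos (hμ : IsCenteredGaussian μ Q) (h : H) :
    ∫ x, Real.cos ⟪x, h⟫_ℝ ∂μ = Real.exp (-(⟪Q h, h⟫_ℝ / 2)) := by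
  have h1 := congrArg Complex.re (hμ.char h)
  have h2 := integral_re (hμ.integrable_exp h)
  have h3 : (-((⟪Q h, h⟫_ℝ : ℂ)) / 2) = ((-(⟪Q h, h⟫_ℝ / 2) : ℝ) : ℂ) := by
    push_cast; ring
  rw [h3, Complex.exp_ofReal_re] at h1
  rw [← h1]
  refine Eq.trans (integral_congr_ae (Eventually.of_forall fun x => ?_)) h2
  exact (Complex.exp_ofReal_mul_I_re _).symm

theorem integral_sin (hμ : IsCenteredGaussian μ Q) (h : H) : ∫ x, Real.sin ⟪x, h⟫_ℝ ∂μ = 0 := by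
  have h1 := congrArg Complex.im (hμ.char h)
  have h2 := integral_im (hμ.integrable_exp h)
  have h3 : (-((⟪Q h, h⟫_ℝ : ℂ)) / 2) = ((-(⟪Q h, h⟫_ℝ / 2) : ℝ) : ℂ) := by
    push_cast; ring
  rw [h3, Complex.exp_ofReal_im] at h1
  rw [← h1]
  refine Eq.trans (integral_congr_ae (Eventually.of_forall fun x => ?_)) h2
  exact (Complex.exp_ofReal_mul_I_im _).symm

theorem map_inner (hμ : IsCenteredGaussian μ Q) (h : H) :
    μ.map (fun x => ⟪x, h⟫_ℝ) = gaussianReal 0 (⟪Q h, h⟫_ℝ).toNNReal := by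
  have := hμ.prob
  have hm : AEMeasurable (fun x : H => ⟪x, h⟫_ℝ) μ := by fun_prop
  have : IsProbabilityMeasure (μ.map fun x => ⟪x, h⟫_ℝ) := Measure.isProbabilityMeasure_map hm
  refine Measure.ext_of_charFun (funext fun t => ?_)
  rw [charFun_gaussianReal, charFun_apply_real, integral_map hm (by fun_prop)]
  have h1 := hμ.char (t • h)
  simp only [map_smul, real_inner_smul_left, real_inner_smul_right] at h1
  rw [Real.coe_toNNReal _ (hμ.inner_nonneg h)]
  convert h1 using 2
  · push_cast; rfl
  · push_cast; ring

theorem memLp_inner (hμ : IsCenteredGaussian μ Q) (h : H) : MemLp (fun x => ⟪x, h⟫_ℝ) 2 μ := by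
  have hm : AEMeasurable (fun x : H => ⟪x, h⟫_ℝ) μ := by fun_prop
  have h1 := memLp_id_gaussianReal' (μ := 0) (v := (⟪Q h, h⟫_ℝ).toNNReal) 2 (by simp)
  rw [← hμ.map_inner h] at h1
  exact h1.comp_of_map hm

theorem integrable_inner (hμ : IsCenteredGaussian μ Q) (h : H) : Integrable (fun x => ⟪x, h⟫_ℝ) μ :=
  have := hμ.prob
  (hμ.memLp_inner h).integrable one_le_two

theorem integral_inner_sq (hμ : IsCenteredGaussian μ Q) (h : H) : ∫ x, ⟪x, h⟫_ℝ ^ 2 ∂μ = ⟪Q h, h⟫_ℝ := by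
  have hm : AEMeasurable (fun x : H => ⟪x, h⟫_ℝ) μ := by fun_prop
  have h1 := variance_fun_id_gaussianReal (μ := 0) (v := (⟪Q h, h⟫_ℝ).toNNReal)
  rw [variance_of_integral_eq_zero (by fun_prop) (by simp), ← hμ.map_inner h,
    integral_map hm (by fun_prop), Real.coe_toNNReal _ (hμ.inner_nonneg h)] at h1
  exact h1

theorem hasDerivAt_cov (hμ : IsCenteredGaussian μ Q) (k k' : H) :
    HasDerivAt (fun ε : ℝ => ⟪Q (k + ε • k'), k + ε • k'⟫_ℝ) (2 * ⟪Q k, k'⟫_ℝ) 0 := by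
  have h1 : HasDerivAt (fun ε : ℝ => k + ε • k') k' 0 := by
    simpa using ((hasDerivAt_id (0 : ℝ)).smul_const k').const_add k
  have h2 := (Q.hasFDerivAt.comp_hasDerivAt (0 : ℝ) h1).inner ℝ h1
  refine h2.congr_deriv ?_
  simp only [Function.comp_apply, zero_smul, add_zero]
  have : ⟪Q k', k⟫_ℝ = ⟪Q k, k'⟫_ℝ := by
    have h : ⟪Q k', k⟫_ℝ = ⟪k', Q k⟫_ℝ := hμ.pos.1 k' k
    rw [h, real_inner_comm]
  rw [this]
  ring

theorem integral_sin_mul_inner (hμ : IsCenteredGaussian μ Q) (k k' : H) :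
    ∫ x, Real.sin ⟪x, k⟫_ℝ * ⟪x, k'⟫_ℝ ∂μ =
      ⟪Q k, k'⟫_ℝ * Real.exp (-(⟪Q k, k⟫_ℝ / 2)) := by
  have := hμ.prob
  have h1 := (hasDerivAt_integral_of_dominated_loc_of_deriv_le (μ := μ) (x₀ := (0 : ℝ))
    (F := fun ε x => Real.cos ⟪x, k + ε • k'⟫_ℝ) (s := univ) (bound := fun x => |⟪x, k'⟫_ℝ|)
    (F' := fun ε x => -Real.sin ⟪x, k + ε • k'⟫_ℝ * ⟪x, k'⟫_ℝ) univ_mem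
    (Eventually.of_forall fun ε => by fun_prop)
    (Integrable.of_bound (C := 1) (by fun_prop)
      (Eventually.of_forall fun x => Real.abs_cos_le_one _)) (by fun_prop)
    (Eventually.of_forall fun x ε _ => by
      rw [norm_mul, norm_neg, Real.norm_eq_abs, Real.norm_eq_abs]
      exact mul_le_of_le_one_left (abs_nonneg _) (Real.abs_sin_le_one _))
    (hμ.integrable_inner k').abs
    (Eventually.of_forall fun x ε _ => by
      refine HasDerivAt.cos ?_
      have h : HasDerivAt (fun ε : ℝ => ⟪x, k⟫_ℝ + ε * ⟪x, k'⟫_ℝ) ⟪x, k'⟫_ℝ ε := by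
        simpa using ((hasDerivAt_id ε).mul_const ⟪x, k'⟫_ℝ).const_add ⟪x, k⟫_ℝ
      refine h.congr_of_eventuallyEq (Eventually.of_forall fun ε => ?_)
      simp only [inner_add_right, real_inner_smul_right])).2
  simp only [zero_smul, add_zero, hμ.integral_cos] at h1
  have h2 := ((hμ.hasDerivAt_cov k k').div_const 2).neg.exp
  have h3 := h1.unique h2
  simp only [neg_mul, integral_neg, Pi.neg_apply, zero_smul, add_zero] at h3
  linarith

theorem integral_cos_mul_inner (hμ : IsCenteredGaussian μ Q) (k k' : H) :
    ∫ x, Real.cos ⟪x, k⟫_ℝ * ⟪x, k'⟫_ℝ ∂μ = 0 := by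
  have := hμ.prob
  have h1 := (hasDerivAt_integral_of_dominated_loc_of_deriv_le (μ := μ) (x₀ := (0 : ℝ))
    (F := fun ε x => Real.sin ⟪x, k + ε • k'⟫_ℝ) (s := univ) (bound := fun x => |⟪x, k'⟫_ℝ|)
    (F' := fun ε x => Real.cos ⟪x, k + ε • k'⟫_ℝ * ⟪x, k'⟫_ℝ) univ_mem
    (Eventually.of_forall fun ε => by fun_prop)
    (Integrable.of_bound (C := 1) (by fun_prop)
      (Eventually.of_forall fun x => Real.abs_sin_le_one _)) (by fun_prop)
    (Eventually.of_forall fun x ε _ => by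
      rw [norm_mul, Real.norm_eq_abs, Real.norm_eq_abs]
      exact mul_le_of_le_one_left (abs_nonneg _) (Real.abs_cos_le_one _))
    (hμ.integrable_inner k').abs
    (Eventually.of_forall fun x ε _ => by
      refine HasDerivAt.sin ?_
      have h : HasDerivAt (fun ε : ℝ => ⟪x, k⟫_ℝ + ε * ⟪x, k'⟫_ℝ) ⟪x, k'⟫_ℝ ε := by
        simpa using ((hasDerivAt_id ε).mul_const ⟪x, k'⟫_ℝ).const_add ⟪x, k⟫_ℝ
      refine h.congr_of_eventuallyEq (Eventually.of_forall fun ε => ?_)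
      simp only [inner_add_right, real_inner_smul_right])).2
  simp only [zero_smul, add_zero, hμ.integral_sin] at h1
  exact h1.unique (hasDerivAt_const _ _)

theorem lintegral_norm_sq (hμ : IsCenteredGaussian μ Q) {ι : Type*}
    (b : HilbertBasis ι ℝ H)
    (hs : Summable fun i => ⟪Q (b i), b i⟫_ℝ) :
    ∫⁻ x, ENNReal.ofReal (‖x‖ ^ 2) ∂μ = ENNReal.ofReal (∑' i, ⟪Q (b i), b i⟫_ℝ) := by
  have := b.countable_index
  have h1 : ∀ x : H, ENNReal.ofReal (‖x‖ ^ 2) = ∑' i, ENNReal.ofReal (⟪x, b i⟫_ℝ ^ 2) := fun x => by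
    rw [← (b.hasSum_sq_inner x).tsum_eq,
      ENNReal.ofReal_tsum_of_nonneg (fun _ => sq_nonneg _) (b.hasSum_sq_inner x).summable]
  simp_rw [h1]
  rw [lintegral_tsum fun i => by fun_prop,
    ENNReal.ofReal_tsum_of_nonneg (fun i => hμ.inner_nonneg _) hs]
  refine tsum_congr fun i => ?_
  rw [← ofReal_integral_eq_lintegral_ofReal (hμ.memLp_inner _).integrable_sq
    (Eventually.of_forall fun _ => sq_nonneg _), hμ.integral_inner_sq]

/-- The white-noise map: an extension of `R k ↦ ⟨·, k⟩` to a bounded operator into `L²(μ)`,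
where `R² = Q`. -/
theorem exists_whiteNoise (hμ : IsCenteredGaussian μ Q) {R : H →L[ℝ] H} (hR : R.IsPositive)
    (hRQ : R.comp R = Q) :
    ∃ W : H →L[ℝ] Lp ℝ 2 μ, (∀ z, ‖W z‖ ≤ ‖z‖) ∧ ∀ z k : H,
      ∫ y, Real.sin ⟪y, k⟫_ℝ * W z y ∂μ = ⟪R z, k⟫_ℝ * Real.exp (-(⟪Q k, k⟫_ℝ / 2)) ∧
      ∫ y, Real.cos ⟪y, k⟫_ℝ * W z y ∂μ = 0 := by
  have := hμ.prob
  have hQ : ∀ k, Q k = R (R k) := fun k => by rw [← hRQ]; rfl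
  let K : Submodule ℝ H := (LinearMap.range (R : H →ₗ[ℝ] H)).topologicalClosure
  have hmem : ∀ k, R k ∈ K := fun k =>
    Submodule.le_topologicalClosure _ (LinearMap.mem_range_self (R : H →ₗ[ℝ] H) k)
  have : CompleteSpace K := (Submodule.isClosed_topologicalClosure _).completeSpace_coe
  let e : H →ₗ[ℝ] K := LinearMap.codRestrict K (R : H →ₗ[ℝ] H) hmem
  have he : ∀ k, ((e k : K) : H) = R k := fun k => rfl
  have hdense : DenseRange e := by
    intro z
    have hz : (z : H) ∈ closure (Set.range R) := z.2
    refine Metric.mem_closure_iff.mpr fun ε hε => ?_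
    obtain ⟨_, ⟨k, rfl⟩, hk⟩ := Metric.mem_closure_iff.mp hz ε hε
    exact ⟨e k, ⟨k, rfl⟩, hk⟩
  let f : H →ₗ[ℝ] Lp ℝ 2 μ :=
    { toFun := fun k => (hμ.memLp_inner k).toLp
      map_add' := fun x y => by
        rw [← MemLp.toLp_add]
        refine MemLp.toLp_congr _ _ (Eventually.of_forall fun _ => ?_)
        simp [inner_add_right]
      map_smul' := fun c x => by
        rw [RingHom.id_apply, ← MemLp.toLp_const_smul]
        refine MemLp.toLp_congr _ _ (Eventually.of_forall fun _ => ?_)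
        simp [real_inner_smul_right] }
  have hf : ∀ k, f k =ᵐ[μ] fun x => ⟪x, k⟫_ℝ := fun k => (hμ.memLp_inner k).coeFn_toLp
  have hnorm : ∀ k, ‖f k‖ = ‖e k‖ := by
    intro k
    rw [← sq_eq_sq₀ (norm_nonneg _) (norm_nonneg _), ← real_inner_self_eq_norm_sq,
      L2.inner_def]
    have h1 : ∫ x, ⟪f k x, f k x⟫_ℝ ∂μ = ∫ x, ⟪x, k⟫_ℝ ^ 2 ∂μ := by
      refine integral_congr_ae ?_
      filter_upwards [hf k] with x hx
      rw [hx]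
      simp [sq]
    rw [h1, hμ.integral_inner_sq, Submodule.coe_norm, he, ← real_inner_self_eq_norm_sq, hQ]
    exact hR.1 (R k) k
  let W : K →L[ℝ] Lp ℝ 2 μ := f.extendOfNorm e
  have hWe : ∀ k, W (e k) = f k := fun k =>
    LinearMap.extendOfNorm_eq hdense ⟨1, fun x => by rw [hnorm, one_mul]⟩ k
  have hWn : ∀ z, ‖W z‖ ≤ ‖z‖ := fun z => by
    have := LinearMap.norm_extendOfNorm_apply_le (f := f) hdense 1
      (fun x => by rw [hnorm, one_mul]) z
    rwa [one_mul] at this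
  have hb : ∀ (φ : ℝ → ℝ), Continuous φ → (∀ t, |φ t| ≤ 1) → ∀ (k : H) (c : H),
      (∀ k', ∫ x, φ ⟪x, k⟫_ℝ * ⟪x, k'⟫_ℝ ∂μ = ⟪c, R k'⟫_ℝ) →
      ∀ z : K, ∫ x, φ ⟪x, k⟫_ℝ * W z x ∂μ = ⟪c, (z : H)⟫_ℝ := by
    intro φ hφ hφ1 k c hc
    have hm : MemLp (fun x => φ ⟪x, k⟫_ℝ) 2 μ :=
      MemLp.of_bound (by fun_prop) 1 (Eventually.of_forall fun x => hφ1 _)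
    have h1 : ∀ v : Lp ℝ 2 μ, ∫ x, φ ⟪x, k⟫_ℝ * v x ∂μ = ⟪hm.toLp, v⟫_ℝ := by
      intro v
      rw [L2.inner_def]
      refine integral_congr_ae ?_
      filter_upwards [hm.coeFn_toLp] with x hx
      rw [hx]
      simp [mul_comm]
    simp_rw [h1]
    refine congrFun (hdense.equalizer (by fun_prop) (by fun_prop) (funext fun k' => ?_))
    simp only [Function.comp_apply]
    rw [hWe, ← h1, he, ← hc]
    refine integral_congr_ae ?_
    filter_upwards [hf k'] with x hx
    rw [hx]
  have hsa : ∀ x y, ⟪R x, y⟫_ℝ = ⟪x, R y⟫_ℝ := hR.1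
  refine ⟨W.comp K.orthogonalProjectionOnto, fun z => ?_, fun z k => ⟨?_, ?_⟩⟩
  · exact (hWn _).trans (K.norm_orthogonalProjectionOnto_apply_le z)
  · have h2 := hb Real.sin Real.continuous_sin Real.abs_sin_le_one k
      (Real.exp (-(⟪Q k, k⟫_ℝ / 2)) • R k) (fun k' => by
        rw [hμ.integral_sin_mul_inner, real_inner_smul_left, hQ, hsa, mul_comm])
      (K.orthogonalProjectionOnto z)
    simp only [ContinuousLinearMap.comp_apply]
    have h3 : ⟪R k, (K.orthogonalProjectionOnto z : H)⟫_ℝ = ⟪R k, z⟫_ℝ := by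
      exact K.inner_orthogonalProjectionOnto_eq_of_mem_left ⟨R k, hmem k⟩ z
    rw [h2, real_inner_smul_left, h3, hsa, real_inner_comm (R z), mul_comm]
  · have h2 := hb Real.cos Real.continuous_cos Real.abs_cos_le_one k 0 (fun k' => by
        rw [hμ.integral_cos_mul_inner, inner_zero_left])
      (K.orthogonalProjectionOnto z)
    simpa using h2

end IsCenteredGaussian

end Gaussian

namespace FPData

section Characters

variable {H : Type} [NormedAddCommGroup H] [InnerProductSpace ℝ H] [CompleteSpace H]
  [SecondCountableTopology H] [MeasurableSpace H] [BorelSpace H] (D : FPData H)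

/-- The linear forms `(t,x) ↦ a t + ⟨x,k⟩` with `k ∈ D(A*)`. -/
def linForms : Submodule ℝ (ℝ × H → ℝ) where
  carrier := {ℓ | ∃ (a : ℝ) (k : H), k ∈ D.A.adjoint.domain ∧ ℓ = fun p => a * p.1 + ⟪p.2, k⟫_ℝ}
  add_mem' := by
    rintro _ _ ⟨a, k, hk, rfl⟩ ⟨b, l, hl, rfl⟩
    refine ⟨a + b, k + l, add_mem hk hl, funext fun p => ?_⟩
    simp only [Pi.add_apply, inner_add_right]
    ring
  zero_mem' := ⟨0, 0, zero_mem _, funext fun p => by simp⟩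
  smul_mem' := by
    rintro r _ ⟨a, k, hk, rfl⟩
    refine ⟨r * a, r • k, Submodule.smul_mem _ r hk, funext fun p => ?_⟩
    simp only [Pi.smul_apply, smul_eq_mul, real_inner_smul_right]
    ring

theorem borel_le_of_linForms (m' : MeasurableSpace (ℝ × H))
    (h : ∀ ℓ ∈ D.linForms, Measurable[m'] ℓ) :
    (Prod.instMeasurableSpace : MeasurableSpace (ℝ × H)) ≤ m' := by
  have hfst : Measurable[m'] (Prod.fst : ℝ × H → ℝ) := by
    have h1 := h _ ⟨1, 0, zero_mem _, rfl⟩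
    simp only [one_mul, inner_zero_right, add_zero] at h1
    exact h1
  have hinner : ∀ y : H, Measurable[m'] fun p : ℝ × H => ⟪p.2, y⟫_ℝ := by
    intro y
    obtain ⟨k, hk, hky⟩ := mem_closure_iff_seq_limit.mp (D.dense_adjoint_domain y)
    refine measurable_of_tendsto_metrizable (f := fun n (p : ℝ × H) => ⟪p.2, k n⟫_ℝ)
      (fun n => ?_) (tendsto_pi_nhds.mpr fun p => tendsto_const_nhds.inner hky)
    have h1 := h _ ⟨0, k n, hk n, rfl⟩
    simp only [zero_mul, zero_add] at h1
    exact h1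
  have hsnd : Measurable[m'] (Prod.snd : ℝ × H → H) := by
    have := D.basis.countable_index
    refine measurable_of_tendsto_metrizable' (u := (atTop : Filter (Finset D.ι)))
      (f := fun s (p : ℝ × H) => ∑ i ∈ s, ⟪p.2, D.basis i⟫_ℝ • D.basis i) (fun s => ?_)
      (tendsto_pi_nhds.mpr fun p => ?_)
    · exact Finset.measurable_fun_sum _ fun i _ => (hinner _).smul_const _
    · have h1 := D.basis.hasSum_repr p.2
      simp only [D.basis.repr_apply_apply] at h1
      refine Tendsto.congr (fun s => ?_) h1
      exact Finset.sum_congr rfl fun i _ => by rw [real_inner_comm]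
  have h1 := measurable_iff_comap_le.mp (hfst.prodMk hsnd)
  rwa [show (fun p : ℝ × H => (p.1, p.2)) = id from rfl, MeasurableSpace.comap_id] at h1

theorem measurable_linForms {ℓ : ℝ × H → ℝ} (h : ℓ ∈ D.linForms) : Measurable ℓ := by
  obtain ⟨a, k, -, rfl⟩ := h
  fun_prop

/-- Measurable functions of linear growth in the space variable, with constant `M`. -/
def LinGrowth (M : ℝ) (g : ℝ × H → ℝ) : Prop := Measurable g ∧ ∀ p, |g p| ≤ M * (1 + ‖p.2‖)

variable {D}

theorem LinGrowth.nonneg {M : ℝ} {f : ℝ × H → ℝ} (hf : LinGrowth M f) : 0 ≤ M := by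
  have h := (abs_nonneg _).trans (hf.2 (0, 0))
  simpa using h

theorem LinGrowth.of_bounded {M : ℝ} {f : ℝ × H → ℝ} (hf : Measurable f) (hM : ∀ p, |f p| ≤ M) :
    LinGrowth M f :=
  ⟨hf, fun p => (hM p).trans <| le_mul_of_one_le_right ((abs_nonneg _).trans (hM p))
    (by linarith [norm_nonneg p.2])⟩

theorem LinGrowth.mono {M : ℝ} {f g : ℝ × H → ℝ} (hf : LinGrowth M f) (hg : Measurable g)
    (h : ∀ p, |g p| ≤ |f p|) : LinGrowth M g :=
  ⟨hg, fun p => (h p).trans (hf.2 p)⟩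

variable (D)

/-- A functional monotone class principle for functions of linear growth. -/
theorem linGrowth_induction (P : (ℝ × H → ℝ) → Prop)
    (hcos : ∀ (a : ℝ) (k : H), k ∈ D.A.adjoint.domain → ∀ c : ℝ,
      P fun p => Real.cos (a * p.1 + ⟪p.2, k⟫_ℝ + c))
    (hadd : ∀ M N f g, LinGrowth M f → LinGrowth N g → P f → P g → P fun p => f p + g p)
    (hsmul : ∀ (a : ℝ) M f, LinGrowth M f → P f → P fun p => a * f p)
    (hlim : ∀ M (f : ℕ → ℝ × H → ℝ) g, (∀ n, LinGrowth M (f n)) → LinGrowth M g →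
      (∀ n, P (f n)) → (∀ p, Tendsto (fun n => f n p) atTop (𝓝 (g p))) → P g)
    {M : ℝ} {g : ℝ × H → ℝ} (hg : LinGrowth M g) : P g := by
  have hbd : ∀ (g : ℝ × H → ℝ) (M : ℝ), Measurable g → (∀ p, |g p| ≤ M) → P g := by
    intro g M hg hM
    refine TrigClosure.measurable_induction (L := D.linForms) D.borel_le_of_linForms
      (fun ℓ hℓ => D.measurable_linForms hℓ) P ?_ ?_ ?_ ?_ hg hM
    · rintro _ ⟨a, k, hk, rfl⟩ c
      exact hcos a k hk c
    · rintro f g hf hg ⟨M, hM⟩ ⟨N, hN⟩ hPf hPg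
      exact hadd M N f g (.of_bounded hf hM) (.of_bounded hg hN) hPf hPg
    · rintro a f hf ⟨M, hM⟩ hPf
      exact hsmul a M f (.of_bounded hf hM) hPf
    · intro f g M hf hg hPf hM hlim'
      refine hlim M f g (fun n => .of_bounded (hf n) (hM n)) (.of_bounded hg fun p => ?_) hPf hlim'
      exact le_of_tendsto (hlim' p).abs (Eventually.of_forall fun n => hM n p)
  refine hlim M (fun n p => max (-(n : ℝ)) (min (g p) n)) g (fun n => ?_) hg (fun n => ?_)
    fun p => ?_
  · refine hg.mono (by have := hg.1; fun_prop) fun p => ?_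
    have hn : (0 : ℝ) ≤ n := n.cast_nonneg
    rw [abs_le]
    rcases abs_cases (g p) with h | h
    · constructor
      · exact (le_max_of_le_right (le_min (by linarith) (by linarith)))
      · exact max_le (by linarith) ((min_le_left _ _).trans (le_abs_self _))
    · constructor
      · exact (le_max_of_le_right (le_min (by linarith) (by linarith)))
      · exact max_le (by linarith) ((min_le_left _ _).trans (le_abs_self _))
  · refine hbd _ n (by have := hg.1; fun_prop) fun p => ?_
    have hn : (0 : ℝ) ≤ n := n.cast_nonneg
    exact abs_le.mpr ⟨le_max_left _ _, max_le (by linarith) (min_le_right _ _)⟩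
  · refine tendsto_const_nhds.congr' ?_
    filter_upwards [eventually_ge_atTop ⌈|g p|⌉₊] with n hn
    have h1 : |g p| ≤ n := (Nat.le_ceil _).trans (by exact_mod_cast hn)
    rw [abs_le] at h1
    rw [min_eq_left h1.2, max_eq_right h1.1]

end Characters

end FPData

namespace FPData.OUData

section Kernel

open ProbabilityTheory

variable {H : Type} [NormedAddCommGroup H] [InnerProductSpace ℝ H] [CompleteSpace H]
  [SecondCountableTopology H] [MeasurableSpace H] [BorelSpace H]
  {D : FPData H} {hyp : D.Hyp31} (O : D.OUData hyp)

theorem isCenteredGaussian {σ : ℝ} (hσ : σ ∈ Ioc 0 D.T) :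
    IsCenteredGaussian (O.N σ) (hyp.Q σ) :=
  ⟨O.N_prob σ hσ.1.le, hyp.Q_pos σ hσ.1, O.N_char σ hσ.1⟩

/-- The Gaussian measure `N_{Q_σ}` for `σ ∈ (0,T]`, extended by the Dirac mass. -/
noncomputable def gauss (σ : ℝ) : Measure H := if σ ∈ Ioc 0 D.T then O.N σ else Measure.dirac 0

theorem gauss_of_mem {σ : ℝ} (hσ : σ ∈ Ioc 0 D.T) : O.gauss σ = O.N σ := if_pos hσ

theorem gauss_of_notMem {σ : ℝ} (hσ : σ ∉ Ioc 0 D.T) : O.gauss σ = Measure.dirac 0 := if_neg hσ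

theorem isCenteredGaussian_gauss {σ : ℝ} (hσ : σ ∈ Ioc 0 D.T) :
    IsCenteredGaussian (O.gauss σ) (hyp.Q σ) := by
  rw [O.gauss_of_mem hσ]
  exact O.isCenteredGaussian hσ

instance (σ : ℝ) : IsProbabilityMeasure (O.gauss σ) := by
  by_cases hσ : σ ∈ Ioc 0 D.T
  · exact (O.isCenteredGaussian_gauss hσ).prob
  · rw [O.gauss_of_notMem hσ]
    infer_instance

/-- The `L²` norm of the identity under `N_{Q_T}`. -/
noncomputable def momB (_ : D.OUData hyp) : ℝ :=
  √(∑' i, ⟪hyp.Q D.T (D.basis i), D.basis i⟫_ℝ)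

theorem eLpNorm_norm_gauss_le (σ : ℝ) :
    eLpNorm (fun y : H => ‖y‖) 2 (O.gauss σ) ≤ ENNReal.ofReal O.momB := by
  by_cases hσ : σ ∈ Ioc 0 D.T
  · rw [eLpNorm_eq_lintegral_rpow_enorm_toReal (by simp) (by simp)]
    have h1 : ∀ y : H, ‖‖y‖‖ₑ ^ (2 : ℝ≥0∞).toReal = ENNReal.ofReal (‖y‖ ^ 2) := fun y => by
      rw [enorm_norm, ← ofReal_norm, ENNReal.toReal_ofNat, ENNReal.rpow_ofNat,
        ENNReal.ofReal_pow (norm_nonneg y)]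
    simp_rw [h1]
    rw [(O.isCenteredGaussian_gauss hσ).lintegral_norm_sq D.basis (hyp.Q_traceClass σ hσ.1), momB,
      Real.sqrt_eq_rpow, ENNReal.toReal_ofNat, ENNReal.ofReal_rpow_of_nonneg
        (tsum_nonneg fun i => (O.isCenteredGaussian_gauss hσ).inner_nonneg _) (by norm_num)]
    refine ENNReal.ofReal_le_ofReal (Real.rpow_le_rpow
      (tsum_nonneg fun i => (O.isCenteredGaussian_gauss hσ).inner_nonneg _) ?_ (by norm_num))
    exact (hyp.Q_traceClass σ hσ.1).tsum_le_tsum (fun i => D.inner_Q_le hyp _ hσ)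
      (hyp.Q_traceClass D.T D.hT)
  · rw [O.gauss_of_notMem hσ, eLpNorm_congr_ae (g := fun _ => (0 : ℝ))]
    · simp
    · rw [Filter.EventuallyEq, ae_dirac_eq]
      simp

/-- The growth constant of the Ornstein–Uhlenbeck transition operators on `[0,T]`. -/
noncomputable def growth : ℝ := D.bdS + O.momB

theorem one_le_growth : 1 ≤ O.growth :=
  D.one_le_bdS.trans (le_add_of_nonneg_right (Real.sqrt_nonneg _))

theorem growth_pos : 0 < O.growth := zero_lt_one.trans_le O.one_le_growth

theorem measurable_shift {g : ℝ × H → ℝ} (hg : Measurable g) (σ : ℝ) (p : ℝ × H) :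
    Measurable fun y => g (p.1 + σ, D.clampS σ p.2 + y) :=
  hg.comp (by fun_prop)

theorem eLpNorm_shift_le {M : ℝ} {g : ℝ × H → ℝ} (hg : LinGrowth M g) (σ : ℝ) (p : ℝ × H) :
    eLpNorm (fun y => g (p.1 + σ, D.clampS σ p.2 + y)) 2 (O.gauss σ) ≤
      ENNReal.ofReal (M * O.growth * (1 + ‖p.2‖)) := by
  have hb := D.one_le_bdS
  have hx := norm_nonneg p.2
  have hM := hg.nonneg
  have hm : 0 ≤ O.momB := Real.sqrt_nonneg _
  calc eLpNorm (fun y => g (p.1 + σ, D.clampS σ p.2 + y)) 2 (O.gauss σ)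
      ≤ eLpNorm (M • ((fun _ : H => 1 + D.bdS * ‖p.2‖) + fun y : H => ‖y‖)) 2 (O.gauss σ) := by
        refine eLpNorm_mono_real fun y => ?_
        simp only [Pi.smul_apply, Pi.add_apply, smul_eq_mul, Real.norm_eq_abs]
        refine (hg.2 _).trans (mul_le_mul_of_nonneg_left ?_ hM)
        have h1 := norm_add_le (D.clampS σ p.2) y
        have h2 := D.norm_clampS_apply_le σ p.2
        simp only
        linarith
    _ ≤ ENNReal.ofReal M * (ENNReal.ofReal (1 + D.bdS * ‖p.2‖) + ENNReal.ofReal O.momB) := by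
        rw [eLpNorm_const_smul, ← ofReal_norm, Real.norm_of_nonneg hM]
        gcongr
        refine (eLpNorm_add_le (by fun_prop) (by fun_prop) one_le_two).trans
          (add_le_add (le_of_eq ?_) (O.eLpNorm_norm_gauss_le σ))
        rw [eLpNorm_const _ (by simp) (NeZero.ne _), measure_univ, ENNReal.one_rpow, mul_one,
          ← ofReal_norm, Real.norm_of_nonneg (by positivity)]
    _ ≤ _ := by
        rw [← ENNReal.ofReal_add (by positivity) hm, ← ENNReal.ofReal_mul hM]
        refine ENNReal.ofReal_le_ofReal ?_
        rw [mul_assoc]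
        refine mul_le_mul_of_nonneg_left ?_ hM
        rw [growth]
        nlinarith [mul_nonneg hm hx]

theorem memLp_shift {M : ℝ} {g : ℝ × H → ℝ} (hg : LinGrowth M g) (σ : ℝ) (p : ℝ × H) :
    MemLp (fun y => g (p.1 + σ, D.clampS σ p.2 + y)) 2 (O.gauss σ) :=
  ⟨(measurable_shift hg.1 σ p).aestronglyMeasurable,
    (O.eLpNorm_shift_le hg σ p).trans_lt ENNReal.ofReal_lt_top⟩

theorem integrable_shift {M : ℝ} {g : ℝ × H → ℝ} (hg : LinGrowth M g) (σ : ℝ) (p : ℝ × H) :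
    Integrable (fun y => g (p.1 + σ, D.clampS σ p.2 + y)) (O.gauss σ) :=
  (O.memLp_shift hg σ p).integrable one_le_two

/-- The variance `⟨Q_σ k, k⟩` for `k ∈ D(A*)`, as an integral over `(0,σ)`. -/
noncomputable def _root_.FPData.covar (D : FPData H) (k : H) (σ : ℝ) : ℝ :=
  ∫ r in (0 : ℝ)..σ, D.covRate k r

theorem integral_cos_gauss {k a : H} (hk : (k, a) ∈ D.A.adjoint.graph) {σ : ℝ}
    (hσ : σ ∈ Ioc 0 D.T) (α : ℝ) :
    ∫ y, Real.cos (α + ⟪y, k⟫_ℝ) ∂(O.gauss σ) = Real.cos α * Real.exp (-(D.covar k σ / 2)) := by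
  have hG := O.isCenteredGaussian_gauss hσ
  have hc : Integrable (fun y => Real.cos ⟪y, k⟫_ℝ) (O.gauss σ) :=
    Integrable.of_bound (C := 1) (by fun_prop) (Eventually.of_forall fun x => Real.abs_cos_le_one _)
  have hs : Integrable (fun y => Real.sin ⟪y, k⟫_ℝ) (O.gauss σ) :=
    Integrable.of_bound (C := 1) (by fun_prop) (Eventually.of_forall fun x => Real.abs_sin_le_one _)
  simp_rw [Real.cos_add]
  rw [integral_sub (hc.const_mul _) (hs.const_mul _), integral_const_mul, integral_const_mul,
    hG.integral_cos, hG.integral_sin, D.inner_Q_eq hyp hk hσ, mul_zero, sub_zero, covar]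

theorem measurable_gauss : Measurable O.gauss := by
  have key : ∀ {M : ℝ} {g : ℝ × H → ℝ}, LinGrowth M g →
      Measurable fun σ => ∫ y, g (0, y) ∂(O.gauss σ) := by
    intro M g hg
    have hint : ∀ {M : ℝ} {g : ℝ × H → ℝ}, LinGrowth M g → ∀ σ,
        Integrable (fun y => g (0, y)) (O.gauss σ) := fun hg σ => by
      simpa using O.integrable_shift hg σ (-σ, 0)
    refine D.linGrowth_induction (fun g => Measurable fun σ => ∫ y, g (0, y) ∂(O.gauss σ))
      ?_ ?_ ?_ ?_ hg
    · intro a k hk c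
      have hk' : (k, D.A.adjoint ⟨k, hk⟩) ∈ D.A.adjoint.graph :=
        LinearPMap.mem_graph D.A.adjoint ⟨k, hk⟩
      have h1 : (fun σ => ∫ y, Real.cos (a * (0 : ℝ) + ⟪y, k⟫_ℝ + c) ∂(O.gauss σ)) =
          (Ioc 0 D.T).piecewise (fun σ => Real.cos c * Real.exp (-(D.covar k σ / 2)))
            fun _ => Real.cos c := by
        funext σ
        by_cases hσ : σ ∈ Ioc 0 D.T
        · rw [Set.piecewise_eq_of_mem _ _ _ hσ, ← O.integral_cos_gauss hk' hσ]
          simp [add_comm]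
        · rw [Set.piecewise_eq_of_notMem _ _ _ hσ, O.gauss_of_notMem hσ, integral_dirac]
          simp
      simp only
      rw [h1]
      refine Measurable.piecewise measurableSet_Ioc (Continuous.measurable ?_) measurable_const
      have := intervalIntegral.continuous_primitive
        (fun a b => (D.continuous_covRate hk').intervalIntegrable (μ := volume) a b) 0
      unfold covar
      fun_prop
    · intro M N f g hf hg hPf hPg
      simp_rw [fun σ => integral_add (hint hf σ) (hint hg σ)]
      exact hPf.add hPg
    · intro a M f hf hPf
      simp_rw [integral_const_mul]
      exact hPf.const_mul a
    · intro M f g hf hg hPf hlim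
      refine measurable_of_tendsto_metrizable hPf (tendsto_pi_nhds.mpr fun σ => ?_)
      have hb := (hint (g := fun p => M * (1 + ‖p.2‖)) (M := M)
        ⟨by fun_prop, fun p => le_of_eq (abs_of_nonneg (by
          have := hg.nonneg
          positivity))⟩ σ)
      exact tendsto_integral_of_dominated_convergence _
        (fun n => (hint (hf n) σ).1) hb
        (fun n => Eventually.of_forall fun y => (hf n).2 (0, y))
        (Eventually.of_forall fun y => hlim _)
  refine Measure.measurable_of_measurable_coe _ fun B hB => ?_
  have h1 := key (g := fun p => B.indicator 1 p.2) (M := 1) (.of_bounded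
    ((measurable_one.indicator hB).comp measurable_snd) fun p => by
      by_cases h : p.2 ∈ B <;> simp [h])
  simp only [integral_indicator_one hB] at h1
  simpa [Measure.real] using h1.ennreal_ofReal

/-- The Gaussian measures as a Markov kernel. -/
noncomputable def gaussKernel : Kernel ℝ H := ⟨O.gauss, O.measurable_gauss⟩

instance : IsMarkovKernel O.gaussKernel := ⟨fun σ => inferInstanceAs (IsProbabilityMeasure (O.gauss σ))⟩

theorem stronglyMeasurable_integral_gauss {X : Type*} [MeasurableSpace X] {s : X → ℝ}
    (hs : Measurable s) {f : X × H → ℝ} (hf : Measurable f) :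
    StronglyMeasurable fun x => ∫ y, f (x, y) ∂(O.gauss (s x)) :=
  hf.stronglyMeasurable.integral_kernel_prod_right' (κ := O.gaussKernel.comap s hs)

/-- The white noise map composed with `Λ_σ`: the `L²(N_{Q_σ})`-density of the directional
derivative of the Ornstein–Uhlenbeck semigroup. -/
theorem exists_noise (σ : ℝ) : ∃ W : H →L[ℝ] Lp ℝ 2 (O.gauss σ),
    (∀ z, ‖W z‖ ≤ ‖hyp.Λ σ‖ * ‖z‖) ∧ (σ ∉ Ioc 0 D.T → W = 0) ∧
    (σ ∈ Ioc 0 D.T → ∀ z k : H,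
      ∫ y, Real.sin ⟪y, k⟫_ℝ * W z y ∂(O.gauss σ) =
        ⟪D.clampS σ z, k⟫_ℝ * Real.exp (-(⟪hyp.Q σ k, k⟫_ℝ / 2)) ∧
      ∫ y, Real.cos ⟪y, k⟫_ℝ * W z y ∂(O.gauss σ) = 0) := by
  by_cases hσ : σ ∈ Ioc 0 D.T
  · obtain ⟨W, hW, hW'⟩ := (O.isCenteredGaussian_gauss hσ).exists_whiteNoise
      (hyp.sqrtQ_pos σ hσ.1) (hyp.sqrtQ_sq σ hσ.1)
    refine ⟨W.comp (hyp.Λ σ), fun z => (hW _).trans ((hyp.Λ σ).le_opNorm z), fun h => absurd hσ h,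
      fun _ z k => ?_⟩
    have h1 : hyp.sqrtQ σ (hyp.Λ σ z) = D.clampS σ z := by
      rw [D.clampS_of_mem ⟨hσ.1.le, hσ.2⟩, ← hyp.Λ_spec σ hσ.1]
      rfl
    have h2 := hW' (hyp.Λ σ z) k
    rw [h1] at h2
    exact h2
  · exact ⟨0, fun z => by simp; positivity, fun _ => rfl, fun h => absurd h hσ⟩

/-- The white noise map composed with `Λ_σ`. -/
noncomputable def noise (σ : ℝ) : H →L[ℝ] Lp ℝ 2 (O.gauss σ) := (O.exists_noise σ).choose

theorem norm_noise_le (σ : ℝ) (z : H) : ‖O.noise σ z‖ ≤ ‖hyp.Λ σ‖ * ‖z‖ :=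
  (O.exists_noise σ).choose_spec.1 z

theorem noise_of_notMem {σ : ℝ} (hσ : σ ∉ Ioc 0 D.T) : O.noise σ = 0 :=
  (O.exists_noise σ).choose_spec.2.1 hσ

theorem integrable_mul_noise {σ : ℝ} {φ : H → ℝ} (hφ : MemLp φ 2 (O.gauss σ)) (z : H) :
    Integrable (fun y => φ y * O.noise σ z y) (O.gauss σ) :=
  hφ.integrable_mul (Lp.memLp _)

theorem integral_mul_noise {σ : ℝ} {φ : H → ℝ} (hφ : MemLp φ 2 (O.gauss σ)) (z : H) :
    ∫ y, φ y * O.noise σ z y ∂(O.gauss σ) = ⟪hφ.toLp, O.noise σ z⟫_ℝ := by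
  rw [L2.inner_def]
  refine integral_congr_ae ?_
  filter_upwards [hφ.coeFn_toLp] with x hx
  rw [hx]
  simp [mul_comm]

theorem abs_integral_mul_noise_le {σ : ℝ} {φ : H → ℝ} (hφ : MemLp φ 2 (O.gauss σ)) (z : H) {B : ℝ}
    (hB : 0 ≤ B) (h : eLpNorm φ 2 (O.gauss σ) ≤ ENNReal.ofReal B) :
    |∫ y, φ y * O.noise σ z y ∂(O.gauss σ)| ≤ B * (‖hyp.Λ σ‖ * ‖z‖) := by
  rw [O.integral_mul_noise hφ]
  refine (abs_real_inner_le_norm _ _).trans (mul_le_mul ?_ (O.norm_noise_le σ z) (norm_nonneg _) hB)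
  rw [Lp.norm_toLp]
  exact ENNReal.toReal_le_of_le_ofReal hB h

theorem integral_cos_mul_noise {k a : H} (hk : (k, a) ∈ D.A.adjoint.graph) {σ : ℝ}
    (hσ : σ ∈ Ioc 0 D.T) (α : ℝ) (z : H) :
    ∫ y, Real.cos (α + ⟪y, k⟫_ℝ) * O.noise σ z y ∂(O.gauss σ) =
      -(Real.sin α * ⟪D.clampS σ z, k⟫_ℝ * Real.exp (-(D.covar k σ / 2))) := by
  obtain ⟨h1, h2⟩ := (O.exists_noise σ).choose_spec.2.2 hσ z k
  have hc : MemLp (fun y => Real.cos ⟪y, k⟫_ℝ) 2 (O.gauss σ) :=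
    MemLp.of_bound (by fun_prop) 1 (Eventually.of_forall fun x => Real.abs_cos_le_one _)
  have hs : MemLp (fun y => Real.sin ⟪y, k⟫_ℝ) 2 (O.gauss σ) :=
    MemLp.of_bound (by fun_prop) 1 (Eventually.of_forall fun x => Real.abs_sin_le_one _)
  have h3 : ∀ y, Real.cos (α + ⟪y, k⟫_ℝ) * O.noise σ z y =
      Real.cos α * (Real.cos ⟪y, k⟫_ℝ * O.noise σ z y) -
        Real.sin α * (Real.sin ⟪y, k⟫_ℝ * O.noise σ z y) := fun y => by
    rw [Real.cos_add]; ring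
  simp_rw [h3]
  rw [integral_sub ((O.integrable_mul_noise hc z).const_mul _)
    ((O.integrable_mul_noise hs z).const_mul _), integral_const_mul, integral_const_mul]
  unfold noise
  rw [h1, h2, D.inner_Q_eq hyp hk hσ, covar]
  ring

end Kernel

end FPData.OUData

namespace FPData.OUData

section Potential

variable {H : Type} [NormedAddCommGroup H] [InnerProductSpace ℝ H] [CompleteSpace H]
  [SecondCountableTopology H] [MeasurableSpace H] [BorelSpace H]
  {D : FPData H} {hyp : D.Hyp31} (O : D.OUData hyp)

/-- The Ornstein–Uhlenbeck transition operator acting on functions of time and space. -/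
noncomputable def semi (g : ℝ × H → ℝ) (σ : ℝ) (p : ℝ × H) : ℝ :=
  ∫ y, g (p.1 + σ, D.clampS σ p.2 + y) ∂(O.gauss σ)

/-- The directional derivative of `semi`, in Bismut–Elworthy form. -/
noncomputable def dsemi (g : ℝ × H → ℝ) (σ : ℝ) (p : ℝ × H) (h : H) : ℝ :=
  ∫ y, g (p.1 + σ, D.clampS σ p.2 + y) * O.noise σ h y ∂(O.gauss σ)

variable {M N : ℝ} {f g : ℝ × H → ℝ}

theorem growth_mul_nonneg (hg : LinGrowth M g) (x : H) : 0 ≤ M * O.growth * (1 + ‖x‖) := by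
  have h1 := hg.nonneg
  have h2 := O.growth_pos
  positivity

theorem abs_semi_le (hg : LinGrowth M g) (σ : ℝ) (p : ℝ × H) :
    |O.semi g σ p| ≤ M * O.growth * (1 + ‖p.2‖) := by
  have h1 : eLpNorm (fun y => g (p.1 + σ, D.clampS σ p.2 + y)) 1 (O.gauss σ) ≤
      ENNReal.ofReal (M * O.growth * (1 + ‖p.2‖)) :=
    (eLpNorm_le_eLpNorm_of_exponent_le one_le_two
      (measurable_shift hg.1 σ p).aestronglyMeasurable).trans (O.eLpNorm_shift_le hg σ p)
  rw [eLpNorm_one_eq_lintegral_enorm] at h1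
  have h2 := (enorm_integral_le_lintegral_enorm
    (fun y => g (p.1 + σ, D.clampS σ p.2 + y)) (μ := O.gauss σ)).trans h1
  rw [← ofReal_norm] at h2
  exact (ENNReal.ofReal_le_ofReal_iff (O.growth_mul_nonneg hg p.2)).mp h2

theorem abs_dsemi_le (hg : LinGrowth M g) (σ : ℝ) (p : ℝ × H) (h : H) :
    |O.dsemi g σ p h| ≤ M * O.growth * (1 + ‖p.2‖) * (‖hyp.Λ σ‖ * ‖h‖) :=
  O.abs_integral_mul_noise_le (O.memLp_shift hg σ p) h (O.growth_mul_nonneg hg p.2)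
    (O.eLpNorm_shift_le hg σ p)

theorem semi_add (hf : LinGrowth M f) (hg : LinGrowth N g) (σ : ℝ) (p : ℝ × H) :
    O.semi (fun q => f q + g q) σ p = O.semi f σ p + O.semi g σ p :=
  integral_add (O.integrable_shift hf σ p) (O.integrable_shift hg σ p)

theorem semi_smul (a σ : ℝ) (p : ℝ × H) :
    O.semi (fun q => a * f q) σ p = a * O.semi f σ p :=
  integral_const_mul _ _

theorem dsemi_add (hf : LinGrowth M f) (hg : LinGrowth N g) (σ : ℝ) (p : ℝ × H) (h : H) :
    O.dsemi (fun q => f q + g q) σ p h = O.dsemi f σ p h + O.dsemi g σ p h := by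
  unfold dsemi
  simp_rw [add_mul]
  exact integral_add (O.integrable_mul_noise (O.memLp_shift hf σ p) h)
    (O.integrable_mul_noise (O.memLp_shift hg σ p) h)

theorem dsemi_smul (a σ : ℝ) (p : ℝ × H) (h : H) :
    O.dsemi (fun q => a * f q) σ p h = a * O.dsemi f σ p h := by
  unfold dsemi
  simp_rw [mul_assoc]
  exact integral_const_mul _ _

theorem linGrowth_bound (hM : 0 ≤ M) : LinGrowth M fun p : ℝ × H => M * (1 + ‖p.2‖) :=
  ⟨by fun_prop, fun p => le_of_eq (abs_of_nonneg (by positivity))⟩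

theorem tendsto_semi {f : ℕ → ℝ × H → ℝ} (hf : ∀ n, LinGrowth M (f n))
    (hlim : ∀ p, Tendsto (fun n => f n p) atTop (𝓝 (g p))) (σ : ℝ) (p : ℝ × H) :
    Tendsto (fun n => O.semi (f n) σ p) atTop (𝓝 (O.semi g σ p)) :=
  tendsto_integral_of_dominated_convergence _ (fun n => (O.integrable_shift (hf n) σ p).1)
    (O.integrable_shift (linGrowth_bound (hf 0).nonneg) σ p)
    (fun n => Eventually.of_forall fun _ => (hf n).2 _)
    (Eventually.of_forall fun _ => hlim _)

theorem tendsto_dsemi {f : ℕ → ℝ × H → ℝ} (hf : ∀ n, LinGrowth M (f n))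
    (hlim : ∀ p, Tendsto (fun n => f n p) atTop (𝓝 (g p))) (σ : ℝ) (p : ℝ × H) (h : H) :
    Tendsto (fun n => O.dsemi (f n) σ p h) atTop (𝓝 (O.dsemi g σ p h)) := by
  refine tendsto_integral_of_dominated_convergence
    (fun y => ‖M * (1 + ‖D.clampS σ p.2 + y‖) * O.noise σ h y‖)
    (fun n => (O.integrable_mul_noise (O.memLp_shift (hf n) σ p) h).1)
    (O.integrable_mul_noise (O.memLp_shift (linGrowth_bound (hf 0).nonneg) σ p) h).norm
    (fun n => Eventually.of_forall fun y => ?_)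
    (Eventually.of_forall fun y => (hlim _).mul_const _)
  rw [norm_mul, norm_mul]
  exact mul_le_mul_of_nonneg_right (((hf n).2 _).trans (le_abs_self _)) (norm_nonneg _)

theorem semi_cos {k a : H} (hk : (k, a) ∈ D.A.adjoint.graph) {σ : ℝ} (hσ : σ ∈ Ioc 0 D.T)
    (b c : ℝ) (p : ℝ × H) :
    O.semi (fun q => Real.cos (b * q.1 + ⟪q.2, k⟫_ℝ + c)) σ p =
      Real.cos (b * (p.1 + σ) + ⟪D.clampS σ p.2, k⟫_ℝ + c) *
        Real.exp (-(D.covar k σ / 2)) := by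
  rw [← O.integral_cos_gauss hk hσ]
  refine integral_congr_ae (Eventually.of_forall fun y => ?_)
  simp only [inner_add_left]
  congr 1
  ring

theorem dsemi_cos {k a : H} (hk : (k, a) ∈ D.A.adjoint.graph) {σ : ℝ} (hσ : σ ∈ Ioc 0 D.T)
    (b c : ℝ) (p : ℝ × H) (h : H) :
    O.dsemi (fun q => Real.cos (b * q.1 + ⟪q.2, k⟫_ℝ + c)) σ p h =
      -(Real.sin (b * (p.1 + σ) + ⟪D.clampS σ p.2, k⟫_ℝ + c) * ⟪D.clampS σ h, k⟫_ℝ *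
        Real.exp (-(D.covar k σ / 2))) := by
  rw [← O.integral_cos_mul_noise hk hσ]
  refine integral_congr_ae (Eventually.of_forall fun y => ?_)
  simp only [inner_add_left]
  congr 2
  ring

theorem dsemi_of_notMem {σ : ℝ} (hσ : σ ∉ Ioc 0 D.T) (p : ℝ × H) (h : H) :
    O.dsemi g σ p h = 0 := by
  unfold dsemi
  rw [O.noise_of_notMem hσ]
  refine integral_eq_zero_of_ae ?_
  filter_upwards [Lp.coeFn_zero ℝ 2 (O.gauss σ)] with y hy
  simp only [zero_apply, hy, Pi.zero_apply, mul_zero]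

theorem stronglyMeasurable_semi (hg : Measurable g) :
    StronglyMeasurable fun q : ℝ × (ℝ × H) => O.semi g q.1 q.2 := by
  have h1 : Measurable fun q : ℝ × (ℝ × H) => D.clampS q.1 q.2.2 :=
    (D.continuous_clampS.comp (by fun_prop : Continuous fun q : ℝ × (ℝ × H) =>
      (q.1, q.2.2))).measurable
  exact O.stronglyMeasurable_integral_gauss (X := ℝ × (ℝ × H)) measurable_fst
    (f := fun z => g (z.1.2.1 + z.1.1, D.clampS z.1.1 z.1.2.2 + z.2))
    (hg.comp (((measurable_fst.comp (measurable_snd.comp measurable_fst)).add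
      (measurable_fst.comp measurable_fst)).prodMk
        ((h1.comp measurable_fst).add measurable_snd)))

theorem _root_.FPData.continuous_covar (D : FPData H) {k a : H}
    (hk : (k, a) ∈ D.A.adjoint.graph) : Continuous (D.covar k) :=
  intervalIntegral.continuous_primitive
    (fun a b => (D.continuous_covRate hk).intervalIntegrable (μ := volume) a b) 0

theorem measurable_dsemi (hg : LinGrowth M g) (p : ℝ × H) (h : H) :
    Measurable fun σ => O.dsemi g σ p h := by
  refine D.linGrowth_induction (fun g => Measurable fun σ => O.dsemi g σ p h) ?_ ?_ ?_ ?_ hg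
  · intro b k hk c
    have hk' : (k, D.A.adjoint ⟨k, hk⟩) ∈ D.A.adjoint.graph :=
      LinearPMap.mem_graph D.A.adjoint ⟨k, hk⟩
    have h1 : (fun σ => O.dsemi (fun q => Real.cos (b * q.1 + ⟪q.2, k⟫_ℝ + c)) σ p h) =
        (Ioc 0 D.T).indicator fun σ =>
          -(Real.sin (b * (p.1 + σ) + ⟪D.clampS σ p.2, k⟫_ℝ + c) * ⟪D.clampS σ h, k⟫_ℝ *
            Real.exp (-(D.covar k σ / 2))) := by
      funext σ
      by_cases hσ : σ ∈ Ioc 0 D.T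
      · rw [Set.indicator_of_mem hσ, O.dsemi_cos hk' hσ]
      · rw [Set.indicator_of_notMem hσ, O.dsemi_of_notMem hσ]
    rw [h1]
    have h2 := D.continuous_clampS_apply p.2
    have h3 := D.continuous_clampS_apply h
    have h4 := D.continuous_covar hk'
    exact (Continuous.measurable (by fun_prop)).indicator measurableSet_Ioc
  · intro M N f g hf hg hPf hPg
    simp_rw [fun σ => O.dsemi_add hf hg σ p h]
    exact hPf.add hPg
  · intro a M f hf hPf
    simp_rw [fun σ => O.dsemi_smul (f := f) a σ p h]
    exact hPf.const_mul a
  · intro M f g hf hg hPf hlim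
    exact measurable_of_tendsto_metrizable hPf
      (tendsto_pi_nhds.mpr fun σ => O.tendsto_dsemi hf hlim σ p h)

theorem _root_.FPData.Hyp31.intervalIntegrable_norm (hyp : D.Hyp31) :
    IntervalIntegrable (fun σ => ‖hyp.Λ σ‖) volume 0 D.T := by
  rw [intervalIntegrable_iff_integrableOn_Ioc_of_le D.hT.le]
  have h1 := (hyp.Λ_int hyp.lam₀ le_rfl).mono_set (Ioc_subset_Ioi_self : Ioc 0 D.T ⊆ Ioi 0)
  have h2 : (fun σ => ‖hyp.Λ σ‖) =
      fun σ => Real.exp (hyp.lam₀ * σ) * (Real.exp (-hyp.lam₀ * σ) * ‖hyp.Λ σ‖) := by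
    funext σ
    rw [← mul_assoc, ← Real.exp_add]
    simp
  rw [h2]
  refine h1.bdd_mul (c := Real.exp (|hyp.lam₀| * D.T)) (Continuous.aestronglyMeasurable (by fun_prop)) ?_
  filter_upwards [ae_restrict_mem measurableSet_Ioc] with σ hσ
  rw [Real.norm_of_nonneg (Real.exp_pos _).le]
  refine Real.exp_le_exp.mpr ?_
  calc hyp.lam₀ * σ ≤ |hyp.lam₀| * σ := mul_le_mul_of_nonneg_right (le_abs_self _) hσ.1.le
    _ ≤ _ := mul_le_mul_of_nonneg_left hσ.2 (abs_nonneg _)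

/-- The constant `∫_0^T ‖Λ_σ‖ dσ`. -/
noncomputable def _root_.FPData.Hyp31.gam (hyp : D.Hyp31) : ℝ := ∫ σ in (0 : ℝ)..D.T, ‖hyp.Λ σ‖

theorem _root_.FPData.Hyp31.gam_nonneg (hyp : D.Hyp31) : 0 ≤ hyp.gam :=
  intervalIntegral.integral_nonneg D.hT.le fun _ _ => norm_nonneg _

/-- The bound of `e^{-λσ}` on `[0,T]`. -/
noncomputable def _root_.FPData.expB (D : FPData H) (lam : ℝ) : ℝ := Real.exp (|lam| * D.T)

theorem _root_.FPData.expB_pos (D : FPData H) (lam : ℝ) : 0 < D.expB lam := Real.exp_pos _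

theorem _root_.FPData.exp_le_expB (D : FPData H) (lam : ℝ) {σ : ℝ} (hσ : σ ∈ Icc 0 D.T) :
    Real.exp (-lam * σ) ≤ D.expB lam := by
  refine Real.exp_le_exp.mpr ?_
  calc -lam * σ ≤ |lam| * σ := mul_le_mul_of_nonneg_right (neg_le_abs _) hσ.1
    _ ≤ _ := mul_le_mul_of_nonneg_left hσ.2 (abs_nonneg _)

/-- The potential `∫_0^T e^{-λσ} R_σ g dσ`. -/
noncomputable def U (lam : ℝ) (g : ℝ × H → ℝ) (p : ℝ × H) : ℝ :=
  ∫ σ in (0 : ℝ)..D.T, Real.exp (-lam * σ) * O.semi g σ p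

/-- The directional derivative of the potential. -/
noncomputable def Γ (lam : ℝ) (g : ℝ × H → ℝ) (p : ℝ × H) (h : H) : ℝ :=
  ∫ σ in (0 : ℝ)..D.T, Real.exp (-lam * σ) * O.dsemi g σ p h

variable (lam : ℝ)

theorem norm_U_integrand_le (hg : LinGrowth M g) (p : ℝ × H) {σ : ℝ} (hσ : σ ∈ Icc 0 D.T) :
    ‖Real.exp (-lam * σ) * O.semi g σ p‖ ≤ D.expB lam * (M * O.growth * (1 + ‖p.2‖)) := by
  rw [norm_mul, Real.norm_of_nonneg (Real.exp_pos _).le]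
  exact mul_le_mul (D.exp_le_expB lam hσ) (O.abs_semi_le hg σ p) (abs_nonneg _)
    (D.expB_pos lam).le

theorem norm_Γ_integrand_le (hg : LinGrowth M g) (p : ℝ × H) (h : H) {σ : ℝ}
    (hσ : σ ∈ Icc 0 D.T) :
    ‖Real.exp (-lam * σ) * O.dsemi g σ p h‖ ≤
      D.expB lam * (M * O.growth * (1 + ‖p.2‖)) * ‖h‖ * ‖hyp.Λ σ‖ := by
  rw [norm_mul, Real.norm_of_nonneg (Real.exp_pos _).le]
  refine (mul_le_mul (D.exp_le_expB lam hσ) (O.abs_dsemi_le hg σ p h) (abs_nonneg _)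
    (D.expB_pos lam).le).trans (le_of_eq ?_)
  ring

theorem stronglyMeasurable_U_integrand (hg : Measurable g) (p : ℝ × H) :
    StronglyMeasurable fun σ => Real.exp (-lam * σ) * O.semi g σ p :=
  (Continuous.stronglyMeasurable (by fun_prop)).mul
    ((O.stronglyMeasurable_semi hg).comp_measurable (measurable_id.prodMk measurable_const))

theorem stronglyMeasurable_Γ_integrand (hg : LinGrowth M g) (p : ℝ × H) (h : H) :
    StronglyMeasurable fun σ => Real.exp (-lam * σ) * O.dsemi g σ p h :=
  (Continuous.stronglyMeasurable (by fun_prop)).mul (O.measurable_dsemi hg p h).stronglyMeasurable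

theorem ae_mem_Icc : ∀ᵐ σ ∂(volume.restrict (uIoc 0 D.T)), σ ∈ Icc 0 D.T := by
  rw [uIoc_of_le D.hT.le]
  filter_upwards [ae_restrict_mem measurableSet_Ioc] with σ hσ
  exact ⟨hσ.1.le, hσ.2⟩

theorem intervalIntegrable_U (hg : LinGrowth M g) (p : ℝ × H) :
    IntervalIntegrable (fun σ => Real.exp (-lam * σ) * O.semi g σ p) volume 0 D.T := by
  refine (intervalIntegrable_const (c := D.expB lam * (M * O.growth * (1 + ‖p.2‖)))).mono_fun'
    (O.stronglyMeasurable_U_integrand lam hg.1 p).aestronglyMeasurable ?_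
  filter_upwards [ae_mem_Icc (D := D)] with σ hσ
  exact O.norm_U_integrand_le lam hg p hσ

theorem intervalIntegrable_Γ (hg : LinGrowth M g) (p : ℝ × H) (h : H) :
    IntervalIntegrable (fun σ => Real.exp (-lam * σ) * O.dsemi g σ p h) volume 0 D.T := by
  refine (hyp.intervalIntegrable_norm.const_mul
    (D.expB lam * (M * O.growth * (1 + ‖p.2‖)) * ‖h‖)).mono_fun'
    (O.stronglyMeasurable_Γ_integrand lam hg p h).aestronglyMeasurable ?_
  filter_upwards [ae_mem_Icc (D := D)] with σ hσ
  exact O.norm_Γ_integrand_le lam hg p h hσ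

theorem abs_U_le (hg : LinGrowth M g) (p : ℝ × H) :
    |O.U lam g p| ≤ D.expB lam * D.T * M * O.growth * (1 + ‖p.2‖) := by
  have h1 := intervalIntegral.norm_integral_le_of_norm_le_const
    (a := 0) (b := D.T) (f := fun σ => Real.exp (-lam * σ) * O.semi g σ p)
    (C := D.expB lam * (M * O.growth * (1 + ‖p.2‖))) fun σ hσ => by
      rw [uIoc_of_le D.hT.le] at hσ
      exact O.norm_U_integrand_le lam hg p ⟨hσ.1.le, hσ.2⟩
  rw [sub_zero, abs_of_pos D.hT] at h1
  refine h1.trans (le_of_eq ?_)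
  ring

theorem abs_Γ_le (hg : LinGrowth M g) (p : ℝ × H) (h : H) :
    |O.Γ lam g p h| ≤ D.expB lam * hyp.gam * M * O.growth * (1 + ‖p.2‖) * ‖h‖ := by
  have h1 := intervalIntegral.norm_integral_le_of_norm_le D.hT.le
    (f := fun σ => Real.exp (-lam * σ) * O.dsemi g σ p h)
    (Eventually.of_forall fun σ (hσ : σ ∈ Ioc 0 D.T) =>
      O.norm_Γ_integrand_le lam hg p h ⟨hσ.1.le, hσ.2⟩)
    (hyp.intervalIntegrable_norm.const_mul _)
  rw [intervalIntegral.integral_const_mul] at h1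
  refine h1.trans (le_of_eq ?_)
  rw [FPData.Hyp31.gam]
  ring

theorem U_add (hf : LinGrowth M f) (hg : LinGrowth N g) (p : ℝ × H) :
    O.U lam (fun q => f q + g q) p = O.U lam f p + O.U lam g p := by
  unfold U
  rw [← intervalIntegral.integral_add (O.intervalIntegrable_U lam hf p)
    (O.intervalIntegrable_U lam hg p)]
  simp_rw [fun σ => O.semi_add hf hg σ p, mul_add]

theorem U_smul (a : ℝ) (p : ℝ × H) : O.U lam (fun q => a * f q) p = a * O.U lam f p := by
  unfold U
  rw [← intervalIntegral.integral_const_mul]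
  simp_rw [fun σ => O.semi_smul (f := f) a σ p, mul_left_comm]

theorem Γ_add (hf : LinGrowth M f) (hg : LinGrowth N g) (p : ℝ × H) (h : H) :
    O.Γ lam (fun q => f q + g q) p h = O.Γ lam f p h + O.Γ lam g p h := by
  unfold Γ
  rw [← intervalIntegral.integral_add (O.intervalIntegrable_Γ lam hf p h)
    (O.intervalIntegrable_Γ lam hg p h)]
  simp_rw [fun σ => O.dsemi_add hf hg σ p h, mul_add]

theorem Γ_smul (a : ℝ) (p : ℝ × H) (h : H) :
    O.Γ lam (fun q => a * f q) p h = a * O.Γ lam f p h := by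
  unfold Γ
  rw [← intervalIntegral.integral_const_mul]
  simp_rw [fun σ => O.dsemi_smul (f := f) a σ p h, mul_left_comm]

theorem tendsto_U {f : ℕ → ℝ × H → ℝ} (hf : ∀ n, LinGrowth M (f n))
    (hlim : ∀ p, Tendsto (fun n => f n p) atTop (𝓝 (g p))) (p : ℝ × H) :
    Tendsto (fun n => O.U lam (f n) p) atTop (𝓝 (O.U lam g p)) := by
  refine intervalIntegral.tendsto_integral_filter_of_dominated_convergence
    (fun _ => D.expB lam * (M * O.growth * (1 + ‖p.2‖)))
    (Eventually.of_forall fun n =>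
      (O.stronglyMeasurable_U_integrand lam (hf n).1 p).aestronglyMeasurable)
    (Eventually.of_forall fun n => Eventually.of_forall fun σ hσ => ?_)
    intervalIntegrable_const
    (Eventually.of_forall fun σ _ => (O.tendsto_semi hf hlim σ p).const_mul _)
  rw [uIoc_of_le D.hT.le] at hσ
  exact O.norm_U_integrand_le lam (hf n) p ⟨hσ.1.le, hσ.2⟩

theorem tendsto_Γ {f : ℕ → ℝ × H → ℝ} (hf : ∀ n, LinGrowth M (f n))
    (hlim : ∀ p, Tendsto (fun n => f n p) atTop (𝓝 (g p))) (p : ℝ × H) (h : H) :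
    Tendsto (fun n => O.Γ lam (f n) p h) atTop (𝓝 (O.Γ lam g p h)) := by
  refine intervalIntegral.tendsto_integral_filter_of_dominated_convergence
    (fun σ => D.expB lam * (M * O.growth * (1 + ‖p.2‖)) * ‖h‖ * ‖hyp.Λ σ‖)
    (Eventually.of_forall fun n =>
      (O.stronglyMeasurable_Γ_integrand lam (hf n) p h).aestronglyMeasurable)
    (Eventually.of_forall fun n => Eventually.of_forall fun σ hσ => ?_)
    (hyp.intervalIntegrable_norm.const_mul _)
    (Eventually.of_forall fun σ _ => (O.tendsto_dsemi hf hlim σ p h).const_mul _)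
  rw [uIoc_of_le D.hT.le] at hσ
  exact O.norm_Γ_integrand_le lam (hf n) p h ⟨hσ.1.le, hσ.2⟩

end Potential

end FPData.OUData

section LpClosure

variable {X E : Type*} [MeasurableSpace X] [NormedAddCommGroup E] [NormedSpace ℝ E]

/-- The function `v` is an `L²(μ)`-limit of measurable elements of `V`. -/
def InL2Closure (V : Submodule ℝ (X → E)) (μ : Measure X) (v : X → E) : Prop :=
  AEStronglyMeasurable v μ ∧ ∀ ε : ℝ≥0∞, ε ≠ 0 →
    ∃ u ∈ V, AEStronglyMeasurable u μ ∧ eLpNorm (u - v) 2 μ ≤ ε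

namespace InL2Closure

variable {V : Submodule ℝ (X → E)} {μ : Measure X} {v w : X → E}

theorem of_mem (hv : v ∈ V) (hm : AEStronglyMeasurable v μ) : InL2Closure V μ v :=
  ⟨hm, fun ε _ => ⟨v, hv, hm, by simp⟩⟩

theorem congr_ae (hv : InL2Closure V μ v) (h : v =ᵐ[μ] w) : InL2Closure V μ w := by
  refine ⟨hv.1.congr h, fun ε hε => ?_⟩
  obtain ⟨u, hu, hum, hle⟩ := hv.2 ε hε
  exact ⟨u, hu, hum, (eLpNorm_congr_ae ((EventuallyEq.refl _ u).sub h)).symm.le.trans hle⟩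

theorem of_close (hm : AEStronglyMeasurable v μ) (h : ∀ ε : ℝ≥0∞, ε ≠ 0 →
    ∃ w, InL2Closure V μ w ∧ eLpNorm (w - v) 2 μ ≤ ε) : InL2Closure V μ v := by
  refine ⟨hm, fun ε hε => ?_⟩
  have hε2 : ε / 2 ≠ 0 := by simpa using hε
  obtain ⟨w, hw, hwv⟩ := h (ε / 2) hε2
  obtain ⟨u, hu, hum, hle⟩ := hw.2 (ε / 2) hε2
  refine ⟨u, hu, hum, ?_⟩
  calc eLpNorm (u - v) 2 μ = eLpNorm ((u - w) + (w - v)) 2 μ := by rw [sub_add_sub_cancel]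
    _ ≤ eLpNorm (u - w) 2 μ + eLpNorm (w - v) 2 μ :=
        eLpNorm_add_le (hum.sub hw.1) (hw.1.sub hm) one_le_two
    _ ≤ ε / 2 + ε / 2 := add_le_add hle hwv
    _ = ε := ENNReal.add_halves ε

theorem add (hv : InL2Closure V μ v) (hw : InL2Closure V μ w) : InL2Closure V μ (v + w) := by
  refine ⟨hv.1.add hw.1, fun ε hε => ?_⟩
  have hε2 : ε / 2 ≠ 0 := by simpa using hε
  obtain ⟨u, hu, hum, hle⟩ := hv.2 (ε / 2) hε2
  obtain ⟨u', hu', hum', hle'⟩ := hw.2 (ε / 2) hε2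
  refine ⟨u + u', V.add_mem hu hu', hum.add hum', ?_⟩
  calc eLpNorm (u + u' - (v + w)) 2 μ = eLpNorm ((u - v) + (u' - w)) 2 μ := by
        rw [add_sub_add_comm]
    _ ≤ eLpNorm (u - v) 2 μ + eLpNorm (u' - w) 2 μ :=
        eLpNorm_add_le (hum.sub hv.1) (hum'.sub hw.1) one_le_two
    _ ≤ ε / 2 + ε / 2 := add_le_add hle hle'
    _ = ε := ENNReal.add_halves ε

theorem smul (hv : InL2Closure V μ v) (c : ℝ) : InL2Closure V μ (c • v) := by
  rcases eq_or_ne c 0 with rfl | hc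
  · rw [zero_smul]
    exact .of_mem V.zero_mem aestronglyMeasurable_zero
  · refine ⟨hv.1.const_smul c, fun ε hε => ?_⟩
    obtain ⟨u, hu, hum, hle⟩ := hv.2 (ε / ‖c‖ₑ) (ENNReal.div_ne_zero.mpr ⟨hε, by simp⟩)
    refine ⟨c • u, V.smul_mem c hu, hum.const_smul c, ?_⟩
    rw [← smul_sub, eLpNorm_const_smul]
    calc ‖c‖ₑ * eLpNorm (u - v) 2 μ ≤ ‖c‖ₑ * (ε / ‖c‖ₑ) := by gcongr
      _ = ε := ENNReal.mul_div_cancel (by simpa using hc) (by simp)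

theorem sum {ι : Type*} (s : Finset ι) {f : ι → X → E} (h : ∀ i ∈ s, InL2Closure V μ (f i)) :
    InL2Closure V μ (∑ i ∈ s, f i) := by
  induction s using Finset.induction_on with
  | empty => simpa using .of_mem V.zero_mem aestronglyMeasurable_zero
  | insert i s hi ih =>
    rw [Finset.sum_insert hi]
    exact (h i (by simp)).add (ih fun j hj => h j (by simp [hj]))

theorem of_tendsto {f : ℕ → X → E} (hf : ∀ n, InL2Closure V μ (f n)) {b : X → ℝ}
    (hb : MemLp b 2 μ) (hfb : ∀ n, ∀ᵐ x ∂μ, ‖f n x‖ ≤ b x)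
    (hlim : ∀ᵐ x ∂μ, Tendsto (fun n => f n x) atTop (𝓝 (v x))) : InL2Closure V μ v := by
  have hm : AEStronglyMeasurable v μ :=
    aestronglyMeasurable_of_tendsto_ae atTop (fun n => (hf n).1) hlim
  have hvb : ∀ᵐ x ∂μ, ‖v x‖ ≤ b x := by
    filter_upwards [hlim, ae_all_iff.mpr hfb] with x hx hxb
    exact le_of_tendsto hx.norm (Eventually.of_forall hxb)
  have key : Tendsto (fun n => ∫⁻ x, ‖(f n - v) x‖ₑ ^ (2 : ℝ) ∂μ) atTop (𝓝 0) := by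
    have h0 : ∫⁻ _ : X, (0 : ℝ≥0∞) ∂μ = 0 := lintegral_zero
    rw [← h0]
    refine tendsto_lintegral_of_dominated_convergence' (fun x => ‖(2 : ℝ) • b x‖ₑ ^ (2 : ℝ))
      (fun n => ((hf n).1.sub hm).enorm.pow_const _) (fun n => ?_) ?_ ?_
    · filter_upwards [hfb n, hvb] with x h1 h2
      gcongr
      rw [enorm_le_iff_norm_le, Pi.sub_apply, norm_smul, Real.norm_ofNat]
      have h3 := norm_sub_le (f n x) (v x)
      have h4 := le_abs_self (b x)
      rw [Real.norm_eq_abs]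
      linarith
    · have h1 := (hb.const_smul (2 : ℝ)).2
      rw [eLpNorm_lt_top_iff_lintegral_rpow_enorm_lt_top (by simp) (by simp)] at h1
      simpa using h1.ne
    · filter_upwards [hlim] with x hx
      have h1 : Tendsto (fun n => ‖f n x - v x‖ₑ) atTop (𝓝 0) := by
        have := (hx.sub_const (v x)).enorm
        simpa using this
      have h2 := h1.ennrpow_const 2
      simpa using h2
  refine of_close hm fun ε hε => ?_
  have hε2 : (0 : ℝ≥0∞) < ε ^ (2 : ℝ) := by
    rw [ENNReal.rpow_ofNat]
    exact pos_iff_ne_zero.mpr (pow_ne_zero 2 hε)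
  obtain ⟨n, hn⟩ := (key.eventually (gt_mem_nhds hε2)).exists
  refine ⟨f n, hf n, ?_⟩
  rw [eLpNorm_eq_lintegral_rpow_enorm_toReal (by simp) (by simp), ENNReal.toReal_ofNat]
  calc (∫⁻ x, ‖(f n - v) x‖ₑ ^ (2 : ℝ) ∂μ) ^ (1 / (2 : ℝ)) ≤ (ε ^ (2 : ℝ)) ^ (1 / (2 : ℝ)) := by
        gcongr
    _ = ε := by rw [← ENNReal.rpow_mul]; norm_num

end InL2Closure

/-- Riemann sums of a continuous function converge to its integral. -/
theorem tendsto_riemannSum [CompleteSpace E] {T : ℝ} (hT : 0 < T) {φ : ℝ → E}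
    (hφ : ContinuousOn φ (Icc 0 T)) :
    Tendsto (fun n : ℕ => ∑ i ∈ Finset.range (n + 1), (T / (n + 1)) • φ (i * (T / (n + 1))))
      atTop (𝓝 (∫ σ in (0 : ℝ)..T, φ σ)) := by
  rw [Metric.tendsto_atTop]
  intro ε hε
  have huc := isCompact_Icc.uniformContinuousOn_of_continuous hφ
  rw [Metric.uniformContinuousOn_iff_le] at huc
  obtain ⟨δ, hδ, hδ'⟩ := huc (ε / (2 * T)) (by positivity)
  obtain ⟨n₀, hn₀⟩ := exists_nat_gt (T / δ)
  refine ⟨n₀, fun n hn => ?_⟩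
  have hn1 : (0 : ℝ) < n + 1 := by positivity
  set d : ℝ := T / (n + 1) with hd
  have hd0 : 0 < d := by positivity
  have hdT : (n + 1) * d = T := by rw [hd]; field_simp
  have hdδ : d ≤ δ := by
    rw [hd, div_le_iff₀ hn1]
    rw [div_lt_iff₀ hδ] at hn₀
    have : (n₀ : ℝ) ≤ n := by exact_mod_cast hn
    nlinarith
  have hmem : ∀ i < n + 1, ∀ σ ∈ Icc (i * d) ((i + 1 : ℕ) * d), σ ∈ Icc 0 T := by
    intro i hi σ hσ
    have hi' : ((i + 1 : ℕ) : ℝ) ≤ n + 1 := by exact_mod_cast hi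
    refine ⟨(by positivity : (0 : ℝ) ≤ i * d).trans hσ.1, hσ.2.trans ?_⟩
    rw [← hdT]
    gcongr
  have hle : ∀ i : ℕ, (i : ℝ) * d ≤ ((i + 1 : ℕ) : ℝ) * d := fun i => by
    push_cast
    nlinarith
  have hint : ∀ i < n + 1, IntervalIntegrable φ volume (i * d) ((i + 1 : ℕ) * d) := fun i hi => by
    refine (hφ.mono fun σ hσ => hmem i hi σ ?_).intervalIntegrable
    rwa [uIcc_of_le (hle i)] at hσ
  have hsum := intervalIntegral.sum_integral_adjacent_intervals (μ := volume) (f := φ)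
    (a := fun i : ℕ => (i : ℝ) * d) (n := n + 1) hint
  have hT' : ((n + 1 : ℕ) : ℝ) * d = T := by push_cast; exact hdT
  rw [hT', Nat.cast_zero, zero_mul] at hsum
  rw [← hsum, dist_eq_norm, ← Finset.sum_sub_distrib]
  have hterm : ∀ i ∈ Finset.range (n + 1),
      ‖d • φ (i * d) - ∫ σ in (i * d)..((i + 1 : ℕ) * d), φ σ‖ ≤ ε / (2 * T) * d := by
    intro i hi
    have hi' := Finset.mem_range.mp hi
    have h1 : d • φ (i * d) = ∫ σ in (i * d)..((i + 1 : ℕ) * d), φ (i * d) := by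
      rw [intervalIntegral.integral_const]
      congr 1
      push_cast
      ring
    rw [h1, ← intervalIntegral.integral_sub intervalIntegrable_const (hint i hi')]
    refine (intervalIntegral.norm_integral_le_of_norm_le_const (C := ε / (2 * T))
      fun σ hσ => ?_).trans (le_of_eq ?_)
    · rw [uIoc_of_le (hle i)] at hσ
      have h2 := hδ' (i * d) (hmem i hi' _ (left_mem_Icc.mpr (hle i))) σ
        (hmem i hi' _ ⟨hσ.1.le, hσ.2⟩) (by
          rw [Real.dist_eq, abs_sub_comm, abs_of_nonneg (by linarith [hσ.1])]
          have := hσ.2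
          push_cast at this
          linarith)
      rwa [dist_eq_norm] at h2
    · rw [abs_of_nonneg (by linarith [hle i])]
      push_cast
      ring
  calc ‖∑ i ∈ Finset.range (n + 1), (d • φ (i * d) - ∫ σ in (i * d)..((i + 1 : ℕ) * d), φ σ)‖
      ≤ ∑ i ∈ Finset.range (n + 1), ε / (2 * T) * d := norm_sum_le_of_le _ hterm
    _ = ε / 2 := by
        rw [Finset.sum_const, Finset.card_range, nsmul_eq_mul]
        push_cast
        rw [mul_left_comm, hdT]
        field_simp
    _ < ε := half_lt_self hε

theorem InL2Closure.integral [CompleteSpace E] {V : Submodule ℝ (X → E)} {μ : Measure X} {T : ℝ}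
    (hT : 0 < T) {f : ℝ → X → E} (hf : ∀ σ ∈ Icc 0 T, InL2Closure V μ (f σ)) {b : X → ℝ}
    (hb : MemLp b 2 μ) (hfb : ∀ᵐ x ∂μ, ∀ σ ∈ Icc 0 T, ‖f σ x‖ ≤ b x)
    (hcont : ∀ᵐ x ∂μ, ContinuousOn (fun σ => f σ x) (Icc 0 T)) :
    InL2Closure V μ fun x => ∫ σ in (0 : ℝ)..T, f σ x := by
  have hmem : ∀ n : ℕ, ∀ i ∈ Finset.range (n + 1), (i : ℝ) * (T / (n + 1)) ∈ Icc 0 T := by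
    intro n i hi
    have h1 : (i : ℝ) ≤ n + 1 := by exact_mod_cast (Finset.mem_range.mp hi).le
    refine ⟨by positivity, ?_⟩
    rw [mul_div_left_comm]
    exact mul_le_of_le_one_right hT.le (div_le_one_of_le₀ h1 (by positivity))
  refine InL2Closure.of_tendsto
    (f := fun n => ∑ i ∈ Finset.range (n + 1), (T / ((n : ℝ) + 1)) • f (i * (T / (n + 1))))
    (fun n => .sum _ fun i hi => (hf _ (hmem n i hi)).smul _) (hb.const_smul T) (fun n => ?_) ?_
  · filter_upwards [hfb] with x hx
    rw [Finset.sum_apply]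
    calc ‖∑ i ∈ Finset.range (n + 1), ((T / ((n : ℝ) + 1)) • f (i * (T / (n + 1)))) x‖
        ≤ ∑ i ∈ Finset.range (n + 1), T / ((n : ℝ) + 1) * b x :=
          norm_sum_le_of_le _ fun i hi => by
            rw [Pi.smul_apply, norm_smul, Real.norm_of_nonneg (by positivity)]
            exact mul_le_mul_of_nonneg_left (hx _ (hmem n i hi)) (by positivity)
      _ = (T • b) x := by
          rw [Finset.sum_const, Finset.card_range, nsmul_eq_mul, Pi.smul_apply, smul_eq_mul]
          push_cast
          field_simp
  · filter_upwards [hcont] with x hx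
    simpa only [Finset.sum_apply, Pi.smul_apply] using tendsto_riemannSum hT hx

end LpClosure

namespace FPData

section TestFunctions

variable {H : Type} [NormedAddCommGroup H] [InnerProductSpace ℝ H] [CompleteSpace H]
  [SecondCountableTopology H] [MeasurableSpace H] [BorelSpace H] (D : FPData H)

/-- `u` is classically differentiable as required by the Kolmogorov operator, with `L₀u = L`. -/
def HasKolmogorov (u L : ℝ × H → ℝ) : Prop :=
  ∃ (ut tr : ℝ × H → ℝ) (G m : ℝ × H → H) (B : ℝ × H → H →L[ℝ] H), ∀ p,
    HasDerivAt (fun r => u (r, p.2)) (ut p) p.1 ∧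
    HasFDerivAt (fun z => u (p.1, z)) (innerSL ℝ (G p)) p.2 ∧
    HasFDerivAt (fun z => G (p.1, z)) (B p) p.2 ∧
    HasSum (fun i => ⟪B p (D.sqrtC (D.basis i)), D.sqrtC (D.basis i)⟫_ℝ) (tr p) ∧
    (G p, m p) ∈ D.A.adjoint.graph ∧
    L p = ut p + 1 / 2 * tr p + ⟪p.2, m p⟫_ℝ + ⟪D.F p, G p⟫_ℝ

variable {D}

theorem HasKolmogorov.Lzero_eq {u L : ℝ × H → ℝ} (h : D.HasKolmogorov u L) (p : ℝ × H) :
    D.Lzero u p = L p := by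
  obtain ⟨ut, tr, G, m, B, h⟩ := h
  have hgrad : ∀ q : ℝ × H, gradient (fun z => u (q.1, z)) q.2 = G q := fun q =>
    HasGradientAt.gradient (hasGradientAt_iff_hasFDerivAt.mpr (h q).2.1)
  have hx : xGrad u p = G p := hgrad p
  obtain ⟨h1, -, h3, h4, h5, h6⟩ := h p
  have hgrad' : (gradient fun z => u (p.1, z)) = fun z => G (p.1, z) :=
    funext fun z => hgrad (p.1, z)
  obtain ⟨y, hy1, hy2⟩ := (LinearPMap.mem_graph_iff D.A.adjoint).mp h5
  simp only at hy1 hy2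
  have hdom : G p ∈ D.A.adjoint.domain := hy1 ▸ y.2
  have hA : D.A.adjoint ⟨G p, hdom⟩ = m p := by
    rw [← hy2]
    congr 1
    exact Subtype.ext hy1.symm
  rw [Lzero, Vzero, traceCD2, h1.deriv, hgrad', h3.fderiv, h4.tsum_eq]
  simp only [hx, dif_pos hdom, hA, h6]

theorem HasKolmogorov.add {u L u' L' : ℝ × H → ℝ} (h : D.HasKolmogorov u L)
    (h' : D.HasKolmogorov u' L') :
    D.HasKolmogorov (fun p => u p + u' p) (fun p => L p + L' p) := by
  obtain ⟨ut, tr, G, m, B, h⟩ := h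
  obtain ⟨ut', tr', G', m', B', h'⟩ := h'
  refine ⟨fun p => ut p + ut' p, fun p => tr p + tr' p, fun p => G p + G' p, fun p => m p + m' p,
    fun p => B p + B' p, fun p => ?_⟩
  obtain ⟨h1, h2, h3, h4, h5, h6⟩ := h p
  obtain ⟨h1', h2', h3', h4', h5', h6'⟩ := h' p
  refine ⟨h1.add h1', ?_, h3.add h3', ?_, D.A.adjoint.graph.add_mem h5 h5', ?_⟩
  · rw [map_add]
    exact h2.add h2'
  · simpa only [add_apply, inner_add_left] using h4.add h4'
  · simp only [h6, h6', inner_add_right]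
    ring

theorem HasKolmogorov.smul {u L : ℝ × H → ℝ} (h : D.HasKolmogorov u L) (c : ℝ) :
    D.HasKolmogorov (fun p => c * u p) (fun p => c * L p) := by
  obtain ⟨ut, tr, G, m, B, h⟩ := h
  refine ⟨fun p => c * ut p, fun p => c * tr p, fun p => c • G p, fun p => c • m p,
    fun p => c • B p, fun p => ?_⟩
  obtain ⟨h1, h2, h3, h4, h5, h6⟩ := h p
  refine ⟨h1.const_mul c, ?_, h3.const_smul c, ?_, D.A.adjoint.graph.smul_mem c h5, ?_⟩
  · rw [map_smul]
    exact h2.const_mul c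
  · simpa only [smul_apply, real_inner_smul_left] using h4.mul_left c
  · simp only [h6, real_inner_smul_right]
    ring

theorem HasKolmogorov.zero : D.HasKolmogorov (fun _ => 0) fun _ => 0 :=
  ⟨fun _ => 0, fun _ => 0, fun _ => 0, fun _ => 0, fun _ => 0, fun p =>
    ⟨hasDerivAt_const _ _, by rw [map_zero]; exact hasFDerivAt_const _ _, hasFDerivAt_const _ _,
      by simp, D.A.adjoint.graph.zero_mem, by simp⟩⟩

variable (D)

/-- The image of the test function `φ(t) cos(⟨x,k⟩ + c)` under the Kolmogorov operator. -/
noncomputable def kolmogorovCos (φ : ℝ → ℝ) (k a : H) (c : ℝ) (p : ℝ × H) : ℝ :=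
  deriv φ p.1 * Real.cos (⟪p.2, k⟫_ℝ + c) -
    1 / 2 * (φ p.1 * ⟪D.C k, k⟫_ℝ * Real.cos (⟪p.2, k⟫_ℝ + c)) -
    φ p.1 * Real.sin (⟪p.2, k⟫_ℝ + c) * (⟪p.2, a⟫_ℝ + ⟪D.F p, k⟫_ℝ)

theorem hasKolmogorov_cos {φ : ℝ → ℝ} (hφ : Differentiable ℝ φ) {k a : H}
    (hk : (k, a) ∈ D.A.adjoint.graph) (c : ℝ) :
    D.HasKolmogorov (fun p => φ p.1 * Real.cos (⟪p.2, k⟫_ℝ + c)) (D.kolmogorovCos φ k a c) := by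
  have hin : ∀ x : H, HasFDerivAt (fun z : H => ⟪z, k⟫_ℝ + c) (innerSL ℝ k) x := fun x => by
    have h1 := ((innerSL ℝ k).hasFDerivAt (x := x)).add_const c
    simpa [real_inner_comm] using h1
  refine ⟨fun p => deriv φ p.1 * Real.cos (⟪p.2, k⟫_ℝ + c),
    fun p => -(φ p.1 * ⟪D.C k, k⟫_ℝ * Real.cos (⟪p.2, k⟫_ℝ + c)),
    fun p => (-(φ p.1 * Real.sin (⟪p.2, k⟫_ℝ + c))) • k,
    fun p => (-(φ p.1 * Real.sin (⟪p.2, k⟫_ℝ + c))) • a,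
    fun p => ((-(φ p.1 * Real.cos (⟪p.2, k⟫_ℝ + c))) • innerSL ℝ k).smulRight k, fun p => ?_⟩
  refine ⟨(hφ p.1).hasDerivAt.mul_const (Real.cos (⟪p.2, k⟫_ℝ + c)), ?_, ?_, ?_, D.A.adjoint.graph.smul_mem _ hk, ?_⟩
  · refine (((hin p.2).cos).const_mul (φ p.1)).congr_fderiv ?_
    ext z
    simp only [smul_apply, innerSL_apply_apply, smul_eq_mul, real_inner_smul_left]
    ring
  · refine ((((hin p.2).sin).const_mul (φ p.1)).neg.smul_const k).congr_fderiv ?_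
    ext z
    simp only [ContinuousLinearMap.smulRight_apply, neg_apply, smul_apply, innerSL_apply_apply,
      smul_eq_mul]
    congr 1
    ring
  · have h0 : ‖D.sqrtC k‖ ^ 2 = ⟪D.C k, k⟫_ℝ := by
      rw [← real_inner_self_eq_norm_sq, ← D.sqrtC_sq, ContinuousLinearMap.comp_apply,
        ← ContinuousLinearMap.adjoint_inner_right, D.sqrtC_pos.isSelfAdjoint.adjoint_eq, real_inner_comm]
    have h1 := (D.basis.hasSum_sq_inner (D.sqrtC k)).mul_left
      (-(φ p.1 * Real.cos (⟪p.2, k⟫_ℝ + c)))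
    have h2 : ∀ i, ⟪k, D.sqrtC (D.basis i)⟫_ℝ = ⟪D.sqrtC k, D.basis i⟫_ℝ := fun i => by
      rw [← ContinuousLinearMap.adjoint_inner_left, D.sqrtC_pos.isSelfAdjoint.adjoint_eq]
    have h3 : -(φ p.1 * Real.cos (⟪p.2, k⟫_ℝ + c)) * ⟪D.C k, k⟫_ℝ =
        -(φ p.1 * ⟪D.C k, k⟫_ℝ * Real.cos (⟪p.2, k⟫_ℝ + c)) := by ring
    rw [h0, h3] at h1
    refine h1.congr_fun fun i => ?_
    simp only [ContinuousLinearMap.smulRight_apply, smul_apply, innerSL_apply_apply,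
      smul_eq_mul, real_inner_smul_left, h2]
    ring
  · simp only [kolmogorovCos, real_inner_smul_right]
    ring

/-- The pairs `(u, L₀u)` for `u = φ(t) cos(⟨x,k⟩ + c)`. -/
def basePairs : Set (ℝ × H → ℝ × ℝ) :=
  {v | ∃ (φ : ℝ → ℝ) (k a : H) (c : ℝ), ContDiff ℝ 1 φ ∧ φ D.T = 0 ∧
    (k, a) ∈ D.A.adjoint.graph ∧
    v = fun p => (φ p.1 * Real.cos (⟪p.2, k⟫_ℝ + c), D.kolmogorovCos φ k a c p)}

/-- The span of `basePairs`, a part of the graph of the Kolmogorov operator. -/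
def testPairs : Submodule ℝ (ℝ × H → ℝ × ℝ) := Submodule.span ℝ D.basePairs

theorem EA_of_cos {φ : ℝ → ℝ} (hφ : ContDiff ℝ 1 φ) (hφT : φ D.T = 0) {k a : H}
    (hk : (k, a) ∈ D.A.adjoint.graph) (c : ℝ) :
    (fun p : ℝ × H => φ p.1 * Real.cos (⟪p.2, k⟫_ℝ + c)) ∈ D.EA := by
  have hC : D.CinDAstar (fun _ => k) fun _ => a :=
    ⟨contDiffOn_const, contDiffOn_const, fun _ _ => hk⟩
  have h1 : (fun p : ℝ × H => φ p.1 * Real.cos ⟪p.2, k⟫_ℝ) ∈ D.EAgen :=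
    ⟨φ, fun _ => k, fun _ => a, hφ.contDiffOn, hφT, hC, Or.inl rfl⟩
  have h2 : (fun p : ℝ × H => φ p.1 * Real.sin ⟪p.2, k⟫_ℝ) ∈ D.EAgen :=
    ⟨φ, fun _ => k, fun _ => a, hφ.contDiffOn, hφT, hC, Or.inr rfl⟩
  have h3 : (fun p : ℝ × H => φ p.1 * Real.cos (⟪p.2, k⟫_ℝ + c)) =
      Real.cos c • (fun p : ℝ × H => φ p.1 * Real.cos ⟪p.2, k⟫_ℝ) +
        (-Real.sin c) • fun p : ℝ × H => φ p.1 * Real.sin ⟪p.2, k⟫_ℝ := by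
    funext p
    simp only [Pi.add_apply, Pi.smul_apply, smul_eq_mul, Real.cos_add]
    ring
  rw [h3]
  exact (Submodule.span ℝ D.EAgen).add_mem
    (Submodule.smul_mem _ _ (Submodule.subset_span h1))
    (Submodule.smul_mem _ _ (Submodule.subset_span h2))

theorem EA_and_hasKolmogorov_of_mem {v : ℝ × H → ℝ × ℝ} (hv : v ∈ D.testPairs) :
    (fun p => (v p).1) ∈ D.EA ∧ D.HasKolmogorov (fun p => (v p).1) fun p => (v p).2 := by
  induction hv using Submodule.span_induction with
  | mem v hv =>
    obtain ⟨φ, k, a, c, hφ, hφT, hk, rfl⟩ := hv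
    exact ⟨D.EA_of_cos hφ hφT hk c, D.hasKolmogorov_cos (hφ.differentiable one_ne_zero) hk c⟩
  | zero => exact ⟨(Submodule.span ℝ D.EAgen).zero_mem, .zero⟩
  | add v w _ _ hv hw =>
    exact ⟨(Submodule.span ℝ D.EAgen).add_mem hv.1 hw.1, hv.2.add hw.2⟩
  | smul c v _ hv => exact ⟨(Submodule.span ℝ D.EAgen).smul_mem c hv.1, hv.2.smul c⟩

end TestFunctions

end FPData

namespace FPData.OUData

section Resolvent

variable {H : Type} [NormedAddCommGroup H] [InnerProductSpace ℝ H] [CompleteSpace H]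
  [SecondCountableTopology H] [MeasurableSpace H] [BorelSpace H]
  {D : FPData H} {hyp : D.Hyp31} (O : D.OUData hyp)

/-- The pair formed by the potential of `g` and the value the Kolmogorov operator takes there. -/
noncomputable def resPair (lam : ℝ) (g : ℝ × H → ℝ) (p : ℝ × H) : ℝ × ℝ :=
  (O.U lam g p, lam * O.U lam g p - g p + O.Γ lam g p (D.F p))

/-- `e^{-λσ} e^{-⟨Q_σ k,k⟩/2}`. -/
noncomputable def _root_.FPData.weight (D : FPData H) (lam : ℝ) (k : H) (σ : ℝ) : ℝ :=
  Real.exp (-lam * σ) * Real.exp (-(D.covar k σ / 2))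

theorem _root_.FPData.weight_nonneg (D : FPData H) (lam : ℝ) (k : H) (σ : ℝ) :
    0 ≤ D.weight lam k σ := by
  unfold FPData.weight
  positivity

theorem _root_.FPData.weight_le (D : FPData H) (lam : ℝ) (k : H) {σ : ℝ} (hσ : σ ∈ Icc 0 D.T) :
    D.weight lam k σ ≤ D.expB lam := by
  have h1 : 0 ≤ D.covar k σ :=
    intervalIntegral.integral_nonneg hσ.1 fun r _ => D.covRate_nonneg k r
  have h2 : Real.exp (-(D.covar k σ / 2)) ≤ 1 := Real.exp_le_one_iff.mpr (by linarith)
  exact (mul_le_of_le_one_right (Real.exp_pos _).le h2).trans (D.exp_le_expB lam hσ)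

theorem _root_.FPData.hasDerivAt_weight (D : FPData H) (lam : ℝ) {k a : H}
    (hk : (k, a) ∈ D.A.adjoint.graph) (σ : ℝ) :
    HasDerivAt (D.weight lam k)
      (-(lam * D.weight lam k σ) - 1 / 2 * (D.covRate k σ * D.weight lam k σ)) σ := by
  have h1 : HasDerivAt (D.covar k) (D.covRate k σ) σ :=
    (D.continuous_covRate hk).integral_hasStrictDerivAt 0 σ |>.hasDerivAt
  have h2 := ((hasDerivAt_id σ).const_mul (-lam)).exp.mul ((h1.div_const 2).neg.exp)
  refine h2.congr_deriv ?_
  simp only [FPData.weight, id, Pi.neg_apply]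
  ring

theorem _root_.FPData.continuous_weight (D : FPData H) (lam : ℝ) {k a : H}
    (hk : (k, a) ∈ D.A.adjoint.graph) : Continuous (D.weight lam k) :=
  continuous_iff_continuousAt.mpr fun σ => (D.hasDerivAt_weight lam hk σ).continuousAt

/-- The curve of test functions whose integral is the potential of `φ(t) cos(⟨x,k⟩ + c)`. -/
noncomputable def _root_.FPData.resCurve (D : FPData H) (lam : ℝ) (φ : ℝ → ℝ) (k a : H) (c σ : ℝ) :
    ℝ × H → ℝ × ℝ :=
  D.weight lam k σ • fun p =>
    (φ (p.1 + σ) * Real.cos (⟪p.2, ContinuousLinearMap.adjoint (D.clampS σ) k⟫_ℝ + c),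
      D.kolmogorovCos (fun t => φ (t + σ)) (ContinuousLinearMap.adjoint (D.clampS σ) k)
        (ContinuousLinearMap.adjoint (D.clampS σ) a) c p)

theorem _root_.FPData.resCurve_mem (D : FPData H) (lam : ℝ) {φ : ℝ → ℝ} (hφ : ContDiff ℝ 1 φ)
    (hφT : ∀ t, D.T ≤ t → φ t = 0) {k a : H} (hk : (k, a) ∈ D.A.adjoint.graph) (c : ℝ) {σ : ℝ}
    (hσ : σ ∈ Icc 0 D.T) : D.resCurve lam φ k a c σ ∈ D.testPairs :=
  Submodule.smul_mem _ _ (Submodule.subset_span ⟨fun t => φ (t + σ), _, _, c,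
    hφ.comp (contDiff_id.add contDiff_const), hφT _ (by linarith [hσ.1]),
    D.adjoint_clampS_mem hk σ, rfl⟩)

theorem _root_.FPData.resCurve_apply (D : FPData H) (lam : ℝ) (φ : ℝ → ℝ) (k a : H) (c σ : ℝ)
    (p : ℝ × H) : D.resCurve lam φ k a c σ p =
      (D.weight lam k σ * (φ (p.1 + σ) * Real.cos (⟪D.clampS σ p.2, k⟫_ℝ + c)),
        D.weight lam k σ * (deriv φ (p.1 + σ) * Real.cos (⟪D.clampS σ p.2, k⟫_ℝ + c) -
          1 / 2 * (φ (p.1 + σ) * D.covRate k σ * Real.cos (⟪D.clampS σ p.2, k⟫_ℝ + c)) -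
          φ (p.1 + σ) * Real.sin (⟪D.clampS σ p.2, k⟫_ℝ + c) *
            (⟪D.clampS σ p.2, a⟫_ℝ + ⟪D.clampS σ (D.F p), k⟫_ℝ))) := by
  simp only [FPData.resCurve, FPData.kolmogorovCos, Pi.smul_apply, Prod.smul_mk, smul_eq_mul,
    ContinuousLinearMap.adjoint_inner_right, deriv_comp_add_const, FPData.covRate]

theorem _root_.FPData.measurable_resCurve (D : FPData H) (lam : ℝ) {φ : ℝ → ℝ}
    (hφ : ContDiff ℝ 1 φ) (k a : H) (c σ : ℝ) : Measurable (D.resCurve lam φ k a c σ) := by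
  have h1 := hφ.continuous
  have h2 := hφ.continuous_deriv le_rfl
  have h3 : Measurable fun p : ℝ × H => ⟪D.clampS σ (D.F p), k⟫_ℝ :=
    Measurable.comp (g := fun z => ⟪D.clampS σ z, k⟫_ℝ) (by fun_prop) D.F_meas
  rw [funext (D.resCurve_apply lam φ k a c σ)]
  fun_prop

theorem _root_.FPData.continuous_resCurve (D : FPData H) (lam : ℝ) {φ : ℝ → ℝ}
    (hφ : ContDiff ℝ 1 φ) {k a : H} (hk : (k, a) ∈ D.A.adjoint.graph) (c : ℝ) (p : ℝ × H) :
    Continuous fun σ => D.resCurve lam φ k a c σ p := by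
  have h1 := hφ.continuous
  have h2 := hφ.continuous_deriv le_rfl
  have h3 := D.continuous_clampS_apply p.2
  have h4 := D.continuous_clampS_apply (D.F p)
  have h5 := D.continuous_weight lam hk
  have h6 := D.continuous_covRate hk
  simp_rw [fun σ => D.resCurve_apply lam φ k a c σ p]
  fun_prop

theorem _root_.FPData.exists_norm_resCurve_le (D : FPData H) (lam : ℝ) {φ : ℝ → ℝ}
    (hφ : ContDiff ℝ 1 φ) {k a : H} (hk : (k, a) ∈ D.A.adjoint.graph) (c : ℝ) :
    ∃ B : ℝ, ∀ p : ℝ × H, p.1 ∈ Icc 0 D.T → ∀ σ ∈ Icc 0 D.T,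
      ‖D.resCurve lam φ k a c σ p‖ ≤ B * ((1 + ‖p.2‖) * (1 + ‖D.F p‖)) := by
  obtain ⟨B₁, hB₁⟩ := isCompact_Icc.exists_bound_of_continuousOn
    (s := Icc 0 (D.T + D.T)) hφ.continuous.continuousOn
  obtain ⟨B₂, hB₂⟩ := isCompact_Icc.exists_bound_of_continuousOn
    (s := Icc 0 (D.T + D.T)) (hφ.continuous_deriv le_rfl).continuousOn
  obtain ⟨B₃, hB₃⟩ := isCompact_Icc.exists_bound_of_continuousOn
    (s := Icc 0 D.T) (D.continuous_covRate hk).continuousOn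
  refine ⟨D.expB lam * (|B₁| + |B₂| + |B₁| * |B₃| + |B₁| * (D.bdS * ‖a‖ + D.bdS * ‖k‖)),
    fun p hp σ hσ => ?_⟩
  have hm : p.1 + σ ∈ Icc 0 (D.T + D.T) := ⟨add_nonneg hp.1 hσ.1, add_le_add hp.2 hσ.2⟩
  have h1 : |φ (p.1 + σ)| ≤ |B₁| := (hB₁ _ hm).trans (le_abs_self _)
  have h2 : |deriv φ (p.1 + σ)| ≤ |B₂| := (hB₂ _ hm).trans (le_abs_self _)
  have h3 : |D.covRate k σ| ≤ |B₃| := (hB₃ _ hσ).trans (le_abs_self _)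
  have hc := Real.abs_cos_le_one (⟪D.clampS σ p.2, k⟫_ℝ + c)
  have hs := Real.abs_sin_le_one (⟪D.clampS σ p.2, k⟫_ℝ + c)
  have hin : ∀ x b : H, |⟪D.clampS σ x, b⟫_ℝ| ≤ D.bdS * ‖b‖ * ‖x‖ := fun x b =>
    (abs_real_inner_le_norm _ _).trans ((mul_le_mul_of_nonneg_right
      (D.norm_clampS_apply_le σ x) (norm_nonneg b)).trans (le_of_eq (by ring)))
  have h4 := hin p.2 a
  have h5 := hin (D.F p) k
  have hw := D.weight_le lam k hσ
  have hw0 := D.weight_nonneg lam k σ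
  have hS := D.bdS_pos
  have hx := norm_nonneg p.2
  have hF := norm_nonneg (D.F p)
  have hxF : 1 ≤ (1 + ‖p.2‖) * (1 + ‖D.F p‖) := by nlinarith [mul_nonneg hx hF]
  have hxle : ‖p.2‖ ≤ (1 + ‖p.2‖) * (1 + ‖D.F p‖) := by nlinarith [mul_nonneg hx hF]
  have hFle : ‖D.F p‖ ≤ (1 + ‖p.2‖) * (1 + ‖D.F p‖) := by nlinarith [mul_nonneg hx hF]
  set G := (1 + ‖p.2‖) * (1 + ‖D.F p‖)
  rw [D.resCurve_apply, Prod.norm_mk, mul_assoc (D.expB lam)]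
  refine max_le ?_ ?_
  · rw [norm_mul, Real.norm_of_nonneg hw0]
    refine mul_le_mul hw ?_ (norm_nonneg _) (D.expB_pos lam).le
    rw [Real.norm_eq_abs, abs_mul]
    calc |φ (p.1 + σ)| * |Real.cos (⟪D.clampS σ p.2, k⟫_ℝ + c)| ≤ |B₁| * 1 := by gcongr
      _ ≤ |B₁| * G := by gcongr
      _ ≤ _ := by
        gcongr
        have : 0 ≤ |B₂| + |B₁| * |B₃| + |B₁| * (D.bdS * ‖a‖ + D.bdS * ‖k‖) := by positivity
        linarith
  · rw [norm_mul, Real.norm_of_nonneg hw0]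
    refine mul_le_mul hw ?_ (norm_nonneg _) (D.expB_pos lam).le
    rw [Real.norm_eq_abs]
    refine (abs_sub _ _).trans ((add_le_add_left (abs_sub _ _) _).trans ?_)
    simp only [abs_mul]
    have e1 : |deriv φ (p.1 + σ)| * |Real.cos (⟪D.clampS σ p.2, k⟫_ℝ + c)| ≤ |B₂| * G :=
      calc _ ≤ |B₂| * 1 := by gcongr
        _ ≤ |B₂| * G := by gcongr
    have e2 : |(1 : ℝ) / 2| * (|φ (p.1 + σ)| * |D.covRate k σ| *
        |Real.cos (⟪D.clampS σ p.2, k⟫_ℝ + c)|) ≤ |B₁| * |B₃| * G :=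
      calc _ ≤ 1 * (|B₁| * |B₃| * 1) := by
            gcongr
            rw [abs_of_pos (by norm_num)]
            norm_num
        _ ≤ |B₁| * |B₃| * G := by
            rw [one_mul]
            gcongr
    have e3 : |φ (p.1 + σ)| * |Real.sin (⟪D.clampS σ p.2, k⟫_ℝ + c)| *
        |⟪D.clampS σ p.2, a⟫_ℝ + ⟪D.clampS σ (D.F p), k⟫_ℝ| ≤
          |B₁| * (D.bdS * ‖a‖ + D.bdS * ‖k‖) * G :=
      calc _ ≤ |B₁| * 1 * (D.bdS * ‖a‖ * ‖p.2‖ + D.bdS * ‖k‖ * ‖D.F p‖) := by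
            gcongr
            exact (abs_add_le _ _).trans (add_le_add h4 h5)
        _ ≤ |B₁| * 1 * (D.bdS * ‖a‖ * G + D.bdS * ‖k‖ * G) := by gcongr
        _ = _ := by ring
    have e4 : 0 ≤ |B₁| * G := by positivity
    linarith

theorem semi_mul_cos {k a : H} (hk : (k, a) ∈ D.A.adjoint.graph) {σ : ℝ} (hσ : σ ∈ Ioc 0 D.T)
    (φ : ℝ → ℝ) (c : ℝ) (p : ℝ × H) :
    O.semi (fun q => φ q.1 * Real.cos (⟪q.2, k⟫_ℝ + c)) σ p =
      φ (p.1 + σ) * (Real.cos (⟪D.clampS σ p.2, k⟫_ℝ + c) * Real.exp (-(D.covar k σ / 2))) := by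
  have h1 := O.semi_cos hk hσ 0 c p
  simp only [zero_mul, zero_add] at h1
  rw [← h1]
  unfold semi
  exact integral_const_mul (φ (p.1 + σ)) _

theorem dsemi_mul_cos {k a : H} (hk : (k, a) ∈ D.A.adjoint.graph) {σ : ℝ} (hσ : σ ∈ Ioc 0 D.T)
    (φ : ℝ → ℝ) (c : ℝ) (p : ℝ × H) (h : H) :
    O.dsemi (fun q => φ q.1 * Real.cos (⟪q.2, k⟫_ℝ + c)) σ p h =
      φ (p.1 + σ) * -(Real.sin (⟪D.clampS σ p.2, k⟫_ℝ + c) * ⟪D.clampS σ h, k⟫_ℝ *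
        Real.exp (-(D.covar k σ / 2))) := by
  have h1 := O.dsemi_cos hk hσ 0 c p h
  simp only [zero_mul, zero_add] at h1
  rw [← h1]
  unfold dsemi
  simp only [mul_assoc]
  exact integral_const_mul (φ (p.1 + σ)) _

theorem integral_resCurve (lam : ℝ) {φ : ℝ → ℝ} (hφ : ContDiff ℝ 1 φ)
    (hφT : ∀ t, D.T ≤ t → φ t = 0) {k a : H} (hk : (k, a) ∈ D.A.adjoint.graph) (c : ℝ)
    {p : ℝ × H} (hp : 0 ≤ p.1) :
    ∫ σ in (0 : ℝ)..D.T, D.resCurve lam φ k a c σ p =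
      O.resPair lam (fun q => φ q.1 * Real.cos (⟪q.2, k⟫_ℝ + c)) p := by
  have h1 := hφ.continuous
  have h2 := hφ.continuous_deriv le_rfl
  have h3 := D.continuous_clampS_apply p.2
  have h4 := D.continuous_clampS_apply (D.F p)
  have h5 := D.continuous_weight lam hk
  have h6 := D.continuous_covRate hk
  set u : ℝ → ℝ := fun σ =>
    D.weight lam k σ * (φ (p.1 + σ) * Real.cos (⟪D.clampS σ p.2, k⟫_ℝ + c)) with hu
  set w : ℝ → ℝ := fun σ => D.weight lam k σ *
    (φ (p.1 + σ) * Real.sin (⟪D.clampS σ p.2, k⟫_ℝ + c) * ⟪D.clampS σ (D.F p), k⟫_ℝ) with hw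
  set u' : ℝ → ℝ := fun σ => -(lam * u σ) - 1 / 2 * (D.covRate k σ * u σ) +
    D.weight lam k σ * (deriv φ (p.1 + σ) * Real.cos (⟪D.clampS σ p.2, k⟫_ℝ + c) -
      φ (p.1 + σ) * Real.sin (⟪D.clampS σ p.2, k⟫_ℝ + c) * ⟪D.clampS σ p.2, a⟫_ℝ) with hu'
  have hcu : Continuous u := by fun_prop
  have hcw : Continuous w := by fun_prop
  have hcu' : Continuous u' := by fun_prop
  have hU : O.U lam (fun q => φ q.1 * Real.cos (⟪q.2, k⟫_ℝ + c)) p = ∫ σ in (0 : ℝ)..D.T, u σ := by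
    refine intervalIntegral.integral_congr_ae (Eventually.of_forall fun σ hσ => ?_)
    rw [uIoc_of_le D.hT.le] at hσ
    simp only [O.semi_mul_cos hk hσ, hu, FPData.weight]
    ring
  have hΓ : O.Γ lam (fun q => φ q.1 * Real.cos (⟪q.2, k⟫_ℝ + c)) p (D.F p) =
      -∫ σ in (0 : ℝ)..D.T, w σ := by
    rw [← intervalIntegral.integral_neg]
    refine intervalIntegral.integral_congr_ae (Eventually.of_forall fun σ hσ => ?_)
    rw [uIoc_of_le D.hT.le] at hσ
    simp only [O.dsemi_mul_cos hk hσ, hw, FPData.weight]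
    ring
  have hFTC : ∫ σ in (0 : ℝ)..D.T, u' σ = -(φ p.1 * Real.cos (⟪p.2, k⟫_ℝ + c)) := by
    have hθ : ∀ σ, HasDerivAt (fun σ => ⟪p.2, k⟫_ℝ + ∫ r in (0 : ℝ)..σ, ⟪D.clampS r p.2, a⟫_ℝ)
        ⟪D.clampS σ p.2, a⟫_ℝ σ := fun σ => by
      have hc : Continuous fun r => ⟪D.clampS r p.2, a⟫_ℝ := by fun_prop
      exact (hc.integral_hasStrictDerivAt 0 σ).hasDerivAt.const_add _
    have hθ' : ∀ σ ∈ Icc 0 D.T,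
        ⟪p.2, k⟫_ℝ + ∫ r in (0 : ℝ)..σ, ⟪D.clampS r p.2, a⟫_ℝ = ⟪D.clampS σ p.2, k⟫_ℝ :=
      fun σ hσ => (D.inner_clampS_eq hk p.2 hσ).symm
    have hd : ∀ σ ∈ uIcc 0 D.T, HasDerivAt (fun σ => D.weight lam k σ * (φ (p.1 + σ) *
        Real.cos (⟪p.2, k⟫_ℝ + (∫ r in (0 : ℝ)..σ, ⟪D.clampS r p.2, a⟫_ℝ) + c))) (u' σ) σ := by
      intro σ hσ
      rw [uIcc_of_le D.hT.le] at hσ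
      have e1 : HasDerivAt (fun σ => φ (p.1 + σ)) (deriv φ (p.1 + σ)) σ :=
        ((hφ.differentiable one_ne_zero) (p.1 + σ)).hasDerivAt.comp_const_add p.1 σ
      have e2 := (D.hasDerivAt_weight lam hk σ).mul (e1.mul ((hθ σ).add_const c).cos)
      refine e2.congr_deriv ?_
      simp only [hu', hu, Pi.mul_apply, hθ' σ hσ]
      ring
    rw [intervalIntegral.integral_eq_sub_of_hasDerivAt hd (hcu'.intervalIntegrable _ _)]
    rw [hφT (p.1 + D.T) (by linarith)]
    simp [FPData.weight, FPData.covar]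
  have hcurve : ∀ σ, D.resCurve lam φ k a c σ p = (u σ, u' σ + lam * u σ - w σ) := fun σ => by
    rw [D.resCurve_apply]
    simp only [hu', hu, hw]
    ring_nf
  simp_rw [hcurve]
  rw [resPair, hU, hΓ]
  have hi1 : IntervalIntegrable (fun σ => (u σ, u' σ + lam * u σ - w σ)) volume 0 D.T :=
    Continuous.intervalIntegrable (by fun_prop) _ _
  have e1 := (ContinuousLinearMap.fst ℝ ℝ ℝ).intervalIntegral_comp_comm hi1
  have e2 := (ContinuousLinearMap.snd ℝ ℝ ℝ).intervalIntegral_comp_comm hi1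
  simp only [ContinuousLinearMap.coe_fst', ContinuousLinearMap.coe_snd'] at e1 e2
  refine Prod.ext e1.symm ?_
  rw [← e2, intervalIntegral.integral_sub, intervalIntegral.integral_add, hFTC,
    intervalIntegral.integral_const_mul]
  · simp only
    ring
  all_goals exact Continuous.intervalIntegrable (by fun_prop) _ _

variable {μ : Measure (ℝ × H)}

theorem inL2Closure_resPair_cos (hμ : ∀ᵐ p ∂μ, p.1 ∈ Icc 0 D.T)
    (hb : MemLp (fun p : ℝ × H => (1 + ‖p.2‖) * (1 + ‖D.F p‖)) 2 μ) (lam : ℝ) {φ : ℝ → ℝ}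
    (hφ : ContDiff ℝ 1 φ) (hφT : ∀ t, D.T ≤ t → φ t = 0) {k a : H}
    (hk : (k, a) ∈ D.A.adjoint.graph) (c : ℝ) :
    InL2Closure D.testPairs μ (O.resPair lam fun q => φ q.1 * Real.cos (⟪q.2, k⟫_ℝ + c)) := by
  obtain ⟨B, hB⟩ := D.exists_norm_resCurve_le lam hφ hk c
  refine (InL2Closure.integral D.hT (f := D.resCurve lam φ k a c) (fun σ hσ => .of_mem
    (D.resCurve_mem lam hφ hφT hk c hσ)
    (D.measurable_resCurve lam hφ k a c σ).aestronglyMeasurable) (hb.const_smul B) ?_ ?_).congr_ae ?_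
  · filter_upwards [hμ] with p hp σ hσ
    exact hB p hp σ hσ
  · exact Eventually.of_forall fun p => (D.continuous_resCurve lam hφ hk c p).continuousOn
  · filter_upwards [hμ] with p hp
    exact O.integral_resCurve lam hφ hφT hk c hp.1

end Resolvent

end FPData.OUData

namespace FPData

section Cut

variable {H : Type} [NormedAddCommGroup H] [InnerProductSpace ℝ H] [CompleteSpace H]
  [SecondCountableTopology H] [MeasurableSpace H] [BorelSpace H] (D : FPData H)

/-- Truncation to times before `T`. -/
noncomputable def cut (g : ℝ × H → ℝ) (p : ℝ × H) : ℝ := if p.1 < D.T then g p else 0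

variable {D}

theorem LinGrowth.cut {M : ℝ} {g : ℝ × H → ℝ} (hg : LinGrowth M g) : LinGrowth M (D.cut g) := by
  refine hg.mono (Measurable.ite (measurableSet_lt measurable_fst measurable_const) hg.1
    measurable_const) fun p => ?_
  unfold FPData.cut
  split_ifs
  · rfl
  · simp

theorem cut_add (f g : ℝ × H → ℝ) :
    D.cut (fun p => f p + g p) = fun p => D.cut f p + D.cut g p := by
  ext p
  simp only [FPData.cut]
  split_ifs <;> simp

theorem cut_smul (a : ℝ) (f : ℝ × H → ℝ) : D.cut (fun p => a * f p) = fun p => a * D.cut f p := by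
  ext p
  simp only [FPData.cut]
  split_ifs <;> simp

variable (D)

/-- Smooth functions of time vanishing after `T` and increasing to `1` before `T`. -/
noncomputable def ramp (n : ℕ) (t : ℝ) : ℝ := Real.smoothTransition (n * (D.T - t))

theorem contDiff_ramp (n : ℕ) : ContDiff ℝ 1 (D.ramp n) :=
  Real.smoothTransition.contDiff.comp (contDiff_const.mul (contDiff_const.sub contDiff_id))

theorem ramp_of_le (n : ℕ) {t : ℝ} (ht : D.T ≤ t) : D.ramp n t = 0 :=
  Real.smoothTransition.zero_of_nonpos (mul_nonpos_of_nonneg_of_nonpos n.cast_nonneg (by linarith))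

theorem abs_ramp_le (n : ℕ) (t : ℝ) : |D.ramp n t| ≤ 1 := by
  rw [ramp, abs_of_nonneg (Real.smoothTransition.nonneg _)]
  exact Real.smoothTransition.le_one _

theorem tendsto_ramp (t : ℝ) :
    Tendsto (fun n => D.ramp n t) atTop (𝓝 (if t < D.T then 1 else 0)) := by
  split_ifs with h
  · have h1 : Tendsto (fun n : ℕ => (n : ℝ) * (D.T - t)) atTop atTop :=
      tendsto_natCast_atTop_atTop.atTop_mul_const (by linarith)
    refine tendsto_const_nhds.congr' ?_
    filter_upwards [h1.eventually_ge_atTop 1] with n hn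
    exact (Real.smoothTransition.one_of_one_le hn).symm
  · simp_rw [fun n => D.ramp_of_le n (not_lt.mp h)]
    exact tendsto_const_nhds

theorem tendsto_ramp_mul (g : ℝ × H → ℝ) (p : ℝ × H) :
    Tendsto (fun n => D.ramp n p.1 * g p) atTop (𝓝 (D.cut g p)) := by
  convert (D.tendsto_ramp p.1).mul_const (g p) using 2
  simp [cut]

theorem linGrowth_ramp_mul {M : ℝ} {g : ℝ × H → ℝ} (hg : LinGrowth M g) (n : ℕ) :
    LinGrowth M fun p => D.ramp n p.1 * g p := by
  refine hg.mono ((((D.contDiff_ramp n).continuous.measurable).comp measurable_fst).mul hg.1)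
    fun p => ?_
  rw [abs_mul]
  exact mul_le_of_le_one_left (abs_nonneg _) (D.abs_ramp_le n p.1)

theorem linGrowth_cos (a : ℝ) (k : H) (c : ℝ) :
    LinGrowth 1 fun p : ℝ × H => Real.cos (a * p.1 + ⟪p.2, k⟫_ℝ + c) :=
  .of_bounded (by fun_prop) fun _ => Real.abs_cos_le_one _

/-- A travelling wave as a combination of products of functions of time and standing waves. -/
theorem cos_add_inner (a : ℝ) (k : H) (c : ℝ) (p : ℝ × H) :
    Real.cos (a * p.1 + ⟪p.2, k⟫_ℝ + c) =
      Real.cos (a * p.1) * Real.cos (⟪p.2, k⟫_ℝ + c) +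
        Real.sin (a * p.1) * Real.cos (⟪p.2, k⟫_ℝ + (c + Real.pi / 2)) := by
  rw [← add_assoc _ c, Real.cos_add_pi_div_two, add_assoc, Real.cos_add]
  ring

end Cut

end FPData

namespace FPData.OUData

section ResolventClosure

variable {H : Type} [NormedAddCommGroup H] [InnerProductSpace ℝ H] [CompleteSpace H]
  [SecondCountableTopology H] [MeasurableSpace H] [BorelSpace H]
  {D : FPData H} {hyp : D.Hyp31} (O : D.OUData hyp) {M N : ℝ} {f g : ℝ × H → ℝ} (lam : ℝ)

theorem resPair_add (hf : LinGrowth M f) (hg : LinGrowth N g) :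
    O.resPair lam (fun q => f q + g q) = O.resPair lam f + O.resPair lam g := by
  ext p
  · exact O.U_add lam hf hg p
  · simp only [resPair, O.U_add lam hf hg p, O.Γ_add lam hf hg p, Pi.add_apply, Prod.snd_add]
    ring

theorem resPair_smul (a : ℝ) : O.resPair lam (fun q => a * f q) = a • O.resPair lam f := by
  ext p
  · exact O.U_smul lam a p
  · simp only [resPair, O.U_smul lam a p, O.Γ_smul lam a p, Pi.smul_apply, Prod.smul_snd,
      smul_eq_mul]
    ring

theorem norm_resPair_le (hg : LinGrowth M g) (p : ℝ × H) :
    ‖O.resPair lam g p‖ ≤ ((1 + |lam|) * (D.expB lam * D.T * M * O.growth) + M +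
      D.expB lam * hyp.gam * M * O.growth) * ((1 + ‖p.2‖) * (1 + ‖D.F p‖)) := by
  have hM := hg.nonneg
  have hx := norm_nonneg p.2
  have hF := norm_nonneg (D.F p)
  have hG := O.growth_pos
  have hE := D.expB_pos lam
  have hT := D.hT
  have hγ := hyp.gam_nonneg
  have h1 := O.abs_U_le lam hg p
  have h2 := O.abs_Γ_le lam hg p (D.F p)
  have h3 := hg.2 p
  set a := D.expB lam * D.T * M * O.growth
  set b := D.expB lam * hyp.gam * M * O.growth
  have ha : 0 ≤ a := by positivity
  have hb : 0 ≤ b := by positivity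
  have hX : (1 + ‖p.2‖) ≤ (1 + ‖p.2‖) * (1 + ‖D.F p‖) :=
    le_mul_of_one_le_right (by positivity) (by linarith)
  have hXF : (1 + ‖p.2‖) * ‖D.F p‖ ≤ (1 + ‖p.2‖) * (1 + ‖D.F p‖) := by gcongr; linarith
  set G := (1 + ‖p.2‖) * (1 + ‖D.F p‖)
  have hG0 : 0 ≤ G := by positivity
  have e1 : |O.U lam g p| ≤ a * G := h1.trans (by gcongr)
  have e2 : |O.Γ lam g p (D.F p)| ≤ b * G := h2.trans (by rw [mul_assoc]; gcongr)
  have e3 : |g p| ≤ M * G := h3.trans (by gcongr)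
  have e4 : 0 ≤ |lam| * (a * G) := by positivity
  have e5 : 0 ≤ M * G := by positivity
  have e6 : 0 ≤ b * G := by positivity
  rw [resPair, Prod.norm_mk]
  refine max_le ?_ ?_
  · rw [Real.norm_eq_abs]
    linarith
  · rw [Real.norm_eq_abs]
    refine (abs_add_le _ _).trans ((add_le_add_left (abs_sub _ _) _).trans ?_)
    rw [abs_mul]
    have e7 : |lam| * |O.U lam g p| ≤ |lam| * (a * G) := by gcongr
    linarith [mul_nonneg ha hG0]

theorem tendsto_resPair {f : ℕ → ℝ × H → ℝ} (hf : ∀ n, LinGrowth M (f n))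
    (hlim : ∀ p, Tendsto (fun n => f n p) atTop (𝓝 (g p))) (p : ℝ × H) :
    Tendsto (fun n => O.resPair lam (f n) p) atTop (𝓝 (O.resPair lam g p)) :=
  (O.tendsto_U lam hf hlim p).prodMk_nhds ((((O.tendsto_U lam hf hlim p).const_mul lam).sub
    (hlim p)).add (O.tendsto_Γ lam hf hlim p (D.F p)))

variable {μ : Measure (ℝ × H)}

theorem inL2Closure_resPair_of_tendsto
    (hb : MemLp (fun p : ℝ × H => (1 + ‖p.2‖) * (1 + ‖D.F p‖)) 2 μ) {f : ℕ → ℝ × H → ℝ}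
    (hf : ∀ n, LinGrowth M (f n)) (hmem : ∀ n, InL2Closure D.testPairs μ (O.resPair lam (f n)))
    (hlim : ∀ p, Tendsto (fun n => f n p) atTop (𝓝 (g p))) :
    InL2Closure D.testPairs μ (O.resPair lam g) :=
  .of_tendsto hmem (hb.const_mul _)
    (fun n => Eventually.of_forall fun p => O.norm_resPair_le lam (hf n) p)
    (Eventually.of_forall (O.tendsto_resPair lam hf hlim))

theorem inL2Closure_resPair (hμ : ∀ᵐ p ∂μ, p.1 ∈ Icc 0 D.T)
    (hb : MemLp (fun p : ℝ × H => (1 + ‖p.2‖) * (1 + ‖D.F p‖)) 2 μ) (hg : LinGrowth M g) :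
    InL2Closure D.testPairs μ (O.resPair lam (D.cut g)) := by
  refine D.linGrowth_induction
    (fun g => InL2Closure D.testPairs μ (O.resPair lam (D.cut g))) ?_ ?_ ?_ ?_ hg
  · intro a k hk c
    refine O.inL2Closure_resPair_of_tendsto lam hb
      (D.linGrowth_ramp_mul (linGrowth_cos a k c)) (fun n => ?_) (D.tendsto_ramp_mul _)
    have hk' := LinearPMap.mem_graph D.A.adjoint ⟨k, hk⟩
    have key : ∀ (ψ : ℝ → ℝ) (d : ℝ), ContDiff ℝ 1 ψ → (∀ t, |ψ t| ≤ 1) →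
        (LinGrowth 1 fun q : ℝ × H => D.ramp n q.1 * ψ q.1 * Real.cos (⟪q.2, k⟫_ℝ + d)) ∧
        InL2Closure D.testPairs μ (O.resPair lam fun q =>
          D.ramp n q.1 * ψ q.1 * Real.cos (⟪q.2, k⟫_ℝ + d)) := by
      intro ψ d hψ hψ1
      constructor
      · have h1 := (D.contDiff_ramp n).continuous
        have h2 := hψ.continuous
        refine .of_bounded (by fun_prop) fun p => ?_
        rw [abs_mul, abs_mul]
        exact mul_le_one₀ (mul_le_one₀ (D.abs_ramp_le n _) (abs_nonneg _) (hψ1 _)) (abs_nonneg _)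
          (Real.abs_cos_le_one _)
      · exact O.inL2Closure_resPair_cos hμ hb lam ((D.contDiff_ramp n).mul hψ)
          (fun t ht => by rw [D.ramp_of_le n ht, zero_mul]) hk' d
    obtain ⟨h1, h2⟩ := key (fun t => Real.cos (a * t)) c (by fun_prop)
      fun _ => Real.abs_cos_le_one _
    obtain ⟨h3, h4⟩ := key (fun t => Real.sin (a * t)) (c + Real.pi / 2) (by fun_prop)
      fun _ => Real.abs_sin_le_one _
    have h5 := h2.add h4
    rw [← O.resPair_add lam h1 h3] at h5
    simp only [cos_add_inner, mul_add]
    simpa only [mul_assoc] using h5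
  · intro M N f g hf hg h1 h2
    rw [cut_add, O.resPair_add lam hf.cut hg.cut]
    exact h1.add h2
  · intro a M f _ h
    rw [cut_smul, O.resPair_smul]
    exact h.smul a
  · intro M f g hf _ h hlim
    refine O.inL2Closure_resPair_of_tendsto lam hb (fun n => (hf n).cut) h fun p => ?_
    unfold FPData.cut
    split_ifs
    · exact hlim p
    · exact tendsto_const_nhds

end ResolventClosure

end FPData.OUData

theorem HilbertBasis.stronglyMeasurable_dual {ι X H : Type*} [NormedAddCommGroup H]
    [InnerProductSpace ℝ H] [CompleteSpace H] [SecondCountableTopology H] [MeasurableSpace H]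
    [BorelSpace H] [MeasurableSpace X] (b : HilbertBasis ι ℝ H) {L : X → H →L[ℝ] ℝ} (h : ∀ z, Measurable fun x => L x z) :
    StronglyMeasurable L := by
  have := b.countable_index
  refine stronglyMeasurable_of_tendsto atTop
    (f := fun (s : Finset ι) x => ∑ i ∈ s, L x (b i) • innerSL ℝ (b i)) (fun s => ?_)
    (tendsto_pi_nhds.mpr fun x => ?_)
  · exact Finset.stronglyMeasurable_fun_sum s fun i _ =>
      (h (b i)).stronglyMeasurable.smul_const _
  · set v := (InnerProductSpace.toDual ℝ H).symm (L x) with hv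
    have h1 : InnerProductSpace.toDual ℝ H v = L x := by rw [hv, LinearIsometryEquiv.apply_symm_apply]
    have h2 := ((b.hasSum_repr v).mapL (innerSL ℝ : H →L[ℝ] H →L[ℝ] ℝ))
    have h3 : innerSL ℝ v = L x := h1
    rw [h3] at h2
    refine HasSum.congr_fun (f := fun i => innerSL ℝ (b.repr v i • b i)) h2 fun i => ?_
    rw [map_smul, b.repr_apply_apply, real_inner_comm, ← h3]
    rfl

namespace FPData.OUData

section Gradient

variable {H : Type} [NormedAddCommGroup H] [InnerProductSpace ℝ H] [CompleteSpace H]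
  [SecondCountableTopology H] [MeasurableSpace H] [BorelSpace H]
  {D : FPData H} {hyp : D.Hyp31} (O : D.OUData hyp) {M : ℝ} {g : ℝ × H → ℝ}

/-- `dsemi` as a continuous linear functional of the direction. -/
noncomputable def dsemiL (hg : LinGrowth M g) (σ : ℝ) (p : ℝ × H) : H →L[ℝ] ℝ :=
  (innerSL ℝ ((O.memLp_shift hg σ p).toLp _)).comp (O.noise σ)

theorem dsemiL_apply (hg : LinGrowth M g) (σ : ℝ) (p : ℝ × H) (h : H) :
    O.dsemiL hg σ p h = O.dsemi g σ p h :=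
  (O.integral_mul_noise (O.memLp_shift hg σ p) h).symm

theorem norm_dsemiL_le (hg : LinGrowth M g) (σ : ℝ) (p : ℝ × H) :
    ‖O.dsemiL hg σ p‖ ≤ M * O.growth * (1 + ‖p.2‖) * ‖hyp.Λ σ‖ :=
  ContinuousLinearMap.opNorm_le_bound _
    (mul_nonneg (O.growth_mul_nonneg hg p.2) (norm_nonneg _)) fun h => by
      rw [dsemiL_apply, Real.norm_eq_abs, mul_assoc _ _ ‖h‖]
      exact O.abs_dsemi_le hg σ p h

theorem stronglyMeasurable_dsemiL (hg : LinGrowth M g) (p : ℝ × H) :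
    StronglyMeasurable fun σ => O.dsemiL hg σ p :=
  D.basis.stronglyMeasurable_dual fun h => by
    simp_rw [dsemiL_apply]
    exact O.measurable_dsemi hg p h

/-- The increments of `semi` in space are integrals of `dsemi` along segments. -/
theorem semi_sub_semi (hg : LinGrowth M g) {σ : ℝ} (hσ : σ ∈ Ioc 0 D.T) (t : ℝ) (x h : H) :
    (Measurable fun θ : ℝ => O.dsemi g σ (t, x + θ • h) h) ∧
      O.semi g σ (t, x + h) - O.semi g σ (t, x) =
        ∫ θ in (0 : ℝ)..1, O.dsemi g σ (t, x + θ • h) h := by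
  have hbound : ∀ {M : ℝ} {g : ℝ × H → ℝ}, LinGrowth M g → ∀ θ ∈ Ioc (0 : ℝ) 1,
      ‖O.dsemi g σ (t, x + θ • h) h‖ ≤
        M * O.growth * (1 + (‖x‖ + ‖h‖)) * (‖hyp.Λ σ‖ * ‖h‖) := by
    intro M g hg θ hθ
    refine (O.abs_dsemi_le hg σ _ h).trans ?_
    have h1 := hg.nonneg
    have h2 := O.growth_pos
    gcongr
    refine (norm_add_le _ _).trans ?_
    gcongr
    rw [norm_smul, Real.norm_of_nonneg hθ.1.le]
    exact mul_le_of_le_one_left (norm_nonneg _) hθ.2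
  have hint : ∀ {M : ℝ} {g : ℝ × H → ℝ}, LinGrowth M g →
      (Measurable fun θ : ℝ => O.dsemi g σ (t, x + θ • h) h) →
      IntervalIntegrable (fun θ : ℝ => O.dsemi g σ (t, x + θ • h) h) volume 0 1 := by
    intro M g hg hm
    refine (intervalIntegrable_const (c := M * O.growth * (1 + (‖x‖ + ‖h‖)) *
      (‖hyp.Λ σ‖ * ‖h‖))).mono_fun' hm.aestronglyMeasurable ?_
    rw [uIoc_of_le zero_le_one]
    filter_upwards [ae_restrict_mem measurableSet_Ioc] with θ hθ
    exact hbound hg θ hθ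
  refine D.linGrowth_induction (fun g => (Measurable fun θ : ℝ => O.dsemi g σ (t, x + θ • h) h) ∧
      O.semi g σ (t, x + h) - O.semi g σ (t, x) =
        ∫ θ in (0 : ℝ)..1, O.dsemi g σ (t, x + θ • h) h) ?_ ?_ ?_ ?_ hg
  · intro b k hk c
    have hk' := LinearPMap.mem_graph D.A.adjoint ⟨k, hk⟩
    simp_rw [fun θ : ℝ => O.dsemi_cos hk' hσ b c (t, x + θ • h) h,
      fun p => O.semi_cos hk' hσ b c p]
    simp only [map_add, map_smul, inner_add_left, real_inner_smul_left]
    refine ⟨by fun_prop, ?_⟩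
    have hd : ∀ θ ∈ uIcc (0 : ℝ) 1, HasDerivAt (fun θ : ℝ => Real.cos (b * (t + σ) +
        (⟪D.clampS σ x, k⟫_ℝ + θ * ⟪D.clampS σ h, k⟫_ℝ) + c) * Real.exp (-(D.covar k σ / 2)))
        (-(Real.sin (b * (t + σ) + (⟪D.clampS σ x, k⟫_ℝ + θ * ⟪D.clampS σ h, k⟫_ℝ) + c) *
          ⟪D.clampS σ h, k⟫_ℝ * Real.exp (-(D.covar k σ / 2)))) θ := by
      intro θ _
      have h1 := (((((hasDerivAt_id θ).mul_const ⟪D.clampS σ h, k⟫_ℝ).const_add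
        ⟪D.clampS σ x, k⟫_ℝ).const_add (b * (t + σ))).add_const c).cos.mul_const
          (Real.exp (-(D.covar k σ / 2)))
      refine h1.congr_deriv ?_
      simp only [id]
      ring
    rw [intervalIntegral.integral_eq_sub_of_hasDerivAt hd
      (Continuous.intervalIntegrable (by fun_prop) _ _)]
    simp
  · rintro M N f g hf hg ⟨hf1, hf2⟩ ⟨hg1, hg2⟩
    simp_rw [fun p => O.semi_add hf hg σ p, fun θ : ℝ => O.dsemi_add hf hg σ (t, x + θ • h) h]
    refine ⟨hf1.add hg1, ?_⟩
    rw [intervalIntegral.integral_add (hint hf hf1) (hint hg hg1), ← hf2, ← hg2]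
    ring
  · rintro a M f hf ⟨hf1, hf2⟩
    simp_rw [fun p => O.semi_smul (f := f) a σ p,
      fun θ : ℝ => O.dsemi_smul (f := f) a σ (t, x + θ • h) h]
    refine ⟨hf1.const_mul a, ?_⟩
    rw [intervalIntegral.integral_const_mul, ← hf2]
    ring
  · intro M f g hf hg hP hlim
    refine ⟨measurable_of_tendsto_metrizable (fun n => (hP n).1)
      (tendsto_pi_nhds.mpr fun θ => O.tendsto_dsemi hf hlim σ _ h), ?_⟩
    refine tendsto_nhds_unique ((O.tendsto_semi hf hlim σ _).sub (O.tendsto_semi hf hlim σ _)) ?_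
    simp_rw [fun n => (hP n).2]
    refine intervalIntegral.tendsto_integral_filter_of_dominated_convergence
      (fun _ => M * O.growth * (1 + (‖x‖ + ‖h‖)) * (‖hyp.Λ σ‖ * ‖h‖))
      (Eventually.of_forall fun n => (hP n).1.aestronglyMeasurable)
      (Eventually.of_forall fun n => Eventually.of_forall fun θ hθ => ?_)
      intervalIntegrable_const
      (Eventually.of_forall fun θ _ => O.tendsto_dsemi hf hlim σ _ h)
    rw [uIoc_of_le zero_le_one] at hθ
    exact hbound (hf n) θ hθ

/-- Continuity of translations in `L²` of the Gaussian measure. -/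
theorem tendsto_eLpNorm_shift_sub (hg : LinGrowth M g) (σ t : ℝ)
    (hc : Continuous fun z => g (t + σ, z)) (x : H) :
    Tendsto (fun x' => eLpNorm (fun y => g (t + σ, D.clampS σ x' + y) -
      g (t + σ, D.clampS σ x + y)) 2 (O.gauss σ)) (𝓝 x) (𝓝 0) := by
  have hM := hg.nonneg
  have hbd := D.bdS_pos
  have hb : MemLp (fun y => M * (2 + D.bdS) * (1 + ‖D.clampS σ x + y‖)) 2 (O.gauss σ) :=
    O.memLp_shift (linGrowth_bound (M := M * (2 + D.bdS)) (by positivity)) σ (t, x)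
  have hle : ∀ᶠ x' in 𝓝 x, ∀ y, ‖g (t + σ, D.clampS σ x' + y) - g (t + σ, D.clampS σ x + y)‖ ≤
      ‖M * (2 + D.bdS) * (1 + ‖D.clampS σ x + y‖)‖ := by
    filter_upwards [Metric.ball_mem_nhds x one_pos] with x' hx' y
    rw [mem_ball_iff_norm] at hx'
    refine (norm_sub_le _ _).trans (((add_le_add (hg.2 _) (hg.2 _))).trans
      (le_trans ?_ (le_abs_self _)))
    have h1 : ‖D.clampS σ x' + y‖ ≤ ‖D.clampS σ x + y‖ + D.bdS := by
      have h2 : D.clampS σ x' + y = (D.clampS σ x + y) + D.clampS σ (x' - x) := by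
        rw [map_sub]
        abel
      rw [h2]
      refine (norm_add_le _ _).trans ?_
      gcongr
      refine (D.norm_clampS_apply_le σ _).trans ?_
      exact mul_le_of_le_one_right hbd.le hx'.le
    simp only
    nlinarith [mul_le_mul_of_nonneg_left h1 hM,
      mul_nonneg (mul_nonneg hM hbd.le) (norm_nonneg (D.clampS σ x + y))]
  have key : Tendsto (fun x' => ∫⁻ y, ‖g (t + σ, D.clampS σ x' + y) -
      g (t + σ, D.clampS σ x + y)‖ₑ ^ (2 : ℝ) ∂(O.gauss σ)) (𝓝 x) (𝓝 0) := by
    have h0 : (0 : ℝ≥0∞) = ∫⁻ _, 0 ∂(O.gauss σ) := by simp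
    rw [h0]
    refine tendsto_lintegral_filter_of_dominated_convergence
      (fun y => ‖M * (2 + D.bdS) * (1 + ‖D.clampS σ x + y‖)‖ₑ ^ (2 : ℝ))
      (Eventually.of_forall fun x' => ?_) ?_ ?_ (Eventually.of_forall fun y => ?_)
    · exact (((measurable_shift hg.1 σ (t, x')).sub
        (measurable_shift hg.1 σ (t, x))).enorm.pow_const _)
    · filter_upwards [hle] with x' hx'
      refine Eventually.of_forall fun y => ENNReal.rpow_le_rpow ?_ (by norm_num)
      exact enorm_le_iff_norm_le.mpr (hx' y)
    · have := (eLpNorm_lt_top_iff_lintegral_rpow_enorm_lt_top (by simp) (by simp)).mp hb.2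
      simpa using this.ne
    · have h1 : Continuous fun x' => g (t + σ, D.clampS σ x' + y) - g (t + σ, D.clampS σ x + y) :=
        (hc.comp (by fun_prop : Continuous fun x' => D.clampS σ x' + y)).sub continuous_const
      have h2 : Tendsto (fun x' => g (t + σ, D.clampS σ x' + y) - g (t + σ, D.clampS σ x + y))
          (𝓝 x) (𝓝 0) := by
        have := h1.tendsto x
        rwa [sub_self] at this
      have h3 := h2.enorm
      rw [enorm_zero] at h3
      simpa using h3.ennrpow_const 2
  have h1 := key.ennrpow_const (1 / 2)
  rw [ENNReal.zero_rpow_of_pos (by norm_num)] at h1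
  refine h1.congr fun x' => ?_
  rw [eLpNorm_eq_lintegral_rpow_enorm_toReal (by simp) (by simp)]
  simp

theorem hasFDerivAt_semi (hg : LinGrowth M g) {σ : ℝ} (hσ : σ ∈ Ioc 0 D.T) (t : ℝ)
    (hc : Continuous fun z => g (t + σ, z)) (x : H) :
    HasFDerivAt (fun z => O.semi g σ (t, z)) (O.dsemiL hg σ (t, x)) x := by
  rw [hasFDerivAt_iff_isLittleO_nhds_zero, Asymptotics.isLittleO_iff]
  intro ε hε
  have hΛ : 0 < ‖hyp.Λ σ‖ + 1 := by positivity
  have h1 := (O.tendsto_eLpNorm_shift_sub hg σ t hc x).eventually_le_const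
    (ENNReal.ofReal_pos.mpr (div_pos hε hΛ))
  obtain ⟨δ, hδ, hball⟩ := Metric.eventually_nhds_iff_ball.mp h1
  filter_upwards [Metric.ball_mem_nhds (0 : H) hδ] with h hh
  rw [mem_ball_zero_iff] at hh
  obtain ⟨hm, he⟩ := O.semi_sub_semi hg hσ t x h
  have hdiff : ∀ θ ∈ Ioc (0 : ℝ) 1,
      ‖O.dsemi g σ (t, x + θ • h) h - O.dsemi g σ (t, x) h‖ ≤ ε * ‖h‖ := by
    intro θ hθ
    have hxb : x + θ • h ∈ Metric.ball x δ := by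
      rw [mem_ball_iff_norm, add_sub_cancel_left, norm_smul, Real.norm_of_nonneg hθ.1.le]
      exact (mul_le_of_le_one_left (norm_nonneg _) hθ.2).trans_lt hh
    have h2 := hball _ hxb
    have h3 : MemLp (fun y => g (t + σ, D.clampS σ (x + θ • h) + y) -
        g (t + σ, D.clampS σ x + y)) 2 (O.gauss σ) :=
      (O.memLp_shift hg σ (t, x + θ • h)).sub (O.memLp_shift hg σ (t, x))
    have h4 := O.abs_integral_mul_noise_le h3 h (div_pos hε hΛ).le h2
    simp_rw [sub_mul] at h4
    rw [integral_sub (O.integrable_mul_noise (O.memLp_shift hg σ (t, x + θ • h)) h)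
      (O.integrable_mul_noise (O.memLp_shift hg σ (t, x)) h)] at h4
    refine h4.trans ?_
    rw [← mul_assoc]
    gcongr
    rw [div_mul_eq_mul_div, div_le_iff₀ hΛ]
    nlinarith
  have hint : IntervalIntegrable (fun θ : ℝ => O.dsemi g σ (t, x + θ • h) h - O.dsemi g σ (t, x) h)
      volume 0 1 := by
    refine (intervalIntegrable_const (c := ε * ‖h‖)).mono_fun'
      (hm.sub measurable_const).aestronglyMeasurable ?_
    rw [uIoc_of_le zero_le_one]
    filter_upwards [ae_restrict_mem measurableSet_Ioc] with θ hθ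
    exact hdiff θ hθ
  have hc1 : IntervalIntegrable (fun _ : ℝ => O.dsemi g σ (t, x) h) volume 0 1 :=
    intervalIntegrable_const
  have h5 : O.semi g σ (t, x + h) - O.semi g σ (t, x) - O.dsemiL hg σ (t, x) h =
      ∫ θ in (0 : ℝ)..1, (O.dsemi g σ (t, x + θ • h) h - O.dsemi g σ (t, x) h) := by
    have h6 := intervalIntegral.integral_add hint hc1
    simp only [sub_add_cancel, intervalIntegral.integral_const, sub_zero, one_smul] at h6
    rw [he, h6, dsemiL_apply, add_sub_cancel_right]
  rw [h5]
  have h7 := intervalIntegral.norm_integral_le_of_norm_le_const (a := (0 : ℝ)) (b := 1)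
    (C := ε * ‖h‖) (fun θ hθ => hdiff θ (by rwa [uIoc_of_le zero_le_one] at hθ))
  simpa using h7

theorem hasGradientAt_U (lam : ℝ) (hg : LinGrowth M g) (t : ℝ)
    (hc : ∀ σ ∈ Ioc 0 D.T, Continuous fun z => g (t + σ, z)) (x : H) :
    ∃ v : H, HasGradientAt (fun z => O.U lam g (t, z)) v x ∧
      ∀ h, ⟪v, h⟫_ℝ = O.Γ lam g (t, x) h := by
  have hE := D.expB_pos lam
  have hM := hg.nonneg
  have hG := O.growth_pos
  set B : ℝ := D.expB lam * (M * O.growth * (1 + (‖x‖ + 1))) with hB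
  have hsm : StronglyMeasurable fun σ => Real.exp (-lam * σ) • O.dsemiL hg σ (t, x) :=
    (Real.continuous_exp.comp (continuous_const.mul continuous_id)).stronglyMeasurable.smul (O.stronglyMeasurable_dsemiL hg (t, x))
  have hbd : ∀ σ ∈ Ioc 0 D.T, ∀ x' ∈ Metric.ball x 1,
      ‖Real.exp (-lam * σ) • O.dsemiL hg σ (t, x')‖ ≤ B * ‖hyp.Λ σ‖ := by
    intro σ hσ x' hx'
    rw [norm_smul, Real.norm_of_nonneg (Real.exp_pos _).le, hB, mul_assoc (D.expB lam)]
    refine mul_le_mul (D.exp_le_expB lam ⟨hσ.1.le, hσ.2⟩) ?_ (norm_nonneg _) hE.le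
    refine (O.norm_dsemiL_le hg σ _).trans ?_
    gcongr
    rw [mem_ball_iff_norm] at hx'
    linarith [norm_le_norm_add_norm_sub' x' x]
  have hint : IntervalIntegrable (fun σ => B * ‖hyp.Λ σ‖) volume 0 D.T :=
    hyp.intervalIntegrable_norm.const_mul B
  have h1 : HasFDerivAt (fun z => O.U lam g (t, z))
      (∫ σ in (0 : ℝ)..D.T, Real.exp (-lam * σ) • O.dsemiL hg σ (t, x)) x := by
    refine intervalIntegral.hasFDerivAt_integral_of_dominated_of_fderiv_le
      (F := fun z σ => Real.exp (-lam * σ) * O.semi g σ (t, z))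
      (F' := fun z σ => Real.exp (-lam * σ) • O.dsemiL hg σ (t, z))
      (bound := fun σ => B * ‖hyp.Λ σ‖) (Metric.ball_mem_nhds x one_pos)
      (Eventually.of_forall fun z =>
        (O.stronglyMeasurable_U_integrand lam hg.1 (t, z)).aestronglyMeasurable)
      (O.intervalIntegrable_U lam hg (t, x)) hsm.aestronglyMeasurable
      (Eventually.of_forall fun σ hσ => hbd σ (by rwa [uIoc_of_le D.hT.le] at hσ)) hint
      (Eventually.of_forall fun σ hσ z _ => ?_)
    rw [uIoc_of_le D.hT.le] at hσ
    exact (O.hasFDerivAt_semi hg hσ t (hc σ hσ) z).const_mul _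
  refine ⟨(InnerProductSpace.toDual ℝ H).symm
    (∫ σ in (0 : ℝ)..D.T, Real.exp (-lam * σ) • O.dsemiL hg σ (t, x)), ?_, fun h => ?_⟩
  · rw [hasGradientAt_iff_hasFDerivAt, LinearIsometryEquiv.apply_symm_apply]
    exact h1
  · have hi : IntervalIntegrable (fun σ => Real.exp (-lam * σ) • O.dsemiL hg σ (t, x))
        volume 0 D.T := by
      refine hint.mono_fun' hsm.aestronglyMeasurable ?_
      rw [uIoc_of_le D.hT.le]
      filter_upwards [ae_restrict_mem measurableSet_Ioc] with σ hσ
      exact hbd σ hσ x (Metric.mem_ball_self one_pos)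
    rw [InnerProductSpace.toDual_symm_apply, ContinuousLinearMap.intervalIntegral_apply hi]
    simp only [smul_apply, dsemiL_apply, smul_eq_mul]
    rfl

end Gradient

end FPData.OUData

section DriftData

variable {H : Type} [NormedAddCommGroup H] [InnerProductSpace ℝ H] [CompleteSpace H]
  [SecondCountableTopology H] [MeasurableSpace H] [BorelSpace H] {D : FPData H}

theorem MemCu2.continuous {φ : H → ℝ} (h : MemCu2 φ) : Continuous φ := by
  have h1 : φ = fun x => φ x / (1 + ‖x‖ ^ 2) * (1 + ‖x‖ ^ 2) := by
    funext x
    rw [div_mul_cancel₀ _ (by positivity)]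
  rw [h1]
  exact h.1.continuous.mul (by fun_prop)

theorem FPData.MemCT.continuousOn {g : ℝ → H → ℝ} (hg : D.MemCT g) :
    ContinuousOn (fun p : ℝ × H => g p.1 p.2) (Icc 0 D.T ×ˢ univ) := by
  rintro ⟨t₀, x₀⟩ ⟨ht₀, -⟩
  have h1 : Tendsto (fun p : ℝ × H => g t₀ p.2) (𝓝[Icc 0 D.T ×ˢ univ] (t₀, x₀)) (𝓝 (g t₀ x₀)) :=
    (((hg.1 t₀ ht₀).continuous.comp continuous_snd).tendsto (t₀, x₀)).mono_left nhdsWithin_le_nhds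
  have h2 : Tendsto (fun p : ℝ × H => g p.1 p.2 - g t₀ p.2) (𝓝[Icc 0 D.T ×ˢ univ] (t₀, x₀))
      (𝓝 0) := by
    rw [Metric.tendsto_nhds]
    intro ε hε
    have hc : 0 < 2 + ‖x₀‖ ^ 2 := by positivity
    obtain ⟨δ, hδ, hδ'⟩ := hg.2 t₀ ht₀ (ε / 2 / (2 + ‖x₀‖ ^ 2)) (by positivity)
    have h3 : ∀ᶠ p : ℝ × H in 𝓝 (t₀, x₀), 1 + ‖p.2‖ ^ 2 < 2 + ‖x₀‖ ^ 2 :=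
      ContinuousAt.eventually_lt (f := fun p : ℝ × H => 1 + ‖p.2‖ ^ 2) (by fun_prop)
        continuousAt_const (by simp only; linarith)
    have h4 : ∀ᶠ p : ℝ × H in 𝓝 (t₀, x₀), |p.1 - t₀| < δ :=
      ContinuousAt.eventually_lt (f := fun p : ℝ × H => |p.1 - t₀|) (by fun_prop)
        continuousAt_const (by simpa using hδ)
    filter_upwards [h3.filter_mono nhdsWithin_le_nhds, h4.filter_mono nhdsWithin_le_nhds,
      self_mem_nhdsWithin] with p hp3 hp4 hp
    rw [Real.dist_eq, sub_zero]
    calc |g p.1 p.2 - g t₀ p.2| ≤ ε / 2 / (2 + ‖x₀‖ ^ 2) * (1 + ‖p.2‖ ^ 2) := hδ' _ hp.1 hp4 _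
      _ ≤ ε / 2 / (2 + ‖x₀‖ ^ 2) * (2 + ‖x₀‖ ^ 2) := by gcongr
      _ = ε / 2 := div_mul_cancel₀ _ hc.ne'
      _ < ε := by linarith
  simpa [ContinuousWithinAt] using h2.add h1

theorem FPData.Hyp33.exists_norm_le {F0 : ℝ × H → H} (hF0 : D.Hyp33 F0) :
    ∃ C, 0 ≤ C ∧ ∀ p : ℝ × H, p.1 ∈ Icc 0 D.T → ‖F0 p‖ ≤ C * (1 + ‖p.2‖) := by
  obtain ⟨h1, -, -, K, hK, h2⟩ := hF0
  obtain ⟨B, hB⟩ := isCompact_Icc.exists_bound_of_continuousOn (s := Icc 0 D.T)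
    (f := fun t => F0 (t, 0)) (h1.comp (by fun_prop) fun t ht => ⟨ht, mem_univ _⟩)
  have hB0 : 0 ≤ B := (norm_nonneg _).trans (hB 0 ⟨le_rfl, D.hT.le⟩)
  refine ⟨B + K, by positivity, fun p hp => ?_⟩
  have h3 := h2 p.1 hp p.2 0
  rw [sub_zero] at h3
  have h4 := norm_le_norm_add_norm_sub' (F0 p) (F0 (p.1, 0))
  have h5 := hB p.1 hp
  have h6 := mul_nonneg hB0 (norm_nonneg p.2)
  simp only [Prod.mk.eta] at h3
  linarith

theorem FPData.GradInCTCuHH.exists_norm_le {u : ℝ × H → ℝ} (hu : D.GradInCTCuHH u) :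
    ∃ C, ∀ p : ℝ × H, p.1 ∈ Icc 0 D.T → ‖xGrad u p‖ ≤ C := by
  have key : ∃ C, ∀ t ∈ Icc 0 D.T, ∀ x : H, ‖xGrad u (t, x)‖ ≤ C := by
    refine isCompact_Icc.induction_on (p := fun s => ∃ C, ∀ t ∈ s, ∀ x : H, ‖xGrad u (t, x)‖ ≤ C)
      ⟨0, by simp⟩ (fun s t hst ⟨C, hC⟩ => ⟨C, fun r hr => hC r (hst hr)⟩) ?_ ?_
    · rintro s t ⟨C, hC⟩ ⟨C', hC'⟩
      refine ⟨max C C', ?_⟩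
      rintro r (hr | hr) x
      · exact (hC r hr x).trans (le_max_left _ _)
      · exact (hC' r hr x).trans (le_max_right _ _)
    · intro t₀ ht₀
      obtain ⟨C, hC⟩ := (hu.1 t₀ ht₀).2
      obtain ⟨δ, hδ, hδ'⟩ := hu.2 t₀ ht₀ 1 one_pos
      refine ⟨Icc 0 D.T ∩ Metric.ball t₀ δ, inter_mem self_mem_nhdsWithin
        (mem_nhdsWithin_of_mem_nhds (Metric.ball_mem_nhds t₀ hδ)), C + 1, fun t ht x => ?_⟩
      have h1 := hδ' t ht.1 (by simpa [Real.dist_eq] using ht.2) x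
      linarith [norm_le_norm_add_norm_sub' (xGrad u (t, x)) (xGrad u (t₀, x)), hC x]
  obtain ⟨C, hC⟩ := key
  exact ⟨C, fun p hp => hC p.1 hp p.2⟩

/-- Extension by zero of a function on `[0,T] × H`. -/
noncomputable def FPData.extend (D : FPData H) (g : ℝ → H → ℝ) (p : ℝ × H) : ℝ :=
  if p.1 ∈ Icc 0 D.T then g p.1 p.2 else 0

theorem FPData.MemCT.measurable_extend {g : ℝ → H → ℝ} (hg : D.MemCT g) :
    Measurable (D.extend g) := by
  have hs : MeasurableSet (Icc 0 D.T ×ˢ (univ : Set H)) := measurableSet_Icc.prod MeasurableSet.univ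
  have heq : D.extend g =
      (Icc 0 D.T ×ˢ (univ : Set H)).piecewise (fun p => g p.1 p.2) fun _ => 0 := by
    funext p
    by_cases hp : p.1 ∈ Icc 0 D.T
    · rw [FPData.extend, if_pos hp, Set.piecewise_eq_of_mem _ _ _ (mem_prod.mpr ⟨hp, mem_univ _⟩)]
    · rw [FPData.extend, if_neg hp, Set.piecewise_eq_of_notMem _ _ _ fun h' => hp h'.1]
  rw [heq]
  exact hg.continuousOn.measurable_piecewise continuousOn_const hs

theorem FPData.MemCT.continuous_cut_extend {g : ℝ → H → ℝ} (hg : D.MemCT g) (t : ℝ) :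
    Continuous fun z => D.cut (D.extend g) (t, z) := by
  unfold FPData.cut FPData.extend
  simp only
  split_ifs with h1 h2
  · exact (hg.1 t h2).continuous
  · exact continuous_const
  · exact continuous_const

end DriftData

namespace FPData.OUData

section Identification

variable {H : Type} [NormedAddCommGroup H] [InnerProductSpace ℝ H] [CompleteSpace H]
  [SecondCountableTopology H] [MeasurableSpace H] [BorelSpace H]
  {D : FPData H} {hyp : D.Hyp31} (O : D.OUData hyp) {M : ℝ} (lam : ℝ)

theorem U_cut {g : ℝ × H → ℝ} (hg : LinGrowth M g) {p : ℝ × H} (hp : p.1 ∈ Icc 0 D.T) :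
    O.U lam (D.cut g) p =
      ∫ σ in (0 : ℝ)..(D.T - p.1), Real.exp (-lam * σ) * O.semi g σ p := by
  have hi := O.intervalIntegrable_U lam (hg.cut (D := D)) p
  have h0 : D.T - p.1 ∈ uIcc 0 D.T := by
    rw [uIcc_of_le D.hT.le]
    exact ⟨by linarith [hp.2], by linarith [hp.1]⟩
  have h1 : ∫ σ in (D.T - p.1)..D.T, Real.exp (-lam * σ) * O.semi (D.cut g) σ p = 0 := by
    refine intervalIntegral.integral_zero_ae (Eventually.of_forall fun σ hσ => ?_)
    rw [uIoc_of_le (by linarith [hp.1])] at hσ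
    have h2 : ¬ p.1 + σ < D.T := by linarith [hσ.1]
    simp [semi, FPData.cut, h2]
  unfold U
  rw [← intervalIntegral.integral_add_adjacent_intervals
    (hi.mono_set (uIcc_subset_uIcc left_mem_uIcc h0))
    (hi.mono_set (uIcc_subset_uIcc h0 right_mem_uIcc)), h1, add_zero]
  have hne : ∀ᵐ σ : ℝ, σ ≠ D.T - p.1 := by simp [ae_iff]
  refine intervalIntegral.integral_congr_ae ?_
  filter_upwards [hne] with σ hσ hmem
  rw [uIoc_of_le (by linarith [hp.2])] at hmem
  have h2 : p.1 + σ < D.T := by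
    have := lt_of_le_of_ne hmem.2 hσ
    linarith
  simp [semi, FPData.cut, h2]

theorem abs_U_cut_le {g : ℝ × H → ℝ} (hg : LinGrowth M g) {p : ℝ × H} (hp : p.1 ∈ Icc 0 D.T) :
    |O.U lam (D.cut g) p| ≤ (D.T - p.1) * (D.expB lam * (M * O.growth) * (1 + ‖p.2‖)) := by
  have h1 := intervalIntegral.norm_integral_le_of_norm_le_const
    (a := 0) (b := D.T - p.1) (f := fun σ => Real.exp (-lam * σ) * O.semi g σ p)
    (C := D.expB lam * (M * O.growth * (1 + ‖p.2‖))) fun σ hσ => by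
      rw [uIoc_of_le (by linarith [hp.2])] at hσ
      exact O.norm_U_integrand_le lam hg p ⟨hσ.1.le, by linarith [hσ.2, hp.1]⟩
  rw [sub_zero, abs_of_nonneg (by linarith [hp.2])] at h1
  rw [O.U_cut lam hg hp]
  refine h1.trans (le_of_eq ?_)
  ring

theorem U_cut_extend {g : ℝ → H → ℝ} (hg : LinGrowth M (D.extend g)) {p : ℝ × H}
    (hp : p.1 ∈ Icc 0 D.T) : O.U lam (D.cut (D.extend g)) p = O.Gop lam g p := by
  rw [O.U_cut lam hg hp]
  have h1 : ∫ σ in (0 : ℝ)..(D.T - p.1), Real.exp (-lam * σ) * O.semi (D.extend g) σ p =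
      ∫ σ in (0 : ℝ)..(D.T - p.1), Real.exp (-lam * (σ + p.1 - p.1)) *
        O.Rop (σ + p.1 - p.1) (g (σ + p.1)) p.2 := by
    refine intervalIntegral.integral_congr_ae (Eventually.of_forall fun σ hσ => ?_)
    rw [uIoc_of_le (by linarith [hp.2])] at hσ
    have hσT : σ ∈ Ioc 0 D.T := ⟨hσ.1, by linarith [hσ.2, hp.1]⟩
    have hm : p.1 + σ ∈ Icc 0 D.T := ⟨by linarith [hσ.1, hp.1], by linarith [hσ.2]⟩
    rw [add_sub_cancel_right, add_comm σ p.1]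
    simp only [semi, Rop, FPData.extend, if_pos hm, O.gauss_of_mem hσT,
      D.clampS_of_mem ⟨hσT.1.le, hσT.2⟩]
  rw [h1, intervalIntegral.integral_comp_add_right
    (fun r => Real.exp (-lam * (r - p.1)) * O.Rop (r - p.1) (g r) p.2), zero_add, sub_add_cancel]
  rfl

theorem inner_xGrad_eq {g : ℝ → H → ℝ} (hg : D.MemCT g) (hlin : LinGrowth M (D.extend g))
    {u : ℝ × H → ℝ} (hu : ∀ p, u p = O.Gop lam g p) {p : ℝ × H} (hp : p.1 ∈ Icc 0 D.T) (h : H) :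
    ⟪xGrad u p, h⟫_ℝ = O.Γ lam (D.cut (D.extend g)) p h := by
  obtain ⟨v, hv, hΓ⟩ := O.hasGradientAt_U lam hlin.cut p.1
    (fun σ _ => hg.continuous_cut_extend _) p.2
  have h1 : (fun z => u (p.1, z)) = fun z => O.U lam (D.cut (D.extend g)) (p.1, z) := by
    funext z
    rw [hu, O.U_cut_extend lam hlin (p := (p.1, z)) hp]
  rw [xGrad, h1, hv.gradient]
  exact hΓ h

end Identification

end FPData.OUData

theorem integral_sq_le_of_eLpNorm_le {X : Type*} [MeasurableSpace X] {μ : Measure X} {w : X → ℝ}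
    (hw : AEStronglyMeasurable w μ) {ε : ℝ} (hε : 0 ≤ ε) (h : eLpNorm w 2 μ ≤ ENNReal.ofReal ε) :
    ∫ x, w x ^ 2 ∂μ ≤ ε ^ 2 := by
  have hm : MemLp w 2 μ := ⟨hw, h.trans_lt ENNReal.ofReal_lt_top⟩
  rw [hm.eLpNorm_eq_integral_rpow_norm two_ne_zero ENNReal.ofNat_ne_top,
    ENNReal.ofReal_le_ofReal_iff hε] at h
  simp only [ENNReal.toReal_ofNat, Real.rpow_ofNat, Real.norm_eq_abs, sq_abs] at h
  rw [← one_div, ← Real.sqrt_eq_rpow] at h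
  exact (Real.sqrt_le_left hε).mp h

section KernelMeasure

variable {H : Type} [NormedAddCommGroup H] [InnerProductSpace ℝ H] [CompleteSpace H]
  [SecondCountableTopology H] [MeasurableSpace H] [BorelSpace H] {D : FPData H} {s : ℝ}
  {ν : Measure (ℝ × H)} {νt : ℝ → Measure H}

namespace FPData

theorem IsKernel.ae_fst_mem (h : D.IsKernel s ν νt) {N : Set ℝ} (hN : MeasurableSet N)
    (hae : ∀ᵐ t ∂(volume.restrict (Icc s D.T)), t ∈ N) : ∀ᵐ p ∂ν, p.1 ∈ N := by
  rw [ae_iff]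
  change ν {p | p.1 ∈ Nᶜ} = 0
  rw [h.2 {p | p.1 ∈ Nᶜ} (measurable_fst hN.compl)]
  refine (lintegral_congr_ae ?_).trans lintegral_zero
  filter_upwards [hae] with t ht
  simp [ht]

theorem IsKernel.ae_fst_mem_Ico (h : D.IsKernel s ν νt) (hs : 0 ≤ s) :
    ∀ᵐ p ∂ν, p.1 ∈ Ico 0 D.T := by
  refine h.ae_fst_mem measurableSet_Ico ?_
  have hne : ∀ᵐ t : ℝ ∂(volume.restrict (Icc s D.T)), t ≠ D.T :=
    ae_restrict_of_ae (by simp [ae_iff])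
  filter_upwards [hne, ae_restrict_mem measurableSet_Icc] with t ht htm
  exact ⟨hs.trans htm.1, lt_of_le_of_ne htm.2 ht⟩

theorem IsKernel.lintegral_le (h : D.IsKernel s ν νt) {f : ℝ × H → ℝ≥0∞} (hf : Measurable f) :
    ∫⁻ p, f p ∂ν ≤ ∫⁻ t in Icc s D.T, ∫⁻ x, f (t, x) ∂(νt t) := by
  refine Measurable.ennreal_induction (motive := fun f : ℝ × H → ℝ≥0∞ =>
    ∫⁻ p, f p ∂ν ≤ ∫⁻ t in Icc s D.T, ∫⁻ x, f (t, x) ∂(νt t)) ?_ ?_ ?_ hf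
  · intro c E hE
    rw [lintegral_indicator_const hE, h.2 E hE]
    refine (lintegral_const_mul_le c _).trans (lintegral_mono fun t => ?_)
    exact (lintegral_indicator_const (measurable_prodMk_left hE) c).ge
  · intro f g _ hf _ ihf ihg
    simp only [Pi.add_apply]
    rw [lintegral_add_left hf]
    refine (add_le_add ihf ihg).trans ((le_lintegral_add _ _).trans (lintegral_mono fun t => ?_))
    exact le_lintegral_add _ _
  · intro f hf hmono ih
    rw [lintegral_iSup hf hmono]
    refine iSup_le fun n => (ih n).trans (lintegral_mono fun t => lintegral_mono fun x => ?_)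
    exact le_iSup (fun n => f n (t, x)) n

theorem measurable_FnormE (D : FPData H) : Measurable D.FnormE :=
  Measurable.ite D.DF_meas D.F_meas.enorm measurable_const

theorem IsKernel.integrable_moment (h : D.IsKernel s ν νt) (hm : D.moment2 s νt) :
    Integrable (fun p : ℝ × H => ‖p.2‖ ^ 4 + ‖D.F p‖ ^ 2 + ‖p.2‖ ^ 4 * ‖D.F p‖ ^ 2) ν := by
  have hF := D.measurable_FnormE
  have hF' := D.F_meas
  have h1 := (h.lintegral_le (f := fun p => ENNReal.ofReal (‖p.2‖ ^ 4) + D.FnormE p ^ 2 +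
    ENNReal.ofReal (‖p.2‖ ^ 4) * D.FnormE p ^ 2) (by fun_prop)).trans_lt hm
  refine ⟨Measurable.aestronglyMeasurable (by fun_prop), ?_⟩
  refine (lintegral_mono fun p => ?_).trans_lt h1
  rw [Real.enorm_eq_ofReal (by positivity), ENNReal.ofReal_add (by positivity) (by positivity),
    ENNReal.ofReal_add (by positivity) (by positivity), ENNReal.ofReal_mul (by positivity)]
  have h2 : ENNReal.ofReal (‖D.F p‖ ^ 2) ≤ D.FnormE p ^ 2 := by
    rw [ENNReal.ofReal_pow (norm_nonneg _), ofReal_norm]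
    refine pow_le_pow_left₀ zero_le ?_ 2
    unfold FnormE
    split_ifs
    · exact le_rfl
    · exact le_top
  gcongr

theorem IsKernel.memLp_growth [IsFiniteMeasure ν] (h : D.IsKernel s ν νt) (hm : D.moment2 s νt) :
    MemLp (fun p : ℝ × H => (1 + ‖p.2‖) * (1 + ‖D.F p‖)) 2 ν := by
  have hF := D.F_meas
  have h0 : Measurable fun p : ℝ × H => (1 + ‖p.2‖) * (1 + ‖D.F p‖) := by fun_prop
  refine (memLp_two_iff_integrable_sq h0.aestronglyMeasurable).mpr
    ((((integrable_const (1 : ℝ)).add (h.integrable_moment hm)).const_mul 6).mono'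
      (h0.pow_const 2).aestronglyMeasurable (Eventually.of_forall fun p => ?_))
  simp only [Pi.add_apply]
  rw [Real.norm_of_nonneg (by positivity)]
  have h1 : (1 + ‖p.2‖) ^ 2 ≤ 3 * (1 + ‖p.2‖ ^ 4) := by
    nlinarith [sq_nonneg (‖p.2‖ - 1), sq_nonneg (‖p.2‖ ^ 2 - 1)]
  have h2 : (1 + ‖D.F p‖) ^ 2 ≤ 2 * (1 + ‖D.F p‖ ^ 2) := by
    nlinarith [sq_nonneg (‖D.F p‖ - 1)]
  calc ((1 + ‖p.2‖) * (1 + ‖D.F p‖)) ^ 2 = (1 + ‖p.2‖) ^ 2 * (1 + ‖D.F p‖) ^ 2 := mul_pow _ _ _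
    _ ≤ 3 * (1 + ‖p.2‖ ^ 4) * (2 * (1 + ‖D.F p‖ ^ 2)) := by gcongr
    _ = _ := by ring

theorem IsKernel.memLp_time_growth (h : D.IsKernel s ν νt) (hm : D.moment2 s νt) (hs : 0 ≤ s)
    (hT : MemLp (fun p : ℝ × H => D.T - p.1) 2 ν) :
    MemLp (fun p : ℝ × H => (D.T - p.1) * (1 + ‖p.2‖)) 2 ν := by
  have h0 : Measurable fun p : ℝ × H => (D.T - p.1) * (1 + ‖p.2‖) := by fun_prop
  refine (memLp_two_iff_integrable_sq h0.aestronglyMeasurable).mpr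
    (((hT.integrable_sq.const_mul 3).add ((h.integrable_moment hm).const_mul (3 * D.T ^ 2))).mono'
      (h0.pow_const 2).aestronglyMeasurable ?_)
  filter_upwards [h.ae_fst_mem_Ico hs] with p hp
  simp only [Pi.add_apply]
  rw [Real.norm_of_nonneg (by positivity)]
  have h1 : (1 + ‖p.2‖) ^ 2 ≤ 3 * (1 + ‖p.2‖ ^ 4) := by
    nlinarith [sq_nonneg (‖p.2‖ - 1), sq_nonneg (‖p.2‖ ^ 2 - 1)]
  have h2 : (D.T - p.1) ^ 2 ≤ D.T ^ 2 := by
    have := hp.1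
    have := hp.2
    gcongr
    linarith
  have h3 : 0 ≤ ‖D.F p‖ ^ 2 + ‖p.2‖ ^ 4 * ‖D.F p‖ ^ 2 := by positivity
  calc ((D.T - p.1) * (1 + ‖p.2‖)) ^ 2 = (D.T - p.1) ^ 2 * (1 + ‖p.2‖) ^ 2 := mul_pow _ _ _
    _ ≤ (D.T - p.1) ^ 2 * (3 * (1 + ‖p.2‖ ^ 4)) := by gcongr
    _ = 3 * (D.T - p.1) ^ 2 + 3 * (D.T - p.1) ^ 2 * ‖p.2‖ ^ 4 := by ring
    _ ≤ 3 * (D.T - p.1) ^ 2 + 3 * D.T ^ 2 * ‖p.2‖ ^ 4 := by gcongr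
    _ ≤ _ := by
      have h4 : 0 ≤ 3 * D.T ^ 2 * (‖D.F p‖ ^ 2 + ‖p.2‖ ^ 4 * ‖D.F p‖ ^ 2) := by positivity
      linarith

end FPData

end KernelMeasure

namespace FPData.OUData

section DriftEquation

variable {H : Type} [NormedAddCommGroup H] [InnerProductSpace ℝ H] [CompleteSpace H]
  [SecondCountableTopology H] [MeasurableSpace H] [BorelSpace H]
  {D : FPData H} {hyp : D.Hyp31} (O : D.OUData hyp) {M : ℝ} (lam : ℝ)

theorem measurable_U {g : ℝ × H → ℝ} (hg : LinGrowth M g) : Measurable (O.U lam g) := by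
  have h1 : StronglyMeasurable fun q : (ℝ × H) × ℝ =>
      Real.exp (-lam * q.2) * O.semi g q.2 q.1 :=
    (by fun_prop : Continuous fun q : (ℝ × H) × ℝ => Real.exp (-lam * q.2)).stronglyMeasurable.mul
      ((O.stronglyMeasurable_semi hg.1).comp_measurable measurable_swap)
  have h2 : O.U lam g = fun p => ∫ σ in Ioc 0 D.T, Real.exp (-lam * σ) * O.semi g σ p :=
    funext fun p => intervalIntegral.integral_of_le D.hT.le
  rw [h2]
  exact h1.integral_prod_right.measurable

theorem exists_linGrowth_extend {F0 : ℝ × H → H} (hF0 : D.Hyp33 F0) {f : H → ℝ}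
    (hf : ∃ B, ∀ x, |f x| ≤ B) {u : ℝ × H → ℝ} (hu : ∃ B, ∀ p : ℝ × H, p.1 ∈ Icc 0 D.T → |u p| ≤ B)
    (hgrad : D.GradInCTCuHH u) {a b : ℝ} {g : ℝ → H → ℝ} (hg : D.MemCT g)
    (heq : ∀ p : ℝ × H, p.1 ∈ Icc 0 D.T →
      a * u p - (b * u p - g p.1 p.2) - ⟪F0 p, xGrad u p⟫_ℝ = f p.2) :
    ∃ M, LinGrowth M (D.extend g) := by
  obtain ⟨B, hB⟩ := hf
  obtain ⟨B', hB'⟩ := hu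
  obtain ⟨C, hC0, hC⟩ := hF0.exists_norm_le
  obtain ⟨C', hC'⟩ := hgrad.exists_norm_le
  have hB0 : 0 ≤ B := (abs_nonneg _).trans (hB 0)
  have hB0' : 0 ≤ B' := (abs_nonneg _).trans (hB' (0, 0) ⟨le_rfl, D.hT.le⟩)
  have hC0' : 0 ≤ C' := (norm_nonneg _).trans (hC' (0, 0) ⟨le_rfl, D.hT.le⟩)
  refine ⟨B + |b - a| * B' + C * C', hg.measurable_extend, fun p => ?_⟩
  unfold FPData.extend
  split_ifs with hp
  · have h1 : g p.1 p.2 = f p.2 + (b - a) * u p + ⟪F0 p, xGrad u p⟫_ℝ := by linarith [heq p hp]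
    have h2 : |⟪F0 p, xGrad u p⟫_ℝ| ≤ C * (1 + ‖p.2‖) * C' :=
      (abs_real_inner_le_norm _ _).trans
        (mul_le_mul (hC p hp) (hC' p hp) (norm_nonneg _) (by positivity))
    have h3 : |(b - a) * u p| ≤ |b - a| * B' := by
      rw [abs_mul]
      exact mul_le_mul_of_nonneg_left (hB' p hp) (abs_nonneg _)
    have h4 := abs_add_three (f p.2) ((b - a) * u p) ⟪F0 p, xGrad u p⟫_ℝ
    have h5 : 0 ≤ (B + |b - a| * B') * ‖p.2‖ := by positivity
    rw [h1]
    linarith [hB p.2]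
  · rw [abs_zero]
    positivity

/-- On `[0,T)` the resolvent pair of `g` consists of the solution and of the value of the
operator there. -/
theorem resPair_cut_extend {F0 : ℝ × H → H} {f : H → ℝ} {u : ℝ × H → ℝ} {a : ℝ} {g : ℝ → H → ℝ}
    (hg : D.MemCT g) (hlin : LinGrowth M (D.extend g)) (hu : ∀ p, u p = O.Gop lam g p)
    (heq : ∀ p : ℝ × H, p.1 ∈ Icc 0 D.T →
      a * u p - (lam * u p - g p.1 p.2) - ⟪F0 p, xGrad u p⟫_ℝ = f p.2)
    {p : ℝ × H} (hp : p.1 ∈ Ico 0 D.T) :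
    O.resPair lam (D.cut (D.extend g)) p =
      (u p, a * u p - f p.2 - ⟪F0 p - D.F p, xGrad u p⟫_ℝ) := by
  have hp' : p.1 ∈ Icc 0 D.T := Ico_subset_Icc_self hp
  have h1 : D.cut (D.extend g) p = g p.1 p.2 := by
    rw [FPData.cut, if_pos hp.2, FPData.extend, if_pos hp']
  rw [resPair, O.U_cut_extend lam hlin hp', ← hu, h1, ← O.inner_xGrad_eq lam hg hlin hu hp',
    Prod.mk.injEq]
  refine ⟨rfl, ?_⟩
  rw [inner_sub_left, ← heq p hp', real_inner_comm (D.F p)]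
  ring

end DriftEquation

end FPData.OUData

section Measurability

variable {H : Type} [NormedAddCommGroup H] [InnerProductSpace ℝ H] [CompleteSpace H]
  [SecondCountableTopology H] [MeasurableSpace H] [BorelSpace H] {D : FPData H}

theorem FPData.GradInCTCuHH.continuousOn {u : ℝ × H → ℝ} (hu : D.GradInCTCuHH u) :
    ContinuousOn (xGrad u) (Icc 0 D.T ×ˢ univ) := by
  rintro ⟨t₀, x₀⟩ ⟨ht₀, -⟩
  have h1 : Tendsto (fun p : ℝ × H => xGrad u (t₀, p.2)) (𝓝[Icc 0 D.T ×ˢ univ] (t₀, x₀))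
      (𝓝 (xGrad u (t₀, x₀))) :=
    (((hu.1 t₀ ht₀).1.continuous.comp continuous_snd).tendsto (t₀, x₀)).mono_left
      nhdsWithin_le_nhds
  have h2 : Tendsto (fun p : ℝ × H => xGrad u p - xGrad u (t₀, p.2))
      (𝓝[Icc 0 D.T ×ˢ univ] (t₀, x₀)) (𝓝 0) := by
    rw [Metric.tendsto_nhds]
    intro ε hε
    obtain ⟨δ, hδ, hδ'⟩ := hu.2 t₀ ht₀ (ε / 2) (by positivity)
    have h4 : ∀ᶠ p : ℝ × H in 𝓝 (t₀, x₀), |p.1 - t₀| < δ :=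
      ContinuousAt.eventually_lt (f := fun p : ℝ × H => |p.1 - t₀|) (by fun_prop)
        continuousAt_const (by simpa using hδ)
    filter_upwards [h4.filter_mono nhdsWithin_le_nhds, self_mem_nhdsWithin] with p hp4 hp
    rw [dist_zero_right]
    exact (hδ' _ hp.1 hp4 _).trans_lt (by linarith)
  simpa [ContinuousWithinAt] using h2.add h1

theorem aestronglyMeasurable_of_continuousOn {E : Type*} [NormedAddCommGroup E]
    [SecondCountableTopology E] {ν : Measure (ℝ × H)} (hν : ∀ᵐ p ∂ν, p.1 ∈ Icc 0 D.T)
    {Φ : ℝ × H → E} (hΦ : ContinuousOn Φ (Icc 0 D.T ×ˢ univ)) : AEStronglyMeasurable Φ ν := by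
  have hs : MeasurableSet (Icc 0 D.T ×ˢ (univ : Set H)) := measurableSet_Icc.prod MeasurableSet.univ
  have h1 : ν.restrict (Icc 0 D.T ×ˢ (univ : Set H)) = ν :=
    Measure.restrict_eq_self_of_ae_mem (hν.mono fun p hp => ⟨hp, mem_univ _⟩)
  rw [← h1]
  exact hΦ.aestronglyMeasurable hs

end Measurability

section NotMemLp

variable {X : Type*} [MeasurableSpace X] {μ : Measure X} {f g a b : X → ℝ}

theorem eq_of_memLp_mul_add (hf : ¬ MemLp f 2 μ) {c c' : ℝ}
    (h : MemLp (fun x => c * f x + a x) 2 μ) (h' : MemLp (fun x => c' * f x + a x) 2 μ) :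
    c = c' := by
  by_contra hne
  have h1 := (h.sub h').const_mul (c - c')⁻¹
  have h2 : (fun x => (c - c')⁻¹ * ((fun x => c * f x + a x) - fun x => c' * f x + a x) x) = f := by
    funext x
    have h3 : c - c' ≠ 0 := sub_ne_zero.mpr hne
    simp only [Pi.sub_apply]
    field_simp
    ring
  exact hf (h2 ▸ h1)

theorem exists_not_memLp (hf : ¬ MemLp f 2 μ) (hg : ¬ MemLp g 2 μ) (a b : X → ℝ) :
    ∃ c : ℝ, ¬ MemLp (fun x => c * f x + a x) 2 μ ∧ ¬ MemLp (fun x => c * g x + b x) 2 μ := by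
  obtain ⟨c, hc⟩ := ((Set.Subsingleton.finite (s := {c : ℝ | MemLp (fun x => c * f x + a x) 2 μ})
    fun _ h _ h' => eq_of_memLp_mul_add hf h h').union (Set.Subsingleton.finite
      (s := {c : ℝ | MemLp (fun x => c * g x + b x) 2 μ})
      fun _ h _ h' => eq_of_memLp_mul_add hg h h')).exists_notMem
  exact ⟨c, fun h => hc (.inl h), fun h => hc (.inr h)⟩

theorem exists_small_not_memLp (hf : ¬ MemLp f 2 μ) (a : X → ℝ) {δ : ℝ} (hδ : 0 < δ) :
    ∃ c : ℝ, |c| ≤ 2 * δ ∧ ¬ MemLp (fun x => c * f x + a x) 2 μ := by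
  by_cases h : MemLp (fun x => δ * f x + a x) 2 μ
  · refine ⟨2 * δ, (abs_of_pos (by positivity)).le, fun h' => ?_⟩
    linarith [eq_of_memLp_mul_add hf h h']
  · exact ⟨δ, by rw [abs_of_pos hδ]; linarith, h⟩

theorem integral_sq_eq_zero_of_not_memLp (hf : AEStronglyMeasurable f μ) (h : ¬ MemLp f 2 μ) :
    ∫ x, f x ^ 2 ∂μ = 0 :=
  integral_undef (mt (memLp_two_iff_integrable_sq hf).mpr h)

end NotMemLp

theorem tendsto_integral_sq_of_eLpNorm_le {X : Type*} [MeasurableSpace X] {μ : Measure X}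
    {w : ℕ → X → ℝ} (hw : ∀ n, AEStronglyMeasurable (w n) μ) {ε : ℕ → ℝ} (hε0 : ∀ n, 0 ≤ ε n)
    (hε : Tendsto ε atTop (𝓝 0)) (h : ∀ n, eLpNorm (w n) 2 μ ≤ ENNReal.ofReal (ε n)) :
    Tendsto (fun n => ∫ x, w n x ^ 2 ∂μ) atTop (𝓝 0) := by
  have h1 : Tendsto (fun n => ε n ^ 2) atTop (𝓝 0) := by simpa using hε.pow 2
  exact squeeze_zero (fun n => integral_nonneg fun x => sq_nonneg _)
    (fun n => integral_sq_le_of_eLpNorm_le (hw n) (hε0 n) (h n)) h1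

namespace FPData

section Approximation

variable {H : Type} [NormedAddCommGroup H] [InnerProductSpace ℝ H] [CompleteSpace H]
  [SecondCountableTopology H] [MeasurableSpace H] [BorelSpace H] {D : FPData H}
  {ν : Measure (ℝ × H)} {a b : ℝ × H → ℝ}

theorem measurable_of_mem_testPairs {v : ℝ × H → ℝ × ℝ} (hv : v ∈ D.testPairs) :
    Measurable v := by
  induction hv using Submodule.span_induction with
  | mem v hv =>
    obtain ⟨φ, k, a, c, hφ, -, -, rfl⟩ := hv
    have h1 := hφ.continuous
    have h2 := hφ.continuous_deriv le_rfl
    have h3 := D.F_meas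
    unfold kolmogorovCos
    fun_prop
  | zero => exact measurable_const
  | add v w _ _ hv hw => exact hv.add hw
  | smul c v _ hv => exact hv.const_smul c

theorem time_mem_testPairs : (fun p : ℝ × H => (D.T - p.1, (-1 : ℝ))) ∈ D.testPairs := by
  refine Submodule.subset_span ⟨fun t => D.T - t, 0, 0, 0, by fun_prop, sub_self _,
    D.A.adjoint.graph.zero_mem, ?_⟩
  funext p
  simp [kolmogorovCos]

/-- Approximability of the pair `(a, b)` by test functions and their images under `L₀`. -/
def Approximable (D : FPData H) (ν : Measure (ℝ × H)) (a b : ℝ × H → ℝ) : Prop :=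
  ∃ un : ℕ → ℝ × H → ℝ, (∀ n, un n ∈ D.EA) ∧
    Tendsto (fun n => ∫ p, (un n p - a p) ^ 2 ∂ν) atTop (𝓝 0) ∧
    Tendsto (fun n => ∫ p, (D.Lzero (un n) p - b p) ^ 2 ∂ν) atTop (𝓝 0)

theorem Approximable.of_testPairs {v : ℕ → ℝ × H → ℝ × ℝ} (hv : ∀ n, v n ∈ D.testPairs)
    (h1 : Tendsto (fun n => ∫ p, ((v n p).1 - a p) ^ 2 ∂ν) atTop (𝓝 0))
    (h2 : Tendsto (fun n => ∫ p, ((v n p).2 - b p) ^ 2 ∂ν) atTop (𝓝 0)) :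
    D.Approximable ν a b := by
  have h3 : ∀ n p, D.Lzero (fun p => (v n p).1) p = (v n p).2 := fun n p =>
    (D.EA_and_hasKolmogorov_of_mem (hv n)).2.Lzero_eq p
  exact ⟨fun n p => (v n p).1, fun n => (D.EA_and_hasKolmogorov_of_mem (hv n)).1, h1,
    by simpa only [h3] using h2⟩

theorem Approximable.of_inL2Closure (h : InL2Closure D.testPairs ν fun p => (a p, b p)) :
    D.Approximable ν a b := by
  have hε0 : ∀ n : ℕ, (0 : ℝ) < 1 / (n + 1) := fun n => by positivity
  choose v hv hvm hle using fun n : ℕ => h.2 (ENNReal.ofReal (1 / (n + 1)))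
    (ENNReal.ofReal_pos.mpr (hε0 n)).ne'
  have hm := fun n => (hvm n).sub h.1
  refine .of_testPairs hv
    (tendsto_integral_sq_of_eLpNorm_le (fun n => continuous_fst.comp_aestronglyMeasurable (hm n))
      (fun n => (hε0 n).le) tendsto_one_div_add_atTop_nhds_zero_nat fun n =>
        (eLpNorm_mono fun p => ?_).trans (hle n))
    (tendsto_integral_sq_of_eLpNorm_le (fun n => continuous_snd.comp_aestronglyMeasurable (hm n))
      (fun n => (hε0 n).le) tendsto_one_div_add_atTop_nhds_zero_nat fun n =>
        (eLpNorm_mono fun p => ?_).trans (hle n))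
  · exact norm_fst_le ((v n - fun p => (a p, b p)) p)
  · exact norm_snd_le ((v n - fun p => (a p, b p)) p)

/-- The space of first components of test pairs. -/
def testSpace (D : FPData H) : Submodule ℝ (ℝ × H → ℝ) :=
  D.testPairs.map ((LinearMap.fst ℝ ℝ ℝ).compLeft (ℝ × H))

theorem mul_cos_mem_testSpace {φ : ℝ → ℝ} (hφ : ContDiff ℝ 1 φ) (hφT : φ D.T = 0) {k a : H}
    (hk : (k, a) ∈ D.A.adjoint.graph) (c : ℝ) :
    (fun p : ℝ × H => φ p.1 * Real.cos (⟪p.2, k⟫_ℝ + c)) ∈ D.testSpace :=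
  ⟨_, Submodule.subset_span ⟨φ, k, a, c, hφ, hφT, hk, rfl⟩, rfl⟩

theorem inL2Closure_time_mul {M : ℝ} (hT : MemLp (fun p : ℝ × H => (D.T - p.1) * (1 + ‖p.2‖)) 2 ν)
    {g : ℝ × H → ℝ} (hg : LinGrowth M g) :
    InL2Closure D.testSpace ν fun p => (D.T - p.1) * g p := by
  refine D.linGrowth_induction
    (fun g => InL2Closure D.testSpace ν fun p => (D.T - p.1) * g p) ?_ ?_ ?_ ?_ hg
  · intro b k hk c
    have hk' := LinearPMap.mem_graph D.A.adjoint ⟨k, hk⟩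
    have h1 := mul_cos_mem_testSpace (D := D) (φ := fun t => (D.T - t) * Real.cos (b * t))
      (by fun_prop) (by simp) hk' c
    have h2 := mul_cos_mem_testSpace (D := D) (φ := fun t => (D.T - t) * Real.sin (b * t))
      (by fun_prop) (by simp) hk' (c + Real.pi / 2)
    have h3 := (InL2Closure.of_mem (μ := ν) h1
      (Continuous.aestronglyMeasurable (by fun_prop))).add
      (.of_mem h2 (Continuous.aestronglyMeasurable (by fun_prop)))
    refine h3.congr_ae (Eventually.of_forall fun p => ?_)
    simp only [cos_add_inner, Pi.add_apply]
    ring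
  · intro M N f g _ _ h1 h2
    refine (h1.add h2).congr_ae (Eventually.of_forall fun p => ?_)
    simp only [Pi.add_apply]
    ring
  · intro c M f _ h
    refine (h.smul c).congr_ae (Eventually.of_forall fun p => ?_)
    simp only [Pi.smul_apply, smul_eq_mul]
    ring
  · intro M f g hf _ h hlim
    refine .of_tendsto h (hT.norm.const_mul M) (fun n => Eventually.of_forall fun p => ?_)
      (Eventually.of_forall fun p => (hlim p).const_mul _)
    rw [norm_mul, norm_mul, Real.norm_eq_abs (f n p), Real.norm_of_nonneg
      (by positivity : 0 ≤ 1 + ‖p.2‖)]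
    calc ‖D.T - p.1‖ * |f n p| ≤ ‖D.T - p.1‖ * (M * (1 + ‖p.2‖)) := by
          gcongr
          exact (hf n).2 p
      _ = _ := by ring

theorem not_memLp_neg_one (hν : ¬ IsFiniteMeasure ν) : ¬ MemLp (fun _ : ℝ × H => (-1 : ℝ)) 2 ν := by
  rw [memLp_const_iff two_ne_zero ENNReal.ofNat_ne_top]
  rintro (h | h)
  · norm_num at h
  · exact hν ⟨h⟩

theorem Approximable.of_not_memLp_time (hν : ¬ IsFiniteMeasure ν)
    (hT : ¬ MemLp (fun p : ℝ × H => D.T - p.1) 2 ν)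
    (ha : AEStronglyMeasurable a ν) (hb : AEStronglyMeasurable b ν) : D.Approximable ν a b := by
  obtain ⟨c, h1, h2⟩ := exists_not_memLp hT (not_memLp_neg_one hν) (fun p => -a p) fun p => -b p
  refine .of_testPairs (v := fun _ => c • fun p : ℝ × H => (D.T - p.1, (-1 : ℝ)))
    (fun _ => D.testPairs.smul_mem c time_mem_testPairs) ?_ ?_
  · have h3 : ∫ p, (c * (D.T - p.1) - a p) ^ 2 ∂ν = 0 := integral_sq_eq_zero_of_not_memLp
      ((Continuous.aestronglyMeasurable (by fun_prop)).sub ha)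
      (by simpa only [← sub_eq_add_neg] using h1)
    simp only [Pi.smul_apply, Prod.smul_mk, smul_eq_mul, h3]
    exact tendsto_const_nhds
  · have h3 : ∫ p, (c * -1 - b p) ^ 2 ∂ν = 0 := integral_sq_eq_zero_of_not_memLp
      (aestronglyMeasurable_const.sub hb) (by simpa only [← sub_eq_add_neg] using h2)
    simp only [Pi.smul_apply, Prod.smul_mk, smul_eq_mul, h3]
    exact tendsto_const_nhds

theorem Approximable.of_memLp_time (hν : ¬ IsFiniteMeasure ν)
    (hT : MemLp (fun p : ℝ × H => D.T - p.1) 2 ν)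
    (ha : InL2Closure D.testSpace ν a) (hb : AEStronglyMeasurable b ν) :
    D.Approximable ν a b := by
  have hε0 : ∀ n : ℕ, (0 : ℝ) < 1 / (n + 1) := fun n => by positivity
  have key : ∀ n : ℕ, ∃ v ∈ D.testPairs,
      eLpNorm (fun p => (v p).1 - a p) 2 ν ≤ ENNReal.ofReal (1 / (n + 1)) := by
    intro n
    obtain ⟨_, ⟨v, hv, rfl⟩, -, hle⟩ := ha.2 (ENNReal.ofReal (1 / (n + 1)))
      (ENNReal.ofReal_pos.mpr (hε0 n)).ne'
    exact ⟨v, hv, hle⟩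
  choose v hv hle using key
  choose c hc hcL using fun n => exists_small_not_memLp (not_memLp_neg_one hν)
    (fun p => (v n p).2 - b p) (hε0 n)
  have hvm := fun n => measurable_of_mem_testPairs (hv n)
  have hτ : Measurable fun p : ℝ × H => D.T - p.1 := by fun_prop
  refine .of_testPairs (v := fun n => v n + c n • fun p : ℝ × H => (D.T - p.1, (-1 : ℝ)))
    (fun n => D.testPairs.add_mem (hv n) (D.testPairs.smul_mem _ time_mem_testPairs)) ?_ ?_
  · have h1 : ∀ n, AEStronglyMeasurable (fun p => (v n p).1 - a p) ν := fun n =>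
      (hvm n).fst.aestronglyMeasurable.sub ha.1
    have h2 : ∀ n, AEStronglyMeasurable (fun p : ℝ × H => c n * (D.T - p.1)) ν := fun n =>
      (hτ.const_mul _).aestronglyMeasurable
    set K := (eLpNorm (fun p : ℝ × H => D.T - p.1) 2 ν).toReal with hK
    have hK' : eLpNorm (fun p : ℝ × H => D.T - p.1) 2 ν = ENNReal.ofReal K :=
      (ENNReal.ofReal_toReal hT.2.ne).symm
    have h3 := tendsto_integral_sq_of_eLpNorm_le (μ := ν)
      (w := fun n p => ((v n p).1 - a p) + c n * (D.T - p.1)) (fun n => (h1 n).add (h2 n))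
      (ε := fun n : ℕ => 1 / ((n : ℝ) + 1) * (1 + 2 * K)) (fun n => by positivity)
      (by simpa using tendsto_one_div_add_atTop_nhds_zero_nat.mul_const (1 + 2 * K)) fun n => ?_
    · refine h3.congr fun n => integral_congr_ae (Eventually.of_forall fun p => ?_)
      simp only [Pi.add_apply, Pi.smul_apply, Prod.smul_mk, smul_eq_mul, Prod.fst_add]
      ring
    · refine (eLpNorm_add_le (h1 n) (h2 n) one_le_two).trans ?_
      have h4 : eLpNorm (fun p : ℝ × H => c n * (D.T - p.1)) 2 ν ≤
          ENNReal.ofReal (2 * (1 / (n + 1)) * K) := by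
        refine (eLpNorm_const_smul_le (c := c n) (f := fun p : ℝ × H => D.T - p.1)).trans ?_
        rw [hK', ENNReal.ofReal_mul (by positivity), Real.enorm_eq_ofReal_abs]
        gcongr
        exact hc n
      refine (add_le_add (hle n) h4).trans (le_of_eq ?_)
      rw [← ENNReal.ofReal_add (by positivity) (by positivity)]
      congr 1
      ring
  · have h3 : ∀ n, ∫ p, (((v n + c n • fun p : ℝ × H => (D.T - p.1, (-1 : ℝ))) p).2 - b p) ^ 2
        ∂ν = 0 := by
      intro n
      rw [← integral_sq_eq_zero_of_not_memLp ((aestronglyMeasurable_const (b := c n * (-1 : ℝ))).add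
        ((hvm n).snd.aestronglyMeasurable.sub hb)) (hcL n)]
      refine integral_congr_ae (Eventually.of_forall fun p => ?_)
      simp only [Pi.add_apply, Pi.sub_apply, Pi.smul_apply, Prod.smul_mk, smul_eq_mul, Prod.snd_add]
      ring
    simp only [h3]
    exact tendsto_const_nhds

end Approximation

end FPData
namespace FPData.OUData

variable {H : Type} [NormedAddCommGroup H] [InnerProductSpace ℝ H] [CompleteSpace H]
  [SecondCountableTopology H] [MeasurableSpace H] [BorelSpace H]
  {D : FPData H} {hyp : D.Hyp31}

theorem linGrowth_U_div (O : D.OUData hyp) {M : ℝ} (lam : ℝ) {g : ℝ × H → ℝ} (hg : LinGrowth M g) :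
    LinGrowth (D.expB lam * (M * O.growth)) fun p =>
      if p.1 ∈ Ico 0 D.T then O.U lam (D.cut g) p / (D.T - p.1) else 0 := by
  have hU := O.measurable_U lam (hg.cut (D := D))
  refine ⟨Measurable.ite (measurable_fst measurableSet_Ico) (hU.div (by fun_prop))
    measurable_const, fun p => ?_⟩
  beta_reduce
  split_ifs with hp
  · have h0 : 0 < D.T - p.1 := sub_pos.mpr hp.2
    rw [abs_div, abs_of_pos h0, div_le_iff₀ h0]
    linarith [O.abs_U_cut_le lam hg (Ico_subset_Icc_self hp)]
  · rw [abs_zero]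
    have h2 := (abs_nonneg _).trans (O.abs_U_cut_le lam hg (p := (0, p.2)) ⟨le_rfl, D.hT.le⟩)
    rw [sub_zero] at h2
    exact nonneg_of_mul_nonneg_right h2 D.hT

end FPData.OUData

section Theorems

open MeasureTheory Set Filter Topology
open scoped InnerProductSpace ENNReal NNReal

variable {H : Type} [NormedAddCommGroup H] [InnerProductSpace ℝ H] [CompleteSpace H]
  [SecondCountableTopology H] [MeasurableSpace H] [BorelSpace H]

/-- Lemma 4.5(i): `u₀ ∈ D(L^ν)` and
`λu₀ - L^ν u₀ = f + ⟨F₀ - F, D_x u₀⟩` in `L²([s,T] × H; ν)`, where `L^ν` is the closure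
of `(L₀, E_A)` in `L²(ν)`; membership in the closure is expressed through an approximating
sequence in `E_A`. -/
theorem statement17 (D : FPData H) (hyp : D.Hyp31) (O : D.OUData hyp)
    (lam s : ℝ) (hlam : 0 < lam) (hs : s ∈ Icc 0 D.T)
    (ν : Measure (ℝ × H)) (νt : ℝ → Measure H)
    (hν : D.IsSubInv lam s ν νt) (hmom : D.moment2 s νt)
    (F0 : ℝ × H → H) (hF0 : D.Hyp33 F0)
    (f : H → ℝ) (hf : MemC1u f)
    (u₀ : ℝ × H → ℝ) (lam₁ : ℝ) (g : ℝ → H → ℝ) (hg : D.MemCT g)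
    (hrep : ∀ p : ℝ × H, u₀ p = O.Gop lam₁ g p)
    (hgradcont : D.GradInCTCuHH u₀)
    (hbound : ∀ M : ℝ, (∀ x : H, |f x| ≤ M) →
      ∀ p : ℝ × H, p.1 ∈ Icc 0 D.T → |u₀ p| ≤ M / lam)
    (heq : ∀ p : ℝ × H, p.1 ∈ Icc 0 D.T →
      lam * u₀ p - (lam₁ * u₀ p - g p.1 p.2) - ⟪F0 p, xGrad u₀ p⟫_ℝ = f p.2) :
    ∃ un : ℕ → ℝ × H → ℝ, (∀ n, un n ∈ D.EA) ∧
      Tendsto (fun n => ∫ p, (un n p - u₀ p) ^ 2 ∂ν) atTop (𝓝 0) ∧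
      Tendsto (fun n => ∫ p, (D.Lzero (un n) p -
          (lam * u₀ p - f p.2 - ⟪F0 p - D.F p, xGrad u₀ p⟫_ℝ)) ^ 2 ∂ν)
        atTop (𝓝 0) := by
  have hker := hν.2.1
  have hae := hker.ae_fst_mem_Ico hs.1
  have hae' : ∀ᵐ p ∂ν, p.1 ∈ Icc 0 D.T := hae.mono fun p hp => Ico_subset_Icc_self hp
  obtain ⟨M, hlin⟩ := FPData.OUData.exists_linGrowth_extend hF0 hf.2.1
    (hf.2.1.imp' (fun B => B / lam) hbound) hgradcont hg heq
  have hpair : ∀ᵐ p ∂ν, O.resPair lam₁ (D.cut (D.extend g)) p =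
      (u₀ p, lam * u₀ p - f p.2 - ⟪F0 p - D.F p, xGrad u₀ p⟫_ℝ) :=
    hae.mono fun p hp => O.resPair_cut_extend lam₁ hg hlin hrep heq hp
  have hU := O.measurable_U lam₁ (hlin.cut (D := D))
  have hu : AEStronglyMeasurable u₀ ν :=
    hU.aestronglyMeasurable.congr (hpair.mono fun p hp => congrArg Prod.fst hp)
  have hb : AEStronglyMeasurable
      (fun p => lam * u₀ p - f p.2 - ⟪F0 p - D.F p, xGrad u₀ p⟫_ℝ) ν :=
    ((hu.const_mul lam).sub (hf.1.continuous.comp continuous_snd).aestronglyMeasurable).sub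
      (((aestronglyMeasurable_of_continuousOn hae' hF0.1).sub
        D.F_meas.aestronglyMeasurable).inner
          (aestronglyMeasurable_of_continuousOn hae' hgradcont.continuousOn))
  change D.Approximable ν u₀ fun p => lam * u₀ p - f p.2 - ⟪F0 p - D.F p, xGrad u₀ p⟫_ℝ
  by_cases hfin : IsFiniteMeasure ν
  · exact .of_inL2Closure ((O.inL2Closure_resPair lam₁ hae' (hker.memLp_growth hmom) hlin).congr_ae
      hpair)
  by_cases hT : MemLp (fun p : ℝ × H => D.T - p.1) 2 ν
  · have hv := O.linGrowth_U_div lam₁ hlin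
    refine .of_memLp_time hfin hT ((FPData.inL2Closure_time_mul
      (hker.memLp_time_growth hmom hs.1 hT) hv).congr_ae ?_) hb
    filter_upwards [hpair, hae] with p hp hpT
    have h0 : D.T - p.1 ≠ 0 := (sub_pos.mpr hpT.2).ne'
    rw [if_pos hpT, mul_div_cancel₀ _ h0]
    exact congrArg Prod.fst hp
  · exact .of_not_memLp_time hfin hT hu hb

end Theorems
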